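/- arXiv:1304.6896 — 2 statements merged into one kernel-verified Lean document; each statement's English description precedes it below -/
import Mathlib

section
/- Every 1-planar graph with minimum degree 7 contains a copy of K₄ on vertices of degrees d₁ ≤ d₂ ≤ d₃ ≤ d₄ satisfying d₁ = 7, d₂ ≤ 8, d₃ ≤ 8, and d₄ ≤ 10, or with all four degrees at most 8. -/
/-- A 1-planar drawing of a simple graph in the plane: vertices at distinct
points, each edge an injective continuous arc between the images of its
endpoints, arc interiors avoiding vertices, any two arcs crossing in at most
one interior point, and every edge crossing at most one other edge. -/
structure OnePlanarDrawing {V : Type*} (G : SimpleGraph V) where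
  pos : V → ℝ × ℝ
  pos_inj : Function.Injective pos
  arc : G.edgeSet → ℝ → ℝ × ℝ
  arc_cont : ∀ e, ContinuousOn (arc e) (Set.Icc 0 1)
  arc_inj : ∀ e, Set.InjOn (arc e) (Set.Icc 0 1)
  arc_ends : ∀ e : G.edgeSet, ∃ u v : V, (e : Sym2 V) = s(u, v) ∧
      arc e 0 = pos u ∧ arc e 1 = pos v
  arc_avoids : ∀ e, ∀ t ∈ Set.Ioo (0 : ℝ) 1, arc e t ∉ Set.range pos
  crossings_subsingleton : ∀ e f : G.edgeSet, e ≠ f →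
      (arc e '' Set.Ioo 0 1 ∩ arc f '' Set.Ioo 0 1).Subsingleton
  at_most_one_crossing : ∀ e : G.edgeSet,
      {f : G.edgeSet | f ≠ e ∧
        (arc e '' Set.Ioo 0 1 ∩ arc f '' Set.Ioo 0 1).Nonempty}.Subsingleton

/-- A graph is 1-planar if it admits a drawing in the plane in which every
edge crosses at most one other edge. -/
def SimpleGraph.IsOnePlanar {V : Type*} (G : SimpleGraph V) : Prop :=
  Nonempty (OnePlanarDrawing G)

/-- An injective self-map induces a permutation on a finite family of recurrent points, by sending
each of them to the first one met afterwards. -/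
theorem exists_firstReturn {X D : Type*} [Finite D] {f : X → X} (hf : f.Injective) {c : D → X}
    (hc : c.Injective) (hr : ∀ d, ∃ n, f^[n + 1] (c d) ∈ Set.range c) :
    ∃ τ : Equiv.Perm D, ∀ d, ∃ n, f^[n + 1] (c d) = c (τ d) ∧
      ∀ m < n, f^[m + 1] (c d) ∉ Set.range c := by
  classical
  have key : ∀ d, ∃ e n, f^[n + 1] (c d) = c e ∧ ∀ m < n, f^[m + 1] (c d) ∉ Set.range c := by
    intro d
    obtain ⟨e, he⟩ := Nat.find_spec (hr d)
    exact ⟨e, Nat.find (hr d), he.symm, fun m hm => Nat.find_min (hr d) hm⟩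
  choose t n ht hn using key
  have main : ∀ d d', n d ≤ n d' → t d = t d' → d = d' := by
    intro d d' hle h
    have h1 : f^[n d + 1] (c d) = f^[n d + 1] (f^[n d' - n d] (c d')) := by
      rw [← Function.iterate_add_apply, ht, h, ← ht]
      congr 1
      omega
    have h2 := hf.iterate _ h1
    rcases Nat.eq_zero_or_pos (n d' - n d) with h0 | h0
    · rw [h0] at h2
      exact hc h2
    · exact absurd ⟨d, by rw [h2]; congr 1; omega⟩ (hn d' (n d' - n d - 1) (by omega))
  have hinj : t.Injective := fun d d' h => by
    rcases le_total (n d) (n d') with hle | hle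
    · exact main d d' hle h
    · exact (main d' d hle h.symm).symm
  exact ⟨Equiv.ofBijective t (Finite.injective_iff_bijective.1 hinj),
    fun d => ⟨n d, ht d, hn d⟩⟩

theorem sameCycle_of_firstReturn {X D : Type*} {f : X → X} {c : D → X} (hc : c.Injective)
    {τ : Equiv.Perm D} (hτ : ∀ d, ∃ n, f^[n + 1] (c d) = c (τ d) ∧
      ∀ m < n, f^[m + 1] (c d) ∉ Set.range c) (k : ℕ) (d e : D) (h : f^[k] (c d) = c e) :
    τ.SameCycle d e := by
  induction k using Nat.strong_induction_on generalizing d with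
  | _ k ih =>
    rcases k with _ | k
    · rw [hc h]
    · obtain ⟨n, hn, hm⟩ := hτ d
      have hle : n ≤ k := by
        by_contra! hlt
        exact hm k hlt ⟨e, h.symm⟩
      have h1 : f^[k - n] (c (τ d)) = c e := by
        rw [← hn, ← Function.iterate_add_apply, ← h]
        congr 1
        omega
      exact (Equiv.Perm.sameCycle_apply_left).1 (ih (k - n) (by omega) (τ d) h1)

theorem sameCycle_invariant {D M : Type*} [Finite D] {φ : Equiv.Perm D} {k : D → M}
    (hk : ∀ d, k (φ d) = k d) {x y : D} (h : φ.SameCycle x y) : k x = k y := by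
  obtain ⟨n, -, rfl⟩ := h.exists_pow_eq'
  clear h
  induction n with
  | zero => rfl
  | succ n ih => rw [pow_succ', Equiv.Perm.mul_apply, hk, ih]

/-- Reachability under iteration of a self-map. -/
def Reach {X : Type*} (f : X → X) : X → X → Prop :=
  Relation.ReflTransGen fun x y => f x = y

theorem Reach.step {X : Type*} (f : X → X) (x : X) : Reach f x (f x) :=
  Relation.ReflTransGen.single rfl

theorem Reach.exists_iterate {X : Type*} {f : X → X} {x y : X} (h : Reach f x y) :
    ∃ n, f^[n] x = y := by
  induction h with
  | refl => exact ⟨0, rfl⟩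
  | tail _ hs ih =>
    obtain ⟨n, rfl⟩ := ih
    exact ⟨n + 1, (Function.iterate_succ_apply' f n _).trans hs⟩

/-- If `A` and `B` are disjoint invariant sets in which any two points reach each other, then
exchanging the values of the map at a point of `A` and a point of `B` merges them. -/
theorem Reach.merge {X : Type*} [DecidableEq X] {f g : X → X} {A B : X → Prop} {a b : X}
    (hA : ∀ x, A x → A (f x)) (hB : ∀ x, B x → B (f x)) (hAB : ∀ x, A x → ¬ B x)
    (hAr : ∀ x y, A x → A y → Reach f x y) (hBr : ∀ x y, B x → B y → Reach f x y)
    (ha : A a) (hb : B b) (hg : ∀ x, x ≠ a → x ≠ b → g x = f x) (hga : g a = f b)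
    (hgb : g b = f a) (x y : X) (hx : A x ∨ B x) (hy : A y ∨ B y) : Reach g x y := by
  have toA : ∀ x, A x → Reach g x a := by
    intro x hx
    have h := hAr x a hx ha
    induction h using Relation.ReflTransGen.head_induction_on with
    | refl => exact .refl
    | @head x z h _ ih =>
      rcases eq_or_ne x a with rfl | hxa
      · exact .refl
      · refine .head ((hg x hxa fun h => hAB x hx (h ▸ hb)).trans h) (ih (h ▸ hA x hx))
  have toB : ∀ x, B x → Reach g x b := by
    intro x hx
    have h := hBr x b hx hb
    induction h using Relation.ReflTransGen.head_induction_on with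
    | refl => exact .refl
    | @head x z h _ ih =>
      rcases eq_or_ne x b with rfl | hxb
      · exact .refl
      · refine .head ((hg x (fun h => hAB x (h ▸ ha) hx) hxb).trans h) (ih (h ▸ hB x hx))
  have a_fb : Reach g a (f b) := hga ▸ Reach.step g a
  have b_fa : Reach g b (f a) := hgb ▸ Reach.step g b
  have ab : Reach g a b := a_fb.trans (toB _ (hB b hb))
  have ba : Reach g b a := b_fa.trans (toA _ (hA a ha))
  have fromA : ∀ y, A y → Reach g a y := by
    intro y hy
    have h := hAr (f a) y (hA a ha) hy
    induction h with
    | refl => exact ab.trans b_fa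
    | @tail z w h hs ih =>
      have hz : A z := by
        clear ih hs hy
        induction h with
        | refl => exact hA a ha
        | tail _ hs ih => exact hs ▸ hA _ ih
      rcases eq_or_ne z a with rfl | hza
      · exact hs ▸ ab.trans b_fa
      · exact (ih hz).tail ((hg z hza fun h => hAB z hz (h ▸ hb)).trans hs)
  have fromB : ∀ y, B y → Reach g b y := by
    intro y hy
    have h := hBr (f b) y (hB b hb) hy
    induction h with
    | refl => exact ba.trans a_fb
    | @tail z w h hs ih =>
      have hz : B z := by
        clear ih hs hy
        induction h with
        | refl => exact hB b hb
        | tail _ hs ih => exact hs ▸ hB _ ih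
      rcases eq_or_ne z b with rfl | hzb
      · exact hs ▸ ba.trans a_fb
      · exact (ih hz).tail ((hg z (fun h => hAB z (h ▸ ha) hz) hzb).trans hs)
  have xa : Reach g x a := hx.elim (toA x) fun h => (toB x h).trans ba
  exact xa.trans (hy.elim (fromA y) fun h => ab.trans (fromB y h))

/-- Linear algebra behind Euler's inequality: if every even edge set of a bipartite graph is the
difference of the two sides of a function constant on faces, there are many faces. -/
theorem card_orbits_ge {D W : Type*} [Fintype D] [Nonempty D] [Fintype W] [DecidableEq W]
    (a b : D → W) (σ φ : Equiv.Perm D)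
    (hZ : ∀ z : D → ZMod 2,
      (∀ w, ∑ d, ((if a d = w then z d else 0) + (if b d = w then z d else 0)) = 0) →
      ∃ k : D → ZMod 2, (∀ d, k (φ d) = k d) ∧ ∀ d, k d + k (σ d) = z d) :
    Fintype.card D + 2 ≤
      Nat.card (Quotient (Equiv.Perm.SameCycle.setoid φ)) + Fintype.card W := by
  classical
  let Q := Quotient (Equiv.Perm.SameCycle.setoid φ)
  have : Fintype Q := Fintype.ofFinite Q
  let bd : (D → ZMod 2) →ₗ[ZMod 2] (W → ZMod 2) :=
    { toFun := fun z w => ∑ d, ((if a d = w then z d else 0) + (if b d = w then z d else 0))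
      map_add' := by
        intro x y
        ext w
        simp only [Pi.add_apply, ← Finset.sum_add_distrib]
        refine Finset.sum_congr rfl fun d _ => ?_
        split_ifs <;> ring
      map_smul' := by
        intro r x
        ext w
        simp only [Pi.smul_apply, smul_eq_mul, RingHom.id_apply, Finset.mul_sum]
        refine Finset.sum_congr rfl fun d _ => ?_
        split_ifs <;> ring }
  let θ : (Q → ZMod 2) →ₗ[ZMod 2] (D → ZMod 2) :=
    { toFun := fun q d => q (Quotient.mk _ d) + q (Quotient.mk _ (σ d))
      map_add' := by
        intro x y
        ext d
        simp only [Pi.add_apply]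
        ring
      map_smul' := by
        intro r x
        ext d
        simp only [Pi.smul_apply, smul_eq_mul, RingHom.id_apply]
        ring }
  let S : (W → ZMod 2) →ₗ[ZMod 2] ZMod 2 := ∑ w, LinearMap.proj w
  have hS : ∀ x, S x = ∑ w, x w := fun x => by simp [S]
  have d0 : D := Classical.arbitrary D
  have hSsurj : Function.Surjective S := fun r =>
    ⟨Pi.single (a d0) r, by rw [hS]; simp⟩
  have hSker : Module.finrank (ZMod 2) (LinearMap.ker S) + 1 = Fintype.card W := by
    have := S.finrank_range_add_finrank_ker
    rw [LinearMap.range_eq_top.2 hSsurj, finrank_top] at this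
    simp only [Module.finrank_self, Module.finrank_fintype_fun_eq_card] at this
    omega
  have hle : LinearMap.range bd ≤ LinearMap.ker S := by
    rintro _ ⟨z, rfl⟩
    rw [LinearMap.mem_ker, hS]
    change ∑ w, ∑ d, _ = _
    rw [Finset.sum_comm]
    refine Finset.sum_eq_zero fun d _ => ?_
    rw [Finset.sum_add_distrib]
    simp only [Finset.sum_ite_eq, Finset.mem_univ, if_true]
    exact CharTwo.add_self_eq_zero _
  have h1 := Submodule.finrank_mono hle
  have h2 := bd.finrank_range_add_finrank_ker
  have hle2 : LinearMap.ker bd ≤ LinearMap.range θ := by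
    intro z hz
    obtain ⟨k, hk, hkz⟩ := hZ z fun w => congrFun (LinearMap.mem_ker.1 hz) w
    refine ⟨fun q => Quotient.lift k (fun x y h => sameCycle_invariant hk h) q, ?_⟩
    ext d
    exact hkz d
  have h3 := Submodule.finrank_mono hle2
  have h4 := θ.finrank_range_add_finrank_ker
  have h5 : 0 < Module.finrank (ZMod 2) (LinearMap.ker θ) := by
    have : Nontrivial (LinearMap.ker θ) := by
      refine ⟨⟨⟨fun _ => 1, ?_⟩, 0, fun h => ?_⟩⟩
      · rw [LinearMap.mem_ker]
        ext d
        exact CharTwo.add_self_eq_zero _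
      · have := congrFun (congrArg Subtype.val h) (Quotient.mk _ d0)
        exact one_ne_zero this
    exact Module.finrank_pos
  simp only [Module.finrank_fintype_fun_eq_card] at h2 h4
  have h6 : Nat.card (Quotient (Equiv.Perm.SameCycle.setoid φ)) = Fintype.card Q :=
    Nat.card_eq_fintype_card
  omega

/-- The darts of the square grid: a vertex and one of the four directions. -/
abbrev GridDart := (ℤ × ℤ) × Fin 4

namespace GridDart

/-- The four unit steps in counterclockwise order. -/
def step : Fin 4 → ℤ × ℤ := ![(1, 0), (0, 1), (-1, 0), (0, -1)]

theorem step_add_two (k : Fin 4) : step (k + 2) = -step k := by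
  fin_cases k <;> rfl

/-- The opposite dart of the same grid edge. -/
def rev (x : GridDart) : GridDart := (x.1 + step x.2, x.2 + 2)

/-- The next dart counterclockwise at the same grid vertex. -/
def rot (x : GridDart) : GridDart := (x.1, x.2 + 1)

@[simp]
theorem rev_rev (x : GridDart) : x.rev.rev = x := by
  refine Prod.ext ?_ ?_
  · simp [rev, step_add_two]
  · simp only [rev, add_assoc]
    rw [show (2 + 2 : Fin 4) = 0 from rfl, add_zero]

theorem rev_injective : Function.Injective rev :=
  Function.LeftInverse.injective rev_rev

theorem rot_injective : Function.Injective rot := fun _ _ h =>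
  Prod.ext (congrArg Prod.fst h :) (add_right_cancel (congrArg Prod.snd h :))

theorem reach_rot (x y : GridDart) (h : x.1 = y.1) : Reach rot x y := by
  have key : ∀ m : ℕ, Reach rot x (x.1, x.2 + Fin.ofNat 4 m) := by
    intro m
    induction m with
    | zero =>
      rw [show Fin.ofNat 4 0 = 0 from rfl, add_zero]
      exact .refl
    | succ m ih =>
      refine ih.tail (Prod.ext rfl ?_)
      simp only [rot, add_assoc]
      congr 1
      simp [Fin.ext_iff, Fin.val_add]
  have := key (y.2 - x.2).val
  rwa [show Fin.ofNat 4 (y.2 - x.2).val = y.2 - x.2 by simp, add_sub_cancel, h] at this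

/-- An even set of grid edges separates the cells of the grid into two classes. The value at a
dart is the class of the cell to its right. -/
theorem exists_potential (z : GridDart → ZMod 2) (N : ℤ) (hN : ∀ x : GridDart, x.1.1 < N → z x = 0)
    (hrev : ∀ x, z (rev x) = z x) (heven : ∀ u, ∑ k, z (u, k) = 0) :
    ∃ h : GridDart → ZMod 2, (∀ x, h x + h (rev x) = z x) ∧ ∀ x, h (rot (rev x)) = h x := by
  let H : ℤ × ℤ → ZMod 2 := fun u => ∑ i ∈ Finset.Icc N u.1, z ((i, u.2), 1)
  have hstep : ∀ i j, H (i + 1, j) = H (i, j) + z ((i + 1, j), 1) := by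
    intro i j
    rcases lt_or_ge (i + 1) N with h | h
    · simp only [H]
      rw [Finset.Icc_eq_empty (by omega), Finset.Icc_eq_empty (by omega), hN _ h]
      simp
    · simp only [H]
      have : Finset.Icc N (i + 1) = insert (i + 1) (Finset.Icc N i) := by
        ext t
        simp only [Finset.mem_Icc, Finset.mem_insert]
        omega
      rw [this, Finset.sum_insert (by simp), add_comm]
  have hvert : ∀ i j, H (i, j) + H (i - 1, j) = z ((i, j), 1) := by
    intro i j
    have := hstep (i - 1) j
    rw [sub_add_cancel] at this
    rw [this, add_comm, ← add_assoc, CharTwo.add_self_eq_zero, zero_add]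
  have hhor : ∀ j i, H (i, j) + H (i, j - 1) = z ((i, j), 0) := by
    intro j i
    rcases lt_or_ge i N with h | h
    · simp only [H]
      rw [Finset.Icc_eq_empty (by omega), hN _ h]
      simp
    · have base : H (N - 1, j) + H (N - 1, j - 1) = z ((N - 1, j), 0) := by
        simp only [H]
        rw [Finset.Icc_eq_empty (by omega), hN _ (by simp)]
        simp
      refine Int.leInduction (m := N - 1)
        (motive := fun i _ => H (i, j) + H (i, j - 1) = z ((i, j), 0)) base ?_ i (by omega)
      intro i _ ih
      have h3 : z ((i + 1, j), 3) = z ((i + 1, j - 1), 1) := by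
        rw [← hrev]
        congr 1
        ext <;> simp [rev, step, sub_eq_add_neg]
      have h2 : z ((i + 1, j), 2) = z ((i, j), 0) := by
        rw [← hrev]
        congr 1
        ext <;> simp [rev, step]
      have he := heven (i + 1, j)
      rw [Fin.sum_univ_four, h3, h2] at he
      rw [hstep, hstep]
      linear_combination ih + he - CharTwo.add_self_eq_zero (z ((i + 1, j), 0))
  let off : Fin 4 → ℤ × ℤ := ![(0, -1), (0, 0), (-1, 0), (-1, -1)]
  refine ⟨fun x => H (x.1 + off x.2), ?_, ?_⟩
  · rintro ⟨⟨i, j⟩, k⟩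
    fin_cases k
    · have := hhor j i
      simp [off, rev, step]
      rw [add_comm]
      exact this
    · have := hvert i j
      simp [off, rev, step]
      exact this
    · have := hhor j (i - 1)
      rw [← hrev]
      simp only [sub_eq_add_neg] at this
      simp [off, rev, step]
      exact this
    · have := hvert i (j - 1)
      rw [← hrev]
      simp only [sub_eq_add_neg] at this
      simp [off, rev, step]
      rw [add_comm]
      exact this
  · rintro ⟨⟨i, j⟩, k⟩
    fin_cases k <;> simp [off, rev, rot, step]

end GridDart

namespace GridDart

/-- Connectedness through a set of grid darts. -/
def Conn (T : Set GridDart) : ℤ × ℤ → ℤ × ℤ → Prop :=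
  Relation.ReflTransGen fun u v => ∃ x ∈ T, x.1 = u ∧ x.rev.1 = v

theorem Conn.of_mem {T : Set GridDart} {x : GridDart} (hx : x ∈ T) : Conn T x.1 x.rev.1 :=
  .single ⟨x, hx, rfl, rfl⟩

theorem Conn.symm {T : Set GridDart} (hT : ∀ x ∈ T, rev x ∈ T) {u v : ℤ × ℤ} (h : Conn T u v) :
    Conn T v u := by
  induction h with
  | refl => exact .refl
  | tail _ hs ih =>
    obtain ⟨x, hx, rfl, rfl⟩ := hs
    exact .head ⟨x.rev, hT x hx, rfl, by rw [rev_rev]⟩ ih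

open Classical in
/-- The rotation of darts after contraction of the edges in `T`. -/
noncomputable def turn (T : Set GridDart) (x : GridDart) : GridDart :=
  rot (if x ∈ T then rev x else x)

theorem turn_of_mem {T : Set GridDart} {x : GridDart} (hx : x ∈ T) : turn T x = rot (rev x) := by
  rw [turn, if_pos hx]

theorem turn_of_notMem {T : Set GridDart} {x : GridDart} (hx : x ∉ T) : turn T x = rot x := by
  rw [turn, if_neg hx]

theorem turn_injective {T : Set GridDart} (hT : ∀ x ∈ T, rev x ∈ T) :
    Function.Injective (turn T) := by
  intro x y h
  have h := rot_injective h
  by_cases hx : x ∈ T <;> by_cases hy : y ∈ T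
  · rw [if_pos hx, if_pos hy] at h
    exact rev_injective h
  · rw [if_pos hx, if_neg hy] at h
    exact absurd (h ▸ hT x hx) hy
  · rw [if_neg hx, if_pos hy] at h
    exact absurd (h ▸ hT y hy) hx
  · rwa [if_neg hx, if_neg hy] at h

theorem conn_turn (T : Set GridDart) (x : GridDart) : Conn T x.1 (turn T x).1 := by
  by_cases hx : x ∈ T
  · rw [turn_of_mem hx]
    exact .of_mem hx
  · rw [turn_of_notMem hx]
    exact .refl

theorem conn_iterate_turn (T : Set GridDart) (x : GridDart) (n : ℕ) :
    Conn T x.1 ((turn T)^[n] x).1 := by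
  induction n with
  | zero => exact .refl
  | succ n ih =>
    rw [Function.iterate_succ_apply']
    exact ih.trans (conn_turn T _)

theorem conn_insert {T : Set GridDart} (hT : ∀ x ∈ T, rev x ∈ T) {x : GridDart} {u v : ℤ × ℤ}
    (h : Conn (insert x (insert x.rev T)) u v) : Conn T u v ∨
      ((Conn T x.1 u ∨ Conn T x.rev.1 u) ∧ (Conn T x.1 v ∨ Conn T x.rev.1 v)) := by
  induction h with
  | refl => exact .inl .refl
  | tail _ hs ih =>
    obtain ⟨y, rfl | rfl | hy, rfl, rfl⟩ := hs
    · refine .inr ⟨?_, .inr .refl⟩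
      rcases ih with ih | ih
      · exact .inl (ih.symm hT)
      · exact ih.1
    · rw [rev_rev]
      refine .inr ⟨?_, .inl .refl⟩
      rcases ih with ih | ih
      · exact .inr (ih.symm hT)
      · exact ih.1
    · rcases ih with ih | ⟨h1, h2⟩
      · exact .inl (ih.trans (Conn.of_mem hy))
      · exact .inr ⟨h1, h2.imp (·.trans (Conn.of_mem hy)) (·.trans (Conn.of_mem hy))⟩

/-- A finite set of grid edges has a spanning forest, around whose trees the contracted rotation
is transitive. -/
theorem exists_forest {I : Set GridDart} (hfin : I.Finite) (hI : ∀ x ∈ I, rev x ∈ I) :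
    ∃ T ⊆ I, (∀ x ∈ T, rev x ∈ T) ∧ (∀ x ∈ I, Conn T x.1 x.rev.1) ∧
      ∀ x y : GridDart, Conn T x.1 y.1 → Reach (turn T) x y := by
  classical
  let S : Set (Set GridDart) := {T | T ⊆ I ∧ (∀ x ∈ T, rev x ∈ T) ∧
    ∀ x y : GridDart, Conn T x.1 y.1 → Reach (turn T) x y}
  have hS : S.Finite := hfin.finite_subsets.subset fun T hT => hT.1
  have hne : S.Nonempty := by
    refine ⟨∅, Set.empty_subset _, fun x hx => hx.elim, fun x y h => ?_⟩
    have hxy : x.1 = y.1 := by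
      rcases h.cases_head with h | ⟨_, ⟨_, hx, -⟩, -⟩
      · exact h
      · exact hx.elim
    have : turn ∅ = rot := funext fun x => turn_of_notMem (Set.notMem_empty x)
    rw [this]
    exact reach_rot x y hxy
  obtain ⟨T, ⟨hTI, hT, hTr⟩, hmax⟩ := hS.exists_maximal hne
  refine ⟨T, hTI, hT, fun x hx => ?_, hTr⟩
  by_contra hcon
  have hxT : x ∉ T := fun h => hcon (.of_mem h)
  have hxT' : x.rev ∉ T := fun h => hxT (rev_rev x ▸ hT _ h)
  refine hxT (hmax (y := insert x (insert x.rev T)) ⟨?_, ?_, ?_⟩ ?_ (.inl rfl))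
  · rintro y (rfl | rfl | hy)
    exacts [hx, hI _ hx, hTI hy]
  · rintro y (rfl | rfl | hy)
    exacts [.inr (.inl rfl), .inl (rev_rev x), .inr (.inr (hT y hy))]
  · have merge := Reach.merge (f := turn T) (g := turn (insert x (insert x.rev T)))
      (A := fun p => Conn T x.1 p.1) (B := fun p => Conn T x.rev.1 p.1) (a := x) (b := x.rev)
      (fun p hp => hp.trans (conn_turn T p)) (fun p hp => hp.trans (conn_turn T p))
      (fun p hp hp' => hcon (hp.trans (hp'.symm hT)))
      (fun p q hp hq => hTr p q ((hp.symm hT).trans hq))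
      (fun p q hp hq => hTr p q ((hp.symm hT).trans hq)) .refl .refl
      (fun p h1 h2 => by simp [turn, h1, h2])
      (by rw [turn_of_mem (.inl rfl), turn_of_notMem hxT'])
      (by rw [turn_of_mem (.inr (.inl rfl)), turn_of_notMem hxT, rev_rev])
    intro p q hpq
    rcases conn_insert hT hpq with h | ⟨hp, hq⟩
    · by_cases hp : Conn T x.1 p.1 ∨ Conn T x.rev.1 p.1
      · exact merge p q hp (hp.imp (·.trans h) (·.trans h))
      · have hr := hTr p q h
        suffices Reach (turn (insert x (insert x.rev T))) p q ∧ Conn T p.1 q.1 from this.1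
        clear h hpq
        induction hr with
        | refl => exact ⟨.refl, .refl⟩
        | @tail r s _ hs ih =>
          have h1 : r ≠ x := by
            rintro rfl
            exact hp (.inl (ih.2.symm hT))
          have h2 : r ≠ x.rev := by
            rintro rfl
            exact hp (.inr (ih.2.symm hT))
          exact ⟨ih.1.tail (by rw [← hs]; simp [turn, h1, h2]), ih.2.trans (hs ▸ conn_turn T r)⟩
    · exact merge p q hp hq
  · exact fun y hy => .inr (.inr hy)

theorem exists_rotation {D W : Type*} [Finite D] {T : Set GridDart} (hT : ∀ x ∈ T, rev x ∈ T)
    (hTr : ∀ x y : GridDart, Conn T x.1 y.1 → Reach (turn T) x y) {fib : W → Set (ℤ × ℤ)}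
    (hdisj : ∀ u w w', u ∈ fib w → u ∈ fib w' → w = w')
    (hfw : ∀ u v w, Conn T u v → u ∈ fib w → v ∈ fib w)
    (hfc : ∀ u v w, u ∈ fib w → v ∈ fib w → Conn T u v) (a : D → W) (c : D → GridDart)
    (hc : c.Injective) (hca : ∀ d, (c d).1 ∈ fib (a d)) :
    ∃ σ : Equiv.Perm D, (∀ d d', σ.SameCycle d d' ↔ a d = a d') ∧
      ∀ d, ∃ n, (turn T)^[n + 1] (c d) = c (σ d) ∧
        ∀ m < n, (turn T)^[m + 1] (c d) ∉ Set.range c := by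
  obtain ⟨σ, hσ⟩ := exists_firstReturn (turn_injective hT) hc (by
    intro d
    obtain ⟨n, hn⟩ := (hTr _ _ ((conn_turn T (c d)).symm hT)).exists_iterate
    exact ⟨n, d, hn.symm⟩)
  refine ⟨σ, fun d d' => ⟨sameCycle_invariant (k := a) ?_, fun h => ?_⟩, hσ⟩
  · intro d
    obtain ⟨n, hn, -⟩ := hσ d
    have := hfw _ _ _ (conn_iterate_turn T (c d) (n + 1)) (hca d)
    rw [hn] at this
    exact hdisj _ _ _ (hca _) this
  · obtain ⟨k, hk⟩ := (hTr _ _ (hfc _ _ _ (hca d) (h ▸ hca d'))).exists_iterate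
    exact sameCycle_of_firstReturn hc hσ k _ _ hk

/-- The chain consisting of one grid edge. -/
def edgeChain (x y : GridDart) : ZMod 2 := (if y = x then 1 else 0) + (if y = rev x then 1 else 0)

theorem edgeChain_rev (x y : GridDart) : edgeChain x (rev y) = edgeChain x y := by
  have h1 : rev y = x ↔ y = rev x :=
    ⟨fun h => by rw [← h, rev_rev], fun h => by rw [h, rev_rev]⟩
  simp only [edgeChain, h1, rev_injective.eq_iff]
  rw [add_comm]

theorem sum_edgeChain (x : GridDart) (p : ℤ × ℤ) :
    ∑ k, edgeChain x (p, k) = (if p = x.1 then 1 else 0) + (if p = x.rev.1 then 1 else 0) := by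
  have key : ∀ y : GridDart, ∑ k, (if ((p, k) : GridDart) = y then 1 else 0 : ZMod 2) =
      if p = y.1 then 1 else 0 := by
    intro y
    by_cases h : p = y.1
    · simp [Prod.ext_iff, h]
    · simp [Prod.ext_iff, h]
  simp only [edgeChain, Finset.sum_add_distrib, key]

theorem Conn.exists_chain {T : Set GridDart} (hT : ∀ x ∈ T, rev x ∈ T) {u v : ℤ × ℤ}
    (h : Conn T u v) : ∃ e : GridDart → ZMod 2, (∀ x ∉ T, e x = 0) ∧ (∀ x, e (rev x) = e x) ∧
      ∀ p, ∑ k, e (p, k) = (if p = u then 1 else 0) + (if p = v then 1 else 0) := by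
  induction h with
  | refl => exact ⟨0, by simp, by simp, fun p => by simp [CharTwo.add_self_eq_zero]⟩
  | tail _ hs ih =>
    obtain ⟨e, h0, h1, h2⟩ := ih
    obtain ⟨y, hy, rfl, rfl⟩ := hs
    refine ⟨e + edgeChain y, fun x hx => ?_, fun x => ?_, fun p => ?_⟩
    · have n1 : x ≠ y := fun h => hx (h ▸ hy)
      have n2 : x ≠ y.rev := fun h => hx (h ▸ hT y hy)
      simp [h0 x hx, edgeChain, n1, n2]
    · simp [h1, edgeChain_rev]
    · simp only [Pi.add_apply, Finset.sum_add_distrib, h2, sum_edgeChain]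
      linear_combination CharTwo.add_self_eq_zero (if p = y.1 then (1 : ZMod 2) else 0)

end GridDart

open GridDart in
/-- Contracting disjoint connected regions of the grid turns the grid edges between them into a
planar map. -/
theorem grid_contract {D W : Type*} [Fintype D] [Nonempty D] [Fintype W] [DecidableEq W]
    (a b : D → W) (hab : ∀ d d', a d ≠ b d') (fib : W → Set (ℤ × ℤ))
    (hdisj : ∀ u w w', u ∈ fib w → u ∈ fib w' → w = w') (hfin : ∀ w, (fib w).Finite)
    (root : W → ℤ × ℤ) (hroot : ∀ w, root w ∈ fib w)
    (hconn : ∀ w, ∀ u ∈ fib w, Conn {x | x.1 ∈ fib w ∧ x.rev.1 ∈ fib w} (root w) u)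
    (c : D → GridDart) (hc : c.Injective) (hca : ∀ d, (c d).1 ∈ fib (a d))
    (hcb : ∀ d, (c d).rev.1 ∈ fib (b d)) :
    ∃ σ ν : Equiv.Perm D, (∀ d d', σ.SameCycle d d' ↔ a d = a d') ∧
      (∀ d d', ν.SameCycle d d' ↔ b d = b d') ∧
      Fintype.card D + 2 ≤
        Nat.card (Quotient (Equiv.Perm.SameCycle.setoid (σ * ν))) + Fintype.card W := by
  classical
  let I : Set GridDart := {x | ∃ w, x.1 ∈ fib w ∧ x.rev.1 ∈ fib w}
  have hIfin : I.Finite := by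
    refine ((Set.finite_iUnion hfin).prod (Set.finite_univ (α := Fin 4))).subset ?_
    rintro x ⟨w, hw, -⟩
    exact ⟨Set.mem_iUnion.2 ⟨w, hw⟩, Set.mem_univ _⟩
  obtain ⟨T, hTI, hT, hIT, hTr⟩ := exists_forest hIfin (by
    rintro x ⟨w, h1, h2⟩
    exact ⟨w, h2, by rwa [rev_rev]⟩)
  have hfw : ∀ u v w, Conn T u v → u ∈ fib w → v ∈ fib w := by
    intro u v w h hu
    induction h with
    | refl => exact hu
    | tail _ hs ih =>
      obtain ⟨x, hx, rfl, rfl⟩ := hs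
      obtain ⟨w', h1, h2⟩ := hTI hx
      rwa [hdisj _ _ _ ih h1]
  have hrc : ∀ w, ∀ u ∈ fib w, Conn T (root w) u := by
    intro w u hu
    have h := hconn w u hu
    clear hu
    induction h with
    | refl => exact .refl
    | tail _ hs ih =>
      obtain ⟨x, hx, rfl, rfl⟩ := hs
      exact ih.trans (hIT x ⟨w, hx⟩)
  have hfc : ∀ u v w, u ∈ fib w → v ∈ fib w → Conn T u v := fun u v w hu hv =>
    ((hrc w u hu).symm hT).trans (hrc w v hv)
  obtain ⟨σ, hσ, hσc⟩ := exists_rotation hT hTr hdisj hfw hfc a c hc hca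
  obtain ⟨ν, hν, hνc⟩ := exists_rotation hT hTr hdisj hfw hfc b (fun d => (c d).rev)
    (rev_injective.comp hc) hcb
  refine ⟨σ, ν, hσ, hν, card_orbits_ge a b σ (σ * ν) fun z hz => ?_⟩
  have hcT : ∀ d, c d ∉ T := by
    intro d h
    obtain ⟨w, h1, h2⟩ := hTI h
    exact hab d d ((hdisj _ _ _ (hca d) h1).trans (hdisj _ _ _ h2 (hcb d)))
  have hcT' : ∀ d, (c d).rev ∉ T := fun d h => hcT d (rev_rev (c d) ▸ hT _ h)
  have hcc : ∀ d d', c d ≠ (c d').rev := fun d d' h =>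
    hab d d' (hdisj _ _ _ (hca d) (h ▸ hcb d'))
  have hrootinj : ∀ w w', root w = root w' ↔ w = w' := fun w w' =>
    ⟨fun h => hdisj _ _ _ (hroot w) (h ▸ hroot w'), fun h => h ▸ rfl⟩
  choose X hX0 hXr hXs using fun d => (hrc _ _ (hca d)).exists_chain hT
  choose Y hY0 hYr hYs using fun d => (hrc _ _ (hcb d)).exists_chain hT
  let Z : GridDart → ZMod 2 := fun x => ∑ d, z d * (edgeChain (c d) x + X d x + Y d x)
  have hZc : ∀ d, Z (c d) = z d := by
    intro d
    simp only [Z, hX0 _ _ (hcT d), hY0 _ _ (hcT d), add_zero, edgeChain, hcc, hc.eq_iff, if_false]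
    simp
  have hZ0 : ∀ x, x ∉ T → x ∉ Set.range c → x ∉ Set.range (fun d => (c d).rev) → Z x = 0 := by
    intro x h1 h2 h3
    refine Finset.sum_eq_zero fun d _ => ?_
    have n1 : x ≠ c d := fun h => h2 ⟨d, h.symm⟩
    have n2 : x ≠ (c d).rev := fun h => h3 ⟨d, h.symm⟩
    simp [edgeChain, hX0 _ _ h1, hY0 _ _ h1, n1, n2]
  have hsupp : {x | Z x ≠ 0}.Finite := by
    refine (((hIfin.subset hTI).union (Set.finite_range c)).union
      (Set.finite_range fun d => (c d).rev)).subset fun x hx => ?_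
    by_contra hcon
    simp only [Set.mem_union, not_or] at hcon
    exact hx (hZ0 x hcon.1.1 hcon.1.2 hcon.2)
  obtain ⟨N, hN⟩ := (hsupp.image fun x => x.1.1).bddBelow
  obtain ⟨h, hh, hrot⟩ := exists_potential Z N
    (fun x hx => by
      by_contra hne
      exact absurd (hN ⟨x, hne, rfl⟩) (not_le.2 hx))
    (fun x => by simp only [Z, edgeChain_rev, hXr, hYr])
    (fun p => by
      have : ∑ k, Z (p, k) = ∑ d, z d *
          ((if p = root (a d) then 1 else 0) + (if p = root (b d) then 1 else 0)) := by
        simp only [Z]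
        rw [Finset.sum_comm]
        refine Finset.sum_congr rfl fun d _ => ?_
        rw [← Finset.mul_sum, Finset.sum_add_distrib, Finset.sum_add_distrib, sum_edgeChain,
          hXs, hYs]
        linear_combination z d * CharTwo.add_self_eq_zero (if p = (c d).1 then (1 : ZMod 2) else 0)
          + z d * CharTwo.add_self_eq_zero (if p = (c d).rev.1 then (1 : ZMod 2) else 0)
      rw [this]
      by_cases hp : ∃ w, root w = p
      · obtain ⟨w, rfl⟩ := hp
        refine Eq.trans ?_ (hz w)
        refine Finset.sum_congr rfl fun d _ => ?_
        simp only [hrootinj, mul_add, mul_ite, mul_one, mul_zero, eq_comm (a := w)]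
      · refine Finset.sum_eq_zero fun d _ => ?_
        rw [if_neg fun h => hp ⟨_, h.symm⟩, if_neg fun h => hp ⟨_, h.symm⟩]
        simp)
  have hrot' : ∀ x, h (rot x) = h (rev x) := fun x => by
    have := hrot (rev x)
    rwa [rev_rev] at this
  have hturn : ∀ x, x ∉ Set.range c → x ∉ Set.range (fun d => (c d).rev) →
      h (turn T x) = h x := by
    intro x h1 h2
    by_cases hx : x ∈ T
    · rw [turn_of_mem hx, hrot]
    · rw [turn_of_notMem hx, hrot']
      have := hh x
      rw [hZ0 x hx h1 h2] at this
      linear_combination this - CharTwo.add_self_eq_zero (h x)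
  have walk : ∀ x n, x ∉ T → (∀ m < n, (turn T)^[m + 1] x ∉ Set.range c) →
      (∀ m < n, (turn T)^[m + 1] x ∉ Set.range fun d => (c d).rev) →
      h ((turn T)^[n + 1] x) = h (rev x) := by
    intro x n hx h1 h2
    induction n with
    | zero => exact (congrArg h (turn_of_notMem hx)).trans (hrot' x)
    | succ n ih =>
      rw [Function.iterate_succ_apply', hturn _ (h1 n (by omega)) (h2 n (by omega))]
      exact ih (fun m hm => h1 m (by omega)) fun m hm => h2 m (by omega)
  have kσ : ∀ d, h (c (σ d)) = h (rev (c d)) := by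
    intro d
    obtain ⟨n, hn, hm⟩ := hσc d
    rw [← hn]
    refine walk _ _ (hcT d) hm fun m _ => ?_
    rintro ⟨d', hd'⟩
    have h1 := hfw _ _ _ (conn_iterate_turn T (c d) (m + 1)) (hca d)
    rw [← hd'] at h1
    exact hab d d' (hdisj _ _ _ h1 (hcb d'))
  have kν : ∀ d, h (c (ν d)).rev = h (c d) := by
    intro d
    obtain ⟨n, hn, hm⟩ := hνc d
    rw [← hn, walk _ _ (hcT' d) ?_ hm, rev_rev]
    rintro m - ⟨d', hd'⟩
    have h1 := hfw _ _ _ (conn_iterate_turn T (c d).rev (m + 1)) (hcb d)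
    rw [← hd'] at h1
    exact hab d' d (hdisj _ _ _ (hca d') h1)
  refine ⟨fun d => h (c d), fun d => ?_, fun d => ?_⟩
  · exact (kσ _).trans (kν d)
  · simp only [kσ, hh, hZc]

open Filter Topology

namespace GridDart

theorem Conn.mono {S T : Set GridDart} (hST : S ⊆ T) {u v : ℤ × ℤ} (h : Conn S u v) :
    Conn T u v :=
  Relation.ReflTransGen.mono (fun _ _ ⟨x, hx, hxu, hxv⟩ => ⟨x, hST hx, hxu, hxv⟩) u v h

/-- The point of the plane represented by a vertex of the grid of mesh `δ`. -/
def gridPoint (δ : ℝ) (g : ℤ × ℤ) : ℝ × ℝ := (δ * g.1, δ * g.2)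

/-- The vertices of the grid of mesh `δ` at distance less than `δ` from a set. -/
def near (δ : ℝ) (K : Set (ℝ × ℝ)) : Set (ℤ × ℤ) := gridPoint δ ⁻¹' Metric.thickening δ K

theorem mem_near {δ : ℝ} {K : Set (ℝ × ℝ)} {g : ℤ × ℤ} :
    g ∈ near δ K ↔ ∃ z ∈ K, dist (gridPoint δ g) z < δ := Metric.mem_thickening_iff

theorem dist_gridPoint_lt {δ : ℝ} {g : ℤ × ℤ} {z : ℝ × ℝ} :
    dist (gridPoint δ g) z < δ ↔ |δ * g.1 - z.1| < δ ∧ |δ * g.2 - z.2| < δ := by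
  rw [Prod.dist_eq, max_lt_iff, Real.dist_eq, Real.dist_eq]
  rfl

theorem exists_gridPoint {δ : ℝ} (hδ : 0 < δ) (z : ℝ × ℝ) : ∃ g, dist (gridPoint δ g) z < δ := by
  have key : ∀ t : ℝ, |δ * ⌊t / δ⌋ - t| < δ := by
    intro t
    have h1 := Int.floor_le (t / δ)
    have h2 := Int.lt_floor_add_one (t / δ)
    rw [le_div_iff₀ hδ] at h1
    rw [div_lt_iff₀ hδ] at h2
    rw [abs_lt]
    constructor <;> nlinarith
  exact ⟨(⌊z.1 / δ⌋, ⌊z.2 / δ⌋), dist_gridPoint_lt.2 ⟨key _, key _⟩⟩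

theorem near_nonempty {δ : ℝ} (hδ : 0 < δ) {K : Set (ℝ × ℝ)} (hK : K.Nonempty) :
    (near δ K).Nonempty := by
  obtain ⟨z, hz⟩ := hK
  obtain ⟨g, hg⟩ := exists_gridPoint hδ z
  exact ⟨g, mem_near.2 ⟨z, hz, hg⟩⟩

theorem near_inter_nonempty {δ : ℝ} (hδ : 0 < δ) {K L : Set (ℝ × ℝ)} (h : (K ∩ L).Nonempty) :
    (near δ K ∩ near δ L).Nonempty := by
  obtain ⟨z, hz, hz'⟩ := h
  obtain ⟨g, hg⟩ := exists_gridPoint hδ z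
  exact ⟨g, mem_near.2 ⟨z, hz, hg⟩, mem_near.2 ⟨z, hz', hg⟩⟩

theorem near_finite {δ : ℝ} (hδ : 0 < δ) {K : Set (ℝ × ℝ)} (hK : IsCompact K) :
    (near δ K).Finite := by
  obtain ⟨R, hR⟩ := hK.isBounded.subset_closedBall 0
  let m : ℤ := ⌈(R + δ) / δ⌉
  have key : ∀ (n : ℤ) (t : ℝ), |t| ≤ R → |δ * n - t| < δ → n ∈ Set.Icc (-m) m := by
    intro n t ht hn
    have hm : (R + δ) / δ ≤ m := Int.le_ceil _
    rw [div_le_iff₀ hδ] at hm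
    rw [abs_le] at ht
    rw [abs_lt] at hn
    constructor
    · have : (-m : ℝ) ≤ n := by
        by_contra! h
        nlinarith
      exact_mod_cast this
    · have : (n : ℝ) ≤ m := by
        by_contra! h
        nlinarith
      exact_mod_cast this
  refine ((Set.finite_Icc (-m) m).prod (Set.finite_Icc (-m) m)).subset fun g hg => ?_
  obtain ⟨z, hz, hgz⟩ := mem_near.1 hg
  have hz := hR hz
  rw [mem_closedBall_zero_iff, Prod.norm_def, max_le_iff] at hz
  rw [dist_gridPoint_lt] at hgz
  exact ⟨key _ _ hz.1 hgz.1, key _ _ hz.2 hgz.2⟩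

theorem near_disjoint {K L : Set (ℝ × ℝ)} (hK : IsCompact K) (hL : IsCompact L)
    (h : Disjoint K L) : ∀ᶠ δ in 𝓝[>] 0, Disjoint (near δ K) (near δ L) := by
  obtain ⟨ε, hε, hd⟩ := h.exists_thickenings hK hL.isClosed
  filter_upwards [Ioo_mem_nhdsGT hε] with δ hδ
  exact (hd.mono (Metric.thickening_mono hδ.2.le _) (Metric.thickening_mono hδ.2.le _)).preimage _

theorem conn_of_near_point {δ : ℝ} {z : ℝ × ℝ} {K : Set (ℝ × ℝ)} (hz : z ∈ K) {g g' : ℤ × ℤ}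
    (hg : dist (gridPoint δ g) z < δ) (hg' : dist (gridPoint δ g') z < δ) :
    Conn {x | x.1 ∈ near δ K ∧ x.rev.1 ∈ near δ K} g g' := by
  have hdir : ∀ u k, dist (gridPoint δ u) z < δ → dist (gridPoint δ (u + step k)) z < δ →
      Conn {x | x.1 ∈ near δ K ∧ x.rev.1 ∈ near δ K} u (u + step k) := fun u k h1 h2 =>
    .single ⟨(u, k), ⟨mem_near.2 ⟨z, hz, h1⟩, mem_near.2 ⟨z, hz, h2⟩⟩, rfl, rfl⟩
  have hδ : 0 < δ := dist_nonneg.trans_lt hg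
  have key : ∀ (m n : ℤ) (t : ℝ), |δ * m - t| < δ → |δ * n - t| < δ →
      n = m ∨ n = m + 1 ∨ n = m - 1 := by
    intro m n t hm hn
    rw [abs_lt] at hm hn
    have h1 : (n : ℝ) < m + 2 := by
      by_contra! h
      nlinarith
    have h2 : (m : ℝ) < n + 2 := by
      by_contra! h
      nlinarith
    have h1 : n < m + 2 := by exact_mod_cast h1
    have h2 : m < n + 2 := by exact_mod_cast h2
    omega
  obtain ⟨i, j⟩ := g
  obtain ⟨i', j'⟩ := g'
  have e := dist_gridPoint_lt.1 hg
  have e' := dist_gridPoint_lt.1 hg'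
  have hm : dist (gridPoint δ (i', j)) z < δ := dist_gridPoint_lt.2 ⟨e'.1, e.2⟩
  refine Relation.ReflTransGen.trans (b := (i', j)) ?_ ?_
  · rcases key _ _ _ e.1 e'.1 with h | h | h
    · obtain rfl : i' = i := h
      exact .refl
    · have := hdir (i, j) 0
      simp only [step, Prod.mk_add_mk, Matrix.cons_val, add_zero, ← h] at this
      exact this hg hm
    · have := hdir (i, j) 2
      simp only [step, Prod.mk_add_mk, Matrix.cons_val, add_zero, ← sub_eq_add_neg, ← h] at this
      exact this hg hm
  · rcases key _ _ _ e.2 e'.2 with h | h | h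
    · obtain rfl : j' = j := h
      exact .refl
    · have := hdir (i', j) 1
      simp only [step, Prod.mk_add_mk, Matrix.cons_val, add_zero, ← h] at this
      exact this hm hg'
    · have := hdir (i', j) 3
      simp only [step, Prod.mk_add_mk, Matrix.cons_val, add_zero, ← sub_eq_add_neg, ← h] at this
      exact this hm hg'

theorem near_conn {δ : ℝ} (hδ : 0 < δ) {K : Set (ℝ × ℝ)} (hK : IsPreconnected K) {g g' : ℤ × ℤ}
    (hg : g ∈ near δ K) (hg' : g' ∈ near δ K) :
    Conn {x | x.1 ∈ near δ K ∧ x.rev.1 ∈ near δ K} g g' := by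
  obtain ⟨z, hz, hgz⟩ := mem_near.1 hg
  obtain ⟨z', hz', hgz'⟩ := mem_near.1 hg'
  refine hK.induction₂ (fun z z' => ∀ g g', dist (gridPoint δ g) z < δ →
      dist (gridPoint δ g') z' < δ → Conn {x | x.1 ∈ near δ K ∧ x.rev.1 ∈ near δ K} g g')
    ?_ ?_ ?_ hz hz' g g' hgz hgz'
  · intro y hy
    obtain ⟨g₀, hg₀⟩ := exists_gridPoint hδ y
    have hev : ∀ᶠ y' in 𝓝[K] y, dist (gridPoint δ g₀) y' < δ :=
      ((continuous_const.dist continuous_id).tendsto' y _ rfl).mono_left nhdsWithin_le_nhds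
        |>.eventually_lt_const hg₀
    filter_upwards [hev, self_mem_nhdsWithin] with y' hy' hyK g g' h h'
    exact (conn_of_near_point hy h hg₀).trans (conn_of_near_point hyK hy' h')
  · intro x y w _ _ _ h1 h2 g g' h h'
    obtain ⟨g₀, hg₀⟩ := exists_gridPoint hδ y
    exact (h1 g g₀ h hg₀).trans (h2 g₀ g' hg₀ h')
  · intro x y _ _ h g g' h1 h2
    refine (h g' g h2 h1).symm ?_
    rintro p ⟨hp, hp'⟩
    exact ⟨hp', by rwa [rev_rev]⟩

end GridDart

open GridDart in
/-- Pairwise disjoint connected compact sets `A w` in the plane, joined by pairwise disjoint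
connected compact sets `M d`, form a planar map. -/
theorem compact_contract {D W : Type*} [Fintype D] [Nonempty D] [Fintype W] [DecidableEq W]
    (a b : D → W) (hab : ∀ d d', a d ≠ b d') (A : W → Set (ℝ × ℝ)) (M : D → Set (ℝ × ℝ))
    (hA : ∀ w, IsCompact (A w)) (hM : ∀ d, IsCompact (M d))
    (hA' : ∀ w, IsConnected (A w)) (hM' : ∀ d, IsPreconnected (M d))
    (hAA : ∀ w w', w ≠ w' → Disjoint (A w) (A w')) (hMM : ∀ d d', d ≠ d' → Disjoint (M d) (M d'))
    (hAM : ∀ w d, w ≠ a d → w ≠ b d → Disjoint (A w) (M d))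
    (ha : ∀ d, (A (a d) ∩ M d).Nonempty) (hb : ∀ d, (A (b d) ∩ M d).Nonempty) :
    ∃ σ ν : Equiv.Perm D, (∀ d d', σ.SameCycle d d' ↔ a d = a d') ∧
      (∀ d d', ν.SameCycle d d' ↔ b d = b d') ∧
      Fintype.card D + 2 ≤
        Nat.card (Quotient (Equiv.Perm.SameCycle.setoid (σ * ν))) + Fintype.card W := by
  obtain ⟨δ, hAA, hMM, hAM, hδ⟩ : ∃ δ,
      (∀ w w', w ≠ w' → Disjoint (near δ (A w)) (near δ (A w'))) ∧
      (∀ d d', d ≠ d' → Disjoint (near δ (M d)) (near δ (M d'))) ∧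
      (∀ w d, w ≠ a d → w ≠ b d → Disjoint (near δ (A w)) (near δ (M d))) ∧ 0 < δ := by
    refine Eventually.exists (f := 𝓝[>] (0 : ℝ)) ?_
    simp only [eventually_and, eventually_all]
    exact ⟨fun w w' h => near_disjoint (hA w) (hA w') (hAA w w' h),
      fun d d' h => near_disjoint (hM d) (hM d') (hMM d d' h),
      fun w d h h' => near_disjoint (hA w) (hM d) (hAM w d h h'), self_mem_nhdsWithin⟩
  let B : W → Set (ℤ × ℤ) := fun w => near δ (A w)
  let P : D → Set (ℤ × ℤ) := fun d => near δ (M d)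
  have hBB : ∀ u w w', u ∈ B w → u ∈ B w' → w = w' := fun u w w' h h' => by
    by_contra hne
    exact Set.disjoint_left.1 (hAA w w' hne) h h'
  have hPP : ∀ u d d', u ∈ P d → u ∈ P d' → d = d' := fun u d d' h h' => by
    by_contra hne
    exact Set.disjoint_left.1 (hMM d d' hne) h h'
  have hBP : ∀ u w d, u ∈ B w → u ∈ P d → u ∉ B (b d) → w = a d := fun u w d h h' h'' => by
    by_contra hne
    exact Set.disjoint_left.1 (hAM w d hne fun e => h'' (e ▸ h)) h h'
  let E : D → Set GridDart := fun d =>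
    {x | (x.1 ∈ P d ∧ x.1 ∉ B (b d)) ∧ x.rev.1 ∈ P d ∧ x.rev.1 ∉ B (b d)}
  let J : D → Set (ℤ × ℤ) := fun d => {v | ∃ u ∈ B (a d) ∩ P d, Conn (E d) u v}
  have hJ : ∀ d, ∀ v ∈ J d, v ∈ P d ∧ v ∉ B (b d) := by
    rintro d v ⟨u, ⟨hu, hu'⟩, h⟩
    rcases h.cases_tail with rfl | ⟨_, -, x, hx, -, rfl⟩
    · exact ⟨hu', fun h => hab d d (hBB _ _ _ hu h)⟩
    · exact hx.2
  have hroot : ∀ w, ∃ g, g ∈ B w := fun w => near_nonempty hδ (hA' w).nonempty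
  choose root hroot using hroot
  have hc : ∀ d, ∃ x : GridDart, x.1 ∈ J d ∧ x.rev.1 ∈ B (b d) := by
    intro d
    obtain ⟨g₀, hg₀, hg₀'⟩ := near_inter_nonempty hδ (ha d)
    obtain ⟨g₁, hg₁, hg₁'⟩ := near_inter_nonempty hδ (hb d)
    have hconn := near_conn hδ (hM' d) hg₀' hg₁'
    by_contra! hcon
    have : g₁ ∈ J d := by
      clear hg₁ hg₁'
      induction hconn with
      | refl => exact ⟨g₀, ⟨hg₀, hg₀'⟩, .refl⟩
      | tail _ hs ih =>
        obtain ⟨x, hx, rfl, rfl⟩ := hs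
        have h1 := hJ d _ ih
        obtain ⟨u, hu, h⟩ := ih
        exact ⟨u, hu, h.tail ⟨x, ⟨h1, hx.2, hcon x ⟨u, hu, h⟩⟩, rfl, rfl⟩⟩
    exact (hJ d _ this).2 hg₁
  choose c hcJ hcB using hc
  refine grid_contract a b hab (fun w => B w ∪ ⋃ d ∈ {d | a d = w}, J d) ?_ ?_ root
    (fun w => .inl (hroot w)) ?_ c ?_ (fun d => .inr (Set.mem_biUnion (x := d) rfl (hcJ d)))
    fun d => .inl (hcB d)
  · intro u w w' h h'
    simp only [Set.mem_union, Set.mem_iUnion, Set.mem_ofPred_eq, exists_prop] at h h'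
    rcases h with h | ⟨d, rfl, h⟩ <;> rcases h' with h' | ⟨d', rfl, h'⟩
    · exact hBB _ _ _ h h'
    · exact hBP _ _ _ h (hJ _ _ h').1 (hJ _ _ h').2
    · exact (hBP _ _ _ h' (hJ _ _ h).1 (hJ _ _ h).2).symm
    · rw [hPP _ _ _ (hJ _ _ h).1 (hJ _ _ h').1]
  · intro w
    refine (near_finite hδ (hA w)).union (Set.Finite.biUnion (Set.toFinite _) fun d _ => ?_)
    exact (near_finite hδ (hM d)).subset fun v hv => (hJ d v hv).1
  · rintro w u (h | h)
    · refine (near_conn hδ (hA' w).isPreconnected (hroot w) h).mono ?_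
      exact fun x hx => ⟨.inl hx.1, .inl hx.2⟩
    · simp only [Set.mem_iUnion, Set.mem_ofPred_eq, exists_prop] at h
      obtain ⟨d, rfl, v, hv, h⟩ := h
      have h0 : Conn {x | x.1 ∈ B (a d) ∧ x.rev.1 ∈ B (a d)} (root (a d)) v :=
        near_conn hδ (hA' (a d)).isPreconnected (hroot _) hv.1
      refine Relation.ReflTransGen.trans (h0.mono ?_) ?_
      · exact fun x hx => ⟨.inl hx.1, .inl hx.2⟩
      suffices u ∈ J d ∧ Conn {x | x.1 ∈ B (a d) ∪ ⋃ d' ∈ {d' | a d' = a d}, J d' ∧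
          x.rev.1 ∈ B (a d) ∪ ⋃ d' ∈ {d' | a d' = a d}, J d'} v u from this.2
      induction h with
      | refl => exact ⟨⟨v, hv, .refl⟩, .refl⟩
      | tail _ hs ih =>
        obtain ⟨x, hx, rfl, rfl⟩ := hs
        obtain ⟨⟨u, hu, h⟩, h'⟩ := ih
        have hJ' : x.rev.1 ∈ J d := ⟨u, hu, h.tail ⟨x, hx, rfl, rfl⟩⟩
        exact ⟨hJ', h'.tail ⟨x, ⟨.inr (Set.mem_biUnion (x := d) rfl ⟨u, hu, h⟩),
          .inr (Set.mem_biUnion (x := d) rfl hJ')⟩, rfl, rfl⟩⟩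
  · intro d e h
    exact hPP _ _ _ (hJ _ _ (hcJ d)).1 (h ▸ (hJ _ _ (hcJ e)).1)

/-- Arcs in the plane with disjoint interiors form a planar map. -/
theorem arcs_contract {D W : Type*} [Fintype D] [Nonempty D] [Fintype W] [DecidableEq W]
    (a b : D → W) (hab : ∀ d d', a d ≠ b d') (pos : W → ℝ × ℝ) (hpos : pos.Injective)
    (γ : D → ℝ → ℝ × ℝ) (hcont : ∀ d, ContinuousOn (γ d) (Set.Icc 0 1))
    (h0 : ∀ d, γ d 0 = pos (a d)) (h1 : ∀ d, γ d 1 = pos (b d))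
    (havoid : ∀ d, ∀ t ∈ Set.Ioo (0 : ℝ) 1, γ d t ∉ Set.range pos)
    (hdisj : ∀ d d', d ≠ d' → ∀ s ∈ Set.Ioo (0 : ℝ) 1, ∀ t ∈ Set.Ioo (0 : ℝ) 1, γ d s ≠ γ d' t) :
    ∃ σ ν : Equiv.Perm D, (∀ d d', σ.SameCycle d d' ↔ a d = a d') ∧
      (∀ d d', ν.SameCycle d d' ↔ b d = b d') ∧
      Fintype.card D + 2 ≤
        Nat.card (Quotient (Equiv.Perm.SameCycle.setoid (σ * ν))) + Fintype.card W := by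
  have hcl : ∀ d, IsClosed (γ d '' Set.Icc 0 1) := fun d =>
    (isCompact_Icc.image_of_continuousOn (hcont d)).isClosed
  have hmem : ∀ w d, w ≠ a d → w ≠ b d → pos w ∉ γ d '' Set.Icc 0 1 := by
    rintro w d ha hb ⟨t, ⟨ht0, ht1⟩, ht⟩
    rcases ht0.eq_or_lt with rfl | ht0
    · exact ha (hpos (ht.symm.trans (h0 d)))
    rcases ht1.eq_or_lt with rfl | ht1
    · exact hb (hpos (ht.symm.trans (h1 d)))
    exact havoid d t ⟨ht0, ht1⟩ ⟨w, ht.symm⟩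
  obtain ⟨r, hr1, hr2, hr⟩ : ∃ r,
      (∀ w w', w ≠ w' → Disjoint (Metric.closedBall (pos w) r) (Metric.closedBall (pos w') r)) ∧
      (∀ w d, w ≠ a d → w ≠ b d → Disjoint (Metric.closedBall (pos w) r) (γ d '' Set.Icc 0 1)) ∧
      0 < r := by
    refine Eventually.exists (f := 𝓝[>] (0 : ℝ)) ?_
    simp only [eventually_and, eventually_all]
    refine ⟨fun w w' h => ?_, fun w d h h' => ?_, self_mem_nhdsWithin⟩
    · filter_upwards [Ioo_mem_nhdsGT (half_pos (dist_pos.2 (hpos.ne h)))] with r hr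
      exact Metric.closedBall_disjoint_closedBall (by linarith [hr.2])
    · obtain ⟨ε, hε, hs⟩ := Metric.isOpen_iff.1 (hcl d).isOpen_compl (pos w) (hmem w d h h')
      filter_upwards [Ioo_mem_nhdsGT hε] with r hr
      exact Set.disjoint_left.2 fun x hx => hs (Metric.closedBall_subset_ball hr.2 hx)
  obtain ⟨η, hη0, hη1, hη⟩ : ∃ η : ℝ, (∀ d, γ d η ∈ Metric.closedBall (pos (a d)) r) ∧
      (∀ d, γ d (1 - η) ∈ Metric.closedBall (pos (b d)) r) ∧ η ∈ Set.Ioo (0 : ℝ) (1 / 2) := by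
    refine Eventually.exists (f := 𝓝[>] (0 : ℝ)) ?_
    simp only [eventually_and, eventually_all]
    refine ⟨fun d => ?_, fun d => ?_, Ioo_mem_nhdsGT (by norm_num)⟩
    · have := (hcont d 0 (by simp)).mono_left
        (nhdsWithin_le_of_mem (Icc_mem_nhdsGT (zero_lt_one (α := ℝ))))
      rw [h0] at this
      exact this (Metric.closedBall_mem_nhds _ hr)
    · have hsub : Tendsto (fun η : ℝ => 1 - η) (𝓝[>] 0) (𝓝[Set.Icc 0 1] 1) := by
        refine tendsto_nhdsWithin_iff.2 ⟨?_, ?_⟩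
        · exact ((continuous_const.sub continuous_id).tendsto' 0 1 (by simp)).mono_left
            nhdsWithin_le_nhds
        · filter_upwards [Ioo_mem_nhdsGT (zero_lt_one (α := ℝ))] with η hη
          exact ⟨by linarith [hη.2], by linarith [hη.1]⟩
      have := Tendsto.comp (hcont d 1 (by simp)) hsub
      rw [h1] at this
      exact this (Metric.closedBall_mem_nhds _ hr)
  have hsub : Set.Icc η (1 - η) ⊆ Set.Ioo 0 1 := fun t ht =>
    ⟨hη.1.trans_le ht.1, ht.2.trans_lt (by linarith [hη.1])⟩
  have hc : ∀ d, ContinuousOn (γ d) (Set.Icc η (1 - η)) := fun d =>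
    (hcont d).mono (hsub.trans Set.Ioo_subset_Icc_self)
  refine compact_contract a b hab (fun w => Metric.closedBall (pos w) r)
    (fun d => γ d '' Set.Icc η (1 - η)) (fun w => isCompact_closedBall _ _)
    (fun d => isCompact_Icc.image_of_continuousOn (hc d))
    (fun w => ⟨⟨_, Metric.mem_closedBall_self hr.le⟩,
      (convex_closedBall (pos w) r).isPreconnected⟩)
    (fun d => isPreconnected_Icc.image _ (hc d)) hr1 ?_ ?_ ?_ ?_
  · rintro d d' h
    refine Set.disjoint_left.2 ?_
    rintro _ ⟨s, hs, rfl⟩ ⟨t, ht, hst⟩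
    exact hdisj d d' h s (hsub hs) t (hsub ht) hst.symm
  · exact fun w d h h' => (hr2 w d h h').mono_right
      (Set.image_mono (hsub.trans Set.Ioo_subset_Icc_self))
  · exact fun d => ⟨_, hη0 d, η, ⟨le_rfl, by linarith [hη.2]⟩, rfl⟩
  · exact fun d => ⟨_, hη1 d, 1 - η, ⟨by linarith [hη.2], le_rfl⟩, rfl⟩

open Classical in
/-- A combinatorial plane map whose darts `d` are the halves of the edges of a graph, starting at
the vertices `s d`. The permutation `σ` rotates darts around vertices, and the cycles of `ν`, of
length two or four, are the midpoints of uncrossed edges and the crossings. -/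
structure DartMap {V D : Type*} [Fintype V] [Fintype D] (G : SimpleGraph V) (s : D → V) where
  σ : Equiv.Perm D
  ν : Equiv.Perm D
  rev : D → D
  sameCycle_iff : ∀ d d', σ.SameCycle d d' ↔ s d = s d'
  rev_rev : ∀ d, rev (rev d) = d
  eq_of_ends : ∀ d d', s d = s d' → s (rev d) = s (rev d') → d = d'
  adj_iff : ∀ u v, G.Adj u v ↔ ∃ d, s d = u ∧ s (rev d) = v
  ν_four : ∀ d, ν (ν (ν (ν d))) = d
  rev_cycle : ∀ d, rev d = ν d ∨ rev d = ν (ν d) ∨ rev d = ν (ν (ν d))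
  euler : ∑ d, (if ν (ν d) = d then 2 else 3) + 8 ≤
    4 * Nat.card (Quotient (Equiv.Perm.SameCycle.setoid (σ * ν))) + 4 * Fintype.card V

theorem sameCycle_four {D : Type*} [Finite D] {ν : Equiv.Perm D} (h : ∀ d, ν (ν (ν (ν d))) = d)
    {x y : D} : ν.SameCycle x y ↔ y = x ∨ y = ν x ∨ y = ν (ν x) ∨ y = ν (ν (ν x)) := by
  constructor
  · intro hxy
    obtain ⟨n, -, rfl⟩ := hxy.exists_pow_eq'
    clear hxy
    induction n with
    | zero => exact .inl rfl
    | succ n ih =>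
      rw [pow_succ', Equiv.Perm.mul_apply]
      rcases ih with ih | ih | ih | ih <;> simp [ih, h]
  · have h1 : ν.SameCycle x (ν x) := Equiv.Perm.sameCycle_apply_right.2 (.refl _ _)
    have h2 : ν.SameCycle x (ν (ν x)) := Equiv.Perm.sameCycle_apply_right.2 h1
    have h3 : ν.SameCycle x (ν (ν (ν x))) := Equiv.Perm.sameCycle_apply_right.2 h2
    rintro (rfl | rfl | rfl | rfl)
    exacts [.refl _ _, h1, h2, h3]

open Classical in
theorem sum_eq_four_mul_card {D Y : Type*} [Fintype D] [Fintype Y] {ν : Equiv.Perm D}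
    (h : ∀ d, ν (ν (ν (ν d))) = d) (hne : ∀ d, ν d ≠ d) {b : D → Y} (hb : b.Surjective)
    (hν : ∀ d d', ν.SameCycle d d' ↔ b d = b d') :
    ∑ d, (if ν (ν d) = d then 2 else 1) = 4 * Fintype.card Y := by
  rw [← Finset.sum_fiberwise Finset.univ b, mul_comm, ← smul_eq_mul, ← Finset.card_univ]
  refine Finset.sum_eq_card_nsmul fun y _ => ?_
  obtain ⟨x, rfl⟩ := hb y
  by_cases hx : ν (ν x) = x
  · have : Finset.univ.filter (fun d => b d = b x) = {x, ν x} := by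
      ext d
      rw [Finset.mem_filter, eq_comm, ← hν, sameCycle_four h, hx]
      simp only [Finset.mem_univ, true_and, Finset.mem_insert, Finset.mem_singleton]
      tauto
    rw [this, Finset.sum_pair (hne x).symm, hx, if_pos rfl, if_pos rfl]
  · have : Finset.univ.filter (fun d => b d = b x) = {x, ν x, ν (ν x), ν (ν (ν x))} := by
      ext d
      rw [Finset.mem_filter, eq_comm, ← hν, sameCycle_four h]
      simp only [Finset.mem_univ, true_and, Finset.mem_insert, Finset.mem_singleton]
    have h3 : x ≠ ν (ν (ν x)) := fun e => hne x (by
      have := congrArg ν e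
      rwa [h] at this)
    rw [this, Finset.sum_insert, Finset.sum_insert, Finset.sum_insert, Finset.sum_singleton]
    · simp [hx]
    · simp [(hne _).symm]
    · simp [(hne _).symm, Ne.symm hx]
    · simp [(hne _).symm, Ne.symm hx, h3]

namespace OnePlanarDrawing

variable {V : Type*} {G : SimpleGraph V}

/-- The parameter of the only crossing of an edge, if there is one. -/
theorem exists_crossing (Γ : OnePlanarDrawing G) (e : G.edgeSet) : ∃ τ ∈ Set.Ioo (0 : ℝ) 1, ∀ f ≠ e,
    ∀ t ∈ Set.Ioo (0 : ℝ) 1, ∀ t' ∈ Set.Ioo (0 : ℝ) 1, Γ.arc e t = Γ.arc f t' → t = τ := by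
  by_cases h : ∃ f ≠ e, ∃ t ∈ Set.Ioo (0 : ℝ) 1, ∃ t' ∈ Set.Ioo (0 : ℝ) 1, Γ.arc e t = Γ.arc f t'
  · obtain ⟨f, hf, t, ht, t', ht', h⟩ := h
    refine ⟨t, ht, fun f₂ hf₂ t₂ ht₂ t₂' ht₂' h₂ => ?_⟩
    obtain rfl : f₂ = f := Γ.at_most_one_crossing e
      ⟨hf₂, _, ⟨t₂, ht₂, rfl⟩, t₂', ht₂', h₂.symm⟩ ⟨hf, _, ⟨t, ht, rfl⟩, t', ht', h.symm⟩
    exact Γ.arc_inj e (Set.Ioo_subset_Icc_self ht₂) (Set.Ioo_subset_Icc_self ht)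
      (Γ.crossings_subsingleton e f₂ hf.symm ⟨⟨t₂, ht₂, rfl⟩, t₂', ht₂', h₂.symm⟩
        ⟨⟨t, ht, rfl⟩, t', ht', h.symm⟩)
  · exact ⟨1 / 2, by norm_num, fun f hf t ht t' ht' h' => absurd ⟨f, hf, t, ht, t', ht', h'⟩ h⟩

theorem ends_dart (Γ : OnePlanarDrawing G) (d : G.Dart) :
    (Γ.arc ⟨d.edge, d.edge_mem⟩ 0 = Γ.pos d.fst ∧ Γ.arc ⟨d.edge, d.edge_mem⟩ 1 = Γ.pos d.snd) ∨
    (Γ.arc ⟨d.edge, d.edge_mem⟩ 0 = Γ.pos d.snd ∧ Γ.arc ⟨d.edge, d.edge_mem⟩ 1 = Γ.pos d.fst) := by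
  obtain ⟨u, v, h, h0, h1⟩ := Γ.arc_ends ⟨d.edge, d.edge_mem⟩
  rcases SimpleGraph.dart_edge_eq_mk'_iff'.1 h with ⟨rfl, rfl⟩ | ⟨rfl, rfl⟩
  · exact .inl ⟨h0, h1⟩
  · exact .inr ⟨h0, h1⟩

theorem nonempty_dartMap (Γ : OnePlanarDrawing G) [Fintype V] [Fintype G.Dart]
    [Nonempty G.Dart] :
    Nonempty (DartMap G fun d : G.Dart => d.fst) := by
  classical
  choose τ hτ hcross using Γ.exists_crossing
  let y : G.edgeSet → ℝ × ℝ := fun e => Γ.arc e (τ e)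
  have hinj : ∀ e, ∀ t ∈ Set.Ioo (0 : ℝ) 1, ∀ t' ∈ Set.Ioo (0 : ℝ) 1, Γ.arc e t = Γ.arc e t' →
      t = t' := fun e t ht t' ht' h =>
    Γ.arc_inj e (Set.Ioo_subset_Icc_self ht) (Set.Ioo_subset_Icc_self ht') h
  have hy : ∀ e f, ∀ t ∈ Set.Ioo (0 : ℝ) 1, Γ.arc e t = y f → t = τ e := by
    intro e f t ht h
    rcases eq_or_ne f e with rfl | hf
    · exact hinj f t ht _ (hτ f) h
    · exact hcross e f hf t ht _ (hτ f) h
  have hunique : ∀ e f f', f ≠ e → f' ≠ e → y f = y e → y f' = y e → f = f' := by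
    intro e f f' hf hf' h h'
    exact Γ.at_most_one_crossing e ⟨hf, _, ⟨τ e, hτ e, rfl⟩, τ f, hτ f, h⟩
      ⟨hf', _, ⟨τ e, hτ e, rfl⟩, τ f', hτ f', h'⟩
  let E : G.Dart → G.edgeSet := fun d => ⟨d.edge, d.edge_mem⟩
  have hE : ∀ d d', E d = E d' ↔ d = d' ∨ d = d'.symm := fun d d' => by
    rw [← SimpleGraph.dart_edge_eq_iff, Subtype.mk.injEq]
  have hEsymm : ∀ d : G.Dart, E d.symm = E d := fun d => Subtype.ext (SimpleGraph.Dart.edge_symm d)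
  have hEsurj : E.Surjective := by
    rintro ⟨e, he⟩
    induction e with
    | _ u v => exact ⟨⟨(u, v), he⟩, rfl⟩
  have : Finite G.edgeSet := Finite.of_surjective E hEsurj
  have : Fintype (Set.range y) := Fintype.ofFinite _
  let pos : V ⊕ Set.range y → ℝ × ℝ := Sum.elim Γ.pos Subtype.val
  have hpos : pos.Injective := by
    refine Function.Injective.sumElim Γ.pos_inj Subtype.val_injective ?_
    rintro v ⟨_, e, rfl⟩ h
    exact Γ.arc_avoids e _ (hτ e) ⟨v, h⟩
  let φ : G.Dart → ℝ → ℝ := fun d t =>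
    if Γ.arc (E d) 0 = Γ.pos d.fst then t * τ (E d) else 1 - t * (1 - τ (E d))
  have hφcont : ∀ d, Continuous (φ d) := by
    intro d
    by_cases h : Γ.arc (E d) 0 = Γ.pos d.fst
    · simp only [φ, if_pos h]
      fun_prop
    · simp only [φ, if_neg h]
      fun_prop
  have hφmaps : ∀ d, ∀ t ∈ Set.Icc (0 : ℝ) 1, φ d t ∈ Set.Icc (0 : ℝ) 1 := by
    intro d t ht
    have h := hτ (E d)
    simp only [φ]
    split_ifs <;> constructor <;> nlinarith [ht.1, ht.2, h.1, h.2]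
  have hφmaps' : ∀ d, ∀ t ∈ Set.Ioo (0 : ℝ) 1, φ d t ∈ Set.Ioo (0 : ℝ) 1 ∧ φ d t ≠ τ (E d) := by
    intro d t ht
    have h := hτ (E d)
    simp only [φ]
    split_ifs
    · have h1 : t * τ (E d) < τ (E d) := by nlinarith [ht.1, ht.2, h.1, h.2]
      exact ⟨⟨mul_pos ht.1 h.1, h1.trans h.2⟩, h1.ne⟩
    · have h1 : τ (E d) < 1 - t * (1 - τ (E d)) := by nlinarith [ht.1, ht.2, h.1, h.2]
      exact ⟨⟨h.1.trans h1, by nlinarith [ht.1, ht.2, h.1, h.2]⟩, h1.ne'⟩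
  have hφ0 : ∀ d, Γ.arc (E d) (φ d 0) = Γ.pos d.fst := by
    intro d
    simp only [φ]
    split_ifs with h
    · rwa [zero_mul]
    · rw [zero_mul, sub_zero]
      rcases Γ.ends_dart d with h' | h'
      · exact absurd h'.1 h
      · exact h'.2
  have hφ1 : ∀ d, φ d 1 = τ (E d) := by
    intro d
    simp only [φ]
    split_ifs <;> ring
  have hφsymm : ∀ d : G.Dart, ∀ t ∈ Set.Ioo (0 : ℝ) 1, ∀ t' ∈ Set.Ioo (0 : ℝ) 1,
      φ d t ≠ φ d.symm t' := by
    have key : ∀ d : G.Dart, Γ.arc (E d) 0 = Γ.pos d.fst → ∀ t ∈ Set.Ioo (0 : ℝ) 1,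
        ∀ t' ∈ Set.Ioo (0 : ℝ) 1, φ d t ≠ φ d.symm t' := by
      intro d hd t ht t' ht'
      have hd' : Γ.arc (E d.symm) 0 ≠ Γ.pos d.symm.fst := by
        rw [hEsymm, hd]
        exact Γ.pos_inj.ne d.adj.ne
      simp only [φ, if_pos hd, if_neg hd', hEsymm]
      have h := hτ (E d)
      nlinarith [ht.1, ht.2, h.1, h.2, ht'.1, ht'.2]
    intro d t ht t' ht'
    by_cases hd : Γ.arc (E d) 0 = Γ.pos d.fst
    · exact key d hd t ht t' ht'
    · have hd' : Γ.arc (E d.symm) 0 = Γ.pos d.symm.fst := by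
        rw [hEsymm]
        rcases Γ.ends_dart d with h | h
        · exact absurd h.1 hd
        · exact h.1
      have := key d.symm hd' t' ht' t ht
      rw [SimpleGraph.Dart.symm_symm] at this
      exact this.symm
  let b : G.Dart → Set.range y := fun d => ⟨y (E d), E d, rfl⟩
  have hb : ∀ d d', b d = b d' ↔ y (E d) = y (E d') := fun _ _ => Subtype.ext_iff
  obtain ⟨σ, ν, hσ, hν, heuler⟩ := arcs_contract (fun d : G.Dart => Sum.inl d.fst)
    (fun d => Sum.inr (b d)) (fun _ _ => Sum.inl_ne_inr) pos hpos
    (fun d t => Γ.arc (E d) (φ d t))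
    (fun d => (Γ.arc_cont (E d)).comp (hφcont d).continuousOn (hφmaps d)) hφ0
    (fun d => congrArg (Γ.arc (E d)) (hφ1 d))
    (by
      rintro d t ht ⟨v | ⟨_, f, rfl⟩, h⟩
      · exact Γ.arc_avoids (E d) _ (hφmaps' d t ht).1 ⟨v, h⟩
      · exact (hφmaps' d t ht).2 (hy _ f _ (hφmaps' d t ht).1 h.symm))
    (by
      intro d d' hdd' t ht t' ht' h
      by_cases hEd : E d = E d'
      · obtain rfl : d' = d.symm := by
          rcases (hE d' d).1 hEd.symm with h | h
          · exact absurd h.symm hdd'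
          · exact h
        simp only [hEsymm] at h
        refine hφsymm d t ht t' ht' (hinj _ _ (hφmaps' d t ht).1 _ ?_ h)
        exact (hφmaps' d.symm t' ht').1
      · exact (hφmaps' d t ht).2
          (hcross _ _ (Ne.symm hEd) _ (hφmaps' d t ht).1 _ (hφmaps' d' t' ht').1 h))
  simp only [Sum.inl.injEq, Sum.inr.injEq] at hσ hν
  have hsymm : ∀ d : G.Dart, ν.SameCycle d d.symm := fun d => by
    rw [hν, hb, hEsymm]
  have hne : ∀ d, ν d ≠ d := fun d h => d.symm_ne ((hsymm d).symm.eq_of_right h)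
  have hfour : ∀ d, ν (ν (ν (ν d))) = d := by
    intro d
    have hmem : ∀ x, x ∈ (ν.cycleOf d).support ↔ y (E d) = y (E x) := fun x => by
      rw [Equiv.Perm.mem_support_cycleOf_iff' (hne d), hν, hb]
    have hcard : (ν.cycleOf d).support.card ∣ 4 := by
      by_cases h : ∃ f, f ≠ E d ∧ y f = y (E d)
      · obtain ⟨f, hf, hyf⟩ := h
        obtain ⟨d₂, rfl⟩ := hEsurj f
        have h1 : d ≠ d₂ := fun h => hf ((hE _ _).2 (.inl h.symm))
        have h2 : d ≠ d₂.symm := fun h => hf ((hE _ _).2 (.inr (by rw [h, d₂.symm_symm])))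
        have h3 : d.symm ≠ d₂ := fun h => hf ((hE _ _).2 (.inr h.symm))
        have h4 : d.symm ≠ d₂.symm := fun h =>
          h1 (SimpleGraph.Dart.symm_involutive.injective h)
        have : (ν.cycleOf d).support = {d, d.symm, d₂, d₂.symm} := by
          ext x
          rw [hmem]
          simp only [Finset.mem_insert, Finset.mem_singleton]
          rw [← or_assoc, ← hE, ← hE]
          constructor
          · intro h
            by_cases hx : E x = E d
            · exact .inl hx
            · exact .inr (hunique _ _ _ hx hf h.symm hyf)
          · rintro (h | h)
            · rw [h]
            · rw [h, hyf]
        rw [this, Finset.card_insert_of_notMem, Finset.card_insert_of_notMem,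
          Finset.card_pair d₂.symm_ne.symm]
        · simp [h3, h4]
        · simp [h1, h2, d.symm_ne.symm]
      · have : (ν.cycleOf d).support = {d, d.symm} := by
          ext x
          rw [hmem]
          simp only [Finset.mem_insert, Finset.mem_singleton]
          rw [← hE]
          refine ⟨fun hx => ?_, fun hx => by rw [hx]⟩
          by_contra hne
          exact h ⟨_, hne, hx.symm⟩
        rw [this, Finset.card_pair d.symm_ne.symm]
        norm_num
    obtain ⟨k, hk⟩ := hcard
    have := Equiv.Perm.pow_mod_card_support_cycleOf_self_apply ν 4 d
    rw [hk, Nat.mul_mod_right, ← hk] at this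
    exact this.symm
  refine ⟨σ, ν, SimpleGraph.Dart.symm, hσ, SimpleGraph.Dart.symm_symm, fun d d' h h' => ?_,
    fun u v => ⟨fun h => ⟨⟨(u, v), h⟩, rfl, rfl⟩, ?_⟩, hfour, fun d => ?_, ?_⟩
  · exact SimpleGraph.Dart.toProd_injective (Prod.ext h h')
  · rintro ⟨d, rfl, rfl⟩
    exact d.adj
  · have := (sameCycle_four hfour).1 (hsymm d)
    simpa [d.symm_ne] using this
  · have hbsurj : b.Surjective := by
      rintro ⟨_, f, rfl⟩
      obtain ⟨d, rfl⟩ := hEsurj f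
      exact ⟨d, rfl⟩
    have hsum := sum_eq_four_mul_card hfour hne hbsurj hν
    have htotal : ∑ d, (@ite _ (ν (ν d) = d) (Classical.propDecidable _) 2 3) +
        ∑ d, (@ite _ (ν (ν d) = d) (Classical.propDecidable _) 2 1) =
        4 * Fintype.card G.Dart := by
      rw [← Finset.sum_add_distrib, mul_comm, ← smul_eq_mul, ← Finset.card_univ]
      refine Finset.sum_eq_card_nsmul fun d _ => ?_
      split_ifs <;> rfl
    rw [Fintype.card_sum] at heuler
    omega

end OnePlanarDrawing

theorem card_orbits_le_mul_swap {D : Type*} [Finite D] [DecidableEq D] (φ : Equiv.Perm D)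
    (x y : D) : Nat.card (Quotient (Equiv.Perm.SameCycle.setoid φ)) ≤
      Nat.card (Quotient (Equiv.Perm.SameCycle.setoid (φ * Equiv.swap x y))) + 1 := by
  classical
  let Q := Quotient (Equiv.Perm.SameCycle.setoid φ)
  let Q' := Quotient (Equiv.Perm.SameCycle.setoid (φ * Equiv.swap x y))
  let mk : D → Q := Quotient.mk _
  have hmk : ∀ d, mk (φ d) = mk d := fun d =>
    Quotient.sound (s := Equiv.Perm.SameCycle.setoid φ)
      (Equiv.Perm.sameCycle_apply_left.2 (.refl φ d))
  let k : D → Q := fun d => if mk d = mk x then mk y else mk d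
  have hk : ∀ d, k ((φ * Equiv.swap x y) d) = k d := by
    intro d
    simp only [k, Equiv.Perm.mul_apply, hmk]
    rcases eq_or_ne d x with rfl | hx
    · simp
    rcases eq_or_ne d y with rfl | hy
    · simp
    rw [Equiv.swap_apply_of_ne_of_ne hx hy]
  let f : Q → Option Q' := fun q => if q = mk x then none else some (Quotient.mk _ q.out)
  have hf : f.Injective := by
    intro q q' h
    by_cases hq : q = mk x <;> by_cases hq' : q' = mk x
    · rw [hq, hq']
    · simp [f, hq, hq'] at h
    · simp [f, hq, hq'] at h
    · simp only [f, hq, hq', if_false, Option.some.injEq] at h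
      have h2 := sameCycle_invariant hk (Quotient.exact h)
      have e : ∀ q : Q, mk q.out = q := Quotient.out_eq
      simpa only [k, e, hq, hq', if_false] using h2
  have := Nat.card_le_card_of_injective f hf
  rwa [Finite.card_option] at this

namespace DartMap

variable {V D : Type*} [Fintype V] [Fintype D] {G : SimpleGraph V} {s : D → V}

theorem rev_ne (M : DartMap G s) (d : D) : M.rev d ≠ d := fun h =>
  ((M.adj_iff (s d) (s (M.rev d))).2 ⟨d, rfl, rfl⟩).ne (by rw [h])

theorem ν_ne (M : DartMap G s) (d : D) : M.ν d ≠ d := fun h => by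
  have := M.rev_cycle d
  simp only [h, or_self] at this
  exact M.rev_ne d this

/-- The darts belonging to a crossing. -/
def crossed (M : DartMap G s) : Set D := {d | M.ν (M.ν d) ≠ d}

theorem ν_mem_crossed (M : DartMap G s) {d : D} : M.ν d ∈ M.crossed ↔ d ∈ M.crossed :=
  not_congr M.ν.injective.eq_iff

open Classical in
/-- A crossing can be removed by reconnecting the four darts meeting there. -/
theorem exists_smoothing (M : DartMap G s) {x : D} (hx : x ∈ M.crossed) {r : D → D}
    (hr : ∀ d, r (r d) = d) (hends : ∀ d d', s d = s d' → s (r d) = s (r d') → d = d')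
    (hadj : ∀ u v, G.Adj u v ↔ ∃ d, s d = u ∧ s (r d) = v) (h1 : r x = M.ν (M.ν (M.ν x)))
    (h2 : r (M.ν x) = M.ν (M.ν x)) (h0 : ∀ d, ¬ M.ν.SameCycle x d → r d = M.rev d) :
    ∃ M' : DartMap G s, M'.crossed ⊂ M.crossed := by
  let ν := M.ν
  let C : Finset D := {x, ν x, ν (ν x), ν (ν (ν x))}
  have hC : ∀ d, d ∈ C ↔ ν.SameCycle x d := fun d => by
    rw [sameCycle_four M.ν_four]
    simp only [C, ν, Finset.mem_insert, Finset.mem_singleton]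
  have hx : ν (ν x) ≠ x := hx
  have hne : ∀ d, ν d ≠ d := M.ν_ne
  have h4 : ∀ d, ν (ν (ν (ν d))) = d := M.ν_four
  have hx3 : x ≠ ν (ν (ν x)) := fun e => hne x (by
    have := congrArg ν e
    rwa [h4] at this)
  have hCcard : C.card = 4 := by
    rw [Finset.card_insert_of_notMem, Finset.card_insert_of_notMem, Finset.card_insert_of_notMem,
      Finset.card_singleton]
    · simp [(hne _).symm]
    · simp [(hne _).symm, Ne.symm hx]
    · simp [(hne _).symm, Ne.symm hx, hx3]
  let ν' := ν * Equiv.swap x (ν (ν x))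
  have e0 : ν' x = ν (ν (ν x)) := by simp [ν']
  have e1 : ν' (ν x) = ν (ν x) := by
    simp only [ν', Equiv.Perm.mul_apply]
    rw [Equiv.swap_apply_of_ne_of_ne (hne x) (hne _).symm]
  have e2 : ν' (ν (ν x)) = ν x := by simp [ν']
  have e3 : ν' (ν (ν (ν x))) = x := by
    simp only [ν', Equiv.Perm.mul_apply]
    rw [Equiv.swap_apply_of_ne_of_ne hx3.symm (hne _), h4]
  have hout : ∀ d, d ∉ C → ν' d = ν d ∧ ν d ∉ C := by
    intro d hd
    refine ⟨?_, fun h => hd ?_⟩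
    · simp only [C, Finset.mem_insert, Finset.mem_singleton, not_or] at hd
      simp only [ν', Equiv.Perm.mul_apply]
      rw [Equiv.swap_apply_of_ne_of_ne hd.1 hd.2.2.1]
    · rw [hC] at h ⊢
      exact Equiv.Perm.sameCycle_apply_right.1 h
  have hν'C : ∀ d ∈ C, ν' (ν' d) = d := by
    intro d hd
    simp only [C, Finset.mem_insert, Finset.mem_singleton] at hd
    rcases hd with rfl | rfl | rfl | rfl
    · rw [e0, e3]
    · rw [e1, e2]
    · rw [e2, e1]
    · rw [e3, e0]
  have hν'out : ∀ d, d ∉ C → ν' (ν' d) = ν (ν d) := by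
    intro d hd
    obtain ⟨h, h'⟩ := hout d hd
    rw [h, (hout _ h').1]
  have hνC : ∀ d ∈ C, ν (ν d) ≠ d := by
    intro d hd
    simp only [C, Finset.mem_insert, Finset.mem_singleton] at hd
    rcases hd with rfl | rfl | rfl | rfl <;> simpa using hx
  have hsum : ∑ d, (if ν (ν d) = d then 2 else 3) = ∑ d, (if ν' (ν' d) = d then 2 else 3) + 4 := by
    have : ∑ d, (if d ∈ C then 1 else 0) = 4 := by
      rw [Finset.sum_boole, Finset.filter_mem_eq_inter, Finset.univ_inter, hCcard]
      rfl
    rw [← this, ← Finset.sum_add_distrib]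
    refine Finset.sum_congr rfl fun d _ => ?_
    by_cases hd : d ∈ C
    · rw [if_neg (hνC d hd), if_pos (hν'C d hd), if_pos hd]
    · rw [hν'out d hd, if_neg hd, add_zero]
  let M' : DartMap G s :=
    { σ := M.σ
      ν := ν'
      rev := r
      sameCycle_iff := M.sameCycle_iff
      rev_rev := hr
      eq_of_ends := hends
      adj_iff := hadj
      ν_four := by
        intro d
        by_cases hd : d ∈ C
        · rw [hν'C d hd, hν'C d hd]
        · have h := (hout d hd).2
          rw [hν'out d hd, hν'out _ (hout _ h).2, h4]
      rev_cycle := by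
        intro d
        by_cases hd : d ∈ C
        · simp only [C, Finset.mem_insert, Finset.mem_singleton] at hd
          refine .inl ?_
          rcases hd with rfl | rfl | rfl | rfl
          · exact h1.trans e0.symm
          · exact h2.trans e1.symm
          · rw [e2]
            exact h2 ▸ hr _
          · rw [e3]
            exact h1 ▸ hr _
        · obtain ⟨a1, a2⟩ := hout d hd
          obtain ⟨b1, b2⟩ := hout _ a2
          rw [h0 d (by rwa [← hC]), a1, b1, (hout _ b2).1]
          exact M.rev_cycle d
      euler := by
        have := M.euler
        have := card_orbits_le_mul_swap (M.σ * M.ν) x (ν (ν x))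
        have hs : M.σ * ν' = M.σ * M.ν * Equiv.swap x (ν (ν x)) := (mul_assoc _ _ _).symm
        rw [hs]
        simp only [ν] at hsum
        omega }
  refine ⟨M', fun d hd => ?_, fun h => ?_⟩
  · by_cases hdC : d ∈ C
    · exact absurd (hν'C d hdC) hd
    · exact fun h => hd ((hν'out d hdC).trans h)
  · exact h hx (hν'C x (by simp [C]))

/-- In a suitable map, edges cross properly at every crossing and have no common ends. -/
theorem exists_proper (M : DartMap G s) : ∃ M : DartMap G s,
    (∀ d ∈ M.crossed, M.rev d = M.ν (M.ν d)) ∧ ∀ d ∈ M.crossed, s d ≠ s (M.ν d) := by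
  classical
  obtain ⟨_, ⟨M, rfl⟩, hmin⟩ := (Set.toFinite
    (Set.range fun M : DartMap G s => M.crossed)).exists_minimal ⟨_, M, rfl⟩
  have hmin : ∀ M' : DartMap G s, ¬ M'.crossed ⊂ M.crossed := fun M' h =>
    h.2 (hmin ⟨M', rfl⟩ h.1)
  have htouch : ∀ d ∈ M.crossed, M.rev d ≠ M.ν d := by
    intro d hd h
    have h' : M.rev (M.ν d) = d := by rw [← h, M.rev_rev]
    have h2 : M.rev (M.ν (M.ν d)) = M.ν (M.ν (M.ν d)) := by
      rcases M.rev_cycle (M.ν (M.ν d)) with h3 | h3 | h3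
      · exact h3
      · rw [M.ν_four] at h3
        have := congrArg M.rev h3
        rw [M.rev_rev, h] at this
        exact absurd this (M.ν_ne _)
      · rw [M.ν_four] at h3
        have := congrArg M.rev h3
        rw [M.rev_rev, h'] at this
        exact absurd this hd
    obtain ⟨M', hM'⟩ := M.exists_smoothing (x := M.ν d) (M.ν_mem_crossed.2 hd) M.rev_rev
      M.eq_of_ends M.adj_iff (by rw [h', M.ν_four]) h2 fun _ _ => rfl
    exact hmin M' hM'
  have hrev : ∀ d ∈ M.crossed, M.rev d = M.ν (M.ν d) := by
    intro d hd
    rcases M.rev_cycle d with h | h | h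
    · exact absurd h (htouch d hd)
    · exact h
    · have h3 : M.ν (M.ν (M.ν d)) ∈ M.crossed := by simpa only [M.ν_mem_crossed] using hd
      refine absurd ?_ (htouch _ h3)
      rw [M.ν_four, ← h, M.rev_rev]
  refine ⟨M, hrev, fun d hd hs => ?_⟩
  let π := Equiv.swap d (M.ν d)
  have hπ : ∀ z, s (π z) = s z := by
    intro z
    rcases eq_or_ne z d with rfl | h1
    · simp [π, hs]
    rcases eq_or_ne z (M.ν d) with rfl | h2
    · simp [π, hs]
    rw [Equiv.swap_apply_of_ne_of_ne h1 h2]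
  have hππ : ∀ z, π (π z) = z := Equiv.swap_apply_self _ _
  have hd1 : M.ν d ∈ M.crossed := M.ν_mem_crossed.2 hd
  have n3 : M.ν (M.ν (M.ν d)) ≠ d := fun e => M.ν_ne d (by
    have := congrArg M.ν e
    rw [M.ν_four] at this
    exact this.symm)
  obtain ⟨M', hM'⟩ := M.exists_smoothing hd (r := fun z => π (M.rev (π z)))
    (fun z => by simp only [hππ, M.rev_rev])
    (fun z z' h h' => by
      rw [hπ, hπ] at h'
      exact π.injective (M.eq_of_ends _ _ (by rw [hπ, hπ, h]) h'))
    (fun u v => by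
      rw [M.adj_iff]
      refine ⟨fun ⟨z, h, h'⟩ => ⟨π z, ?_, ?_⟩, fun ⟨z, h, h'⟩ => ⟨π z, ?_, ?_⟩⟩
      · rw [hπ, h]
      · rw [hππ, hπ, h']
      · rw [hπ, h]
      · rwa [hπ] at h')
    (by
      simp only [π, Equiv.swap_apply_left]
      rw [hrev _ hd1, Equiv.swap_apply_of_ne_of_ne n3 hd1])
    (by
      simp only [π, Equiv.swap_apply_right]
      rw [hrev _ hd, Equiv.swap_apply_of_ne_of_ne hd (M.ν_ne _)])
    (by
      intro z hz
      rw [sameCycle_four M.ν_four] at hz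
      simp only [not_or] at hz
      have hr : ∀ w ∈ M.crossed, M.rev z = w → z = M.ν (M.ν w) := fun w hw h => by
        rw [← hrev w hw, ← h, M.rev_rev]
      have hz0 : π z = z := Equiv.swap_apply_of_ne_of_ne hz.1 hz.2.1
      have hz1 : π (M.rev z) = M.rev z := Equiv.swap_apply_of_ne_of_ne
        (fun h => hz.2.2.1 (hr _ hd h)) (fun h => hz.2.2.2 (hr _ hd1 h))
      simp only [hz0, hz1])
  exact hmin M' hM'

end DartMap

open Classical in
theorem mul_card_orbits_le_sum {D : Type*} [Fintype D] (φ : Equiv.Perm D) (f : D → ℕ) (c : ℕ)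
    (h : ∀ x, ∃ S : Finset D, (∀ d ∈ S, φ.SameCycle x d) ∧ c ≤ ∑ d ∈ S, f d) :
    c * Nat.card (Quotient (Equiv.Perm.SameCycle.setoid φ)) ≤ ∑ d, f d := by
  rw [Nat.card_eq_fintype_card, ← Finset.sum_fiberwise Finset.univ
    (fun d => (Quotient.mk (Equiv.Perm.SameCycle.setoid φ) d)), mul_comm, ← smul_eq_mul,
    ← Finset.card_univ]
  refine Finset.card_nsmul_le_sum _ _ _ fun q _ => ?_
  induction q using Quotient.ind with
  | _ x =>
    obtain ⟨S, hS, hc⟩ := h x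
    refine hc.trans (Finset.sum_le_sum_of_subset fun d hd => ?_)
    rw [Finset.mem_filter]
    exact ⟨Finset.mem_univ _, Quotient.sound (s := Equiv.Perm.SameCycle.setoid φ) (hS d hd).symm⟩

namespace DartMap

variable {V D : Type*} [Fintype V] [Fintype D] {G : SimpleGraph V} {s : D → V}

/-- The permutation of the darts whose cycles are the faces. -/
def face (M : DartMap G s) : Equiv.Perm D := M.σ * M.ν

/-- The dart lies on a triangular face with one crossing, just before that crossing. -/
def FalseTriangle (M : DartMap G s) (d : D) : Prop :=
  d ∈ M.crossed ∧ M.face d ∉ M.crossed ∧ M.face (M.face d) = d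

/-- The dart lies on a triangular face with three vertices. -/
def TrueTriangle (M : DartMap G s) (d : D) : Prop :=
  d ∉ M.crossed ∧ M.face d ∉ M.crossed ∧ M.face (M.face d) ∉ M.crossed ∧
    M.face (M.face (M.face d)) = d

theorem s_σ (M : DartMap G s) (d : D) : s (M.σ d) = s d :=
  (M.sameCycle_iff _ _).1 (Equiv.Perm.sameCycle_apply_left.2 (.refl _ _))

theorem s_face (M : DartMap G s) (d : D) : s (M.face d) = s (M.ν d) := M.s_σ _

theorem rev_of_notMem (M : DartMap G s) {d : D} (hd : d ∉ M.crossed) : M.rev d = M.ν d := by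
  have h : M.ν (M.ν d) = d := not_not.1 hd
  have := M.rev_cycle d
  rw [h] at this
  have := M.rev_ne d
  tauto

theorem adj_rev (M : DartMap G s) (d : D) : G.Adj (s d) (s (M.rev d)) :=
  (M.adj_iff _ _).2 ⟨d, rfl, rfl⟩

theorem adj_of_notMem (M : DartMap G s) {d : D} (hd : d ∉ M.crossed) :
    G.Adj (s d) (s (M.face d)) := by
  rw [M.s_face, ← M.rev_of_notMem hd]
  exact M.adj_rev d

theorem FalseTriangle.adj {M : DartMap G s} {d : D} (h : M.FalseTriangle d) :
    G.Adj (s d) (s (M.ν d)) := by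
  have := M.adj_of_notMem h.2.1
  rw [h.2.2, M.s_face] at this
  exact this.symm

open Classical in
theorem card_fiber (M : DartMap G s) [DecidableRel G.Adj] (v : V) :
    (Finset.univ.filter fun d => s d = v).card = G.degree v := by
  rw [← G.card_neighborFinset_eq_degree]
  refine Finset.card_bij (fun d _ => s (M.rev d)) ?_ ?_ ?_
  · intro d hd
    obtain rfl := (Finset.mem_filter.1 hd).2
    rw [SimpleGraph.mem_neighborFinset]
    exact M.adj_rev d
  · intro d hd d' hd' h
    exact M.eq_of_ends _ _ ((Finset.mem_filter.1 hd).2.trans (Finset.mem_filter.1 hd').2.symm) h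
  · intro u hu
    rw [SimpleGraph.mem_neighborFinset, M.adj_iff] at hu
    obtain ⟨d, hd, hu⟩ := hu
    exact ⟨d, Finset.mem_filter.2 ⟨Finset.mem_univ _, hd⟩, hu⟩

open Classical in
/-- Faces other than triangles have nonnegative charge. -/
theorem euler_triangles (M : DartMap G s) (hp : ∀ d ∈ M.crossed, s d ≠ s (M.ν d))
    (hσ : ∀ d, M.σ d ≠ d) : 3 * Fintype.card D + 24 ≤
      ∑ d, ((if M.TrueTriangle d then 1 else 0) + 3 * if M.FalseTriangle d then 1 else 0) +
        12 * Fintype.card V := by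
  obtain ⟨f, hf⟩ : ∃ f : D → ℕ, ∀ d, f d = 3 * (if d ∈ M.crossed then 2 else 1) +
    ((if M.TrueTriangle d then 1 else 0) + 3 * if M.FalseTriangle d then 1 else 0) :=
    ⟨_, fun _ => rfl⟩
  have key : 12 * Nat.card (Quotient (Equiv.Perm.SameCycle.setoid M.face)) ≤ ∑ d, f d := by
    refine mul_card_orbits_le_sum _ _ _ fun x => ?_
    have f3 : ∀ d, 3 ≤ f d := fun d => by rw [hf]; split_ifs <;> omega
    have f6 : ∀ d ∈ M.crossed, 6 ≤ f d := fun d hd => by rw [hf, if_pos hd]; omega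
    have f9 : ∀ d, M.FalseTriangle d → 9 ≤ f d := fun d hd => by
      rw [hf, if_pos hd, if_pos hd.1]; omega
    have f4 : ∀ d, M.TrueTriangle d → 4 ≤ f d := fun d hd => by
      rw [hf, if_pos hd, if_neg hd.1]; omega
    have h1 : ∀ d, M.face d ≠ d := fun d h => by
      have hs := M.s_face d
      rw [h] at hs
      by_cases hd : d ∈ M.crossed
      · exact hp d hd hs
      · rw [← M.rev_of_notMem hd] at hs
        exact (M.adj_rev d).ne hs
    have c0 : M.face.SameCycle x x := .refl _ _
    have c1 : M.face.SameCycle x (M.face x) := Equiv.Perm.sameCycle_apply_right.2 c0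
    have c2 : M.face.SameCycle x (M.face (M.face x)) := Equiv.Perm.sameCycle_apply_right.2 c1
    have c3 : M.face.SameCycle x (M.face (M.face (M.face x))) :=
      Equiv.Perm.sameCycle_apply_right.2 c2
    have inj := M.face.injective
    by_cases h2 : M.face (M.face x) = x
    · refine ⟨{x, M.face x}, by simp [c0, c1], ?_⟩
      rw [Finset.sum_pair (h1 x).symm]
      by_cases hx : x ∈ M.crossed <;> by_cases hy : M.face x ∈ M.crossed
      · exact Nat.add_le_add (f6 _ hx) (f6 _ hy)
      · exact Nat.add_le_add (f9 x ⟨hx, hy, h2⟩) (f3 _)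
      · rw [add_comm]
        exact Nat.add_le_add (f9 _ ⟨hy, by rwa [h2], by rw [h2]⟩) (f3 _)
      · refine absurd ?_ (hσ (M.ν x))
        change M.face x = M.ν x
        have e1 := M.rev_of_notMem hx
        have e2 := M.rev_of_notMem hy
        rw [← e1, ← M.rev_rev (M.face x)]
        refine congrArg M.rev (M.eq_of_ends _ _ ?_ ?_)
        · rw [e2, ← M.s_face, h2]
        · rw [M.rev_rev, e1, M.s_face]
    by_cases h3 : M.face (M.face (M.face x)) = x
    · refine ⟨{x, M.face x, M.face (M.face x)}, by simp [c0, c1, c2], ?_⟩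
      rw [Finset.sum_insert, Finset.sum_pair (h1 _).symm]
      · have := f3 x
        have := f3 (M.face x)
        have := f3 (M.face (M.face x))
        by_cases hx : x ∈ M.crossed
        · have := f6 _ hx
          omega
        by_cases hy : M.face x ∈ M.crossed
        · have := f6 _ hy
          omega
        by_cases hz : M.face (M.face x) ∈ M.crossed
        · have := f6 _ hz
          omega
        have := f4 x ⟨hx, hy, hz, h3⟩
        have := f4 (M.face x) ⟨hy, hz, by rwa [h3], by rw [h3]⟩
        have := f4 (M.face (M.face x)) ⟨hz, by rwa [h3], by rwa [h3], by rw [h3]⟩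
        omega
      · simp [(h1 _).symm, Ne.symm h2]
    · refine ⟨{x, M.face x, M.face (M.face x), M.face (M.face (M.face x))},
        by simp [c0, c1, c2, c3], ?_⟩
      rw [Finset.sum_insert, Finset.sum_insert, Finset.sum_pair (h1 _).symm]
      · have := f3 x
        have := f3 (M.face x)
        have := f3 (M.face (M.face x))
        have := f3 (M.face (M.face (M.face x)))
        omega
      · simp [(h1 _).symm, Ne.symm h2, inj.eq_iff]
      · simp [(h1 _).symm, Ne.symm h2, Ne.symm h3]
  have he := M.euler
  have hw : ∀ d, (if M.ν (M.ν d) = d then 2 else 3) = (if d ∈ M.crossed then 2 else 1) + 1 := by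
    intro d
    by_cases hd : M.ν (M.ν d) = d
    · rw [if_pos hd, if_neg (show d ∉ M.crossed from not_not.2 hd)]
    · rw [if_neg hd, if_pos (show d ∈ M.crossed from hd)]
  simp only [hw] at he
  rw [Finset.sum_add_distrib, Finset.sum_const, Finset.card_univ, smul_eq_mul, mul_one] at he
  simp only [hf] at key
  rw [Finset.sum_add_distrib, ← Finset.mul_sum] at key
  simp only [face] at key
  omega

end DartMap

/-- Half of what a vertex pays to a crossing between two triangles, as a function of its degree. -/
def halfPayment (n : ℕ) : ℕ :=
  if n ≤ 7 then 16 else if n = 8 then 18 else if n ≤ 10 then 21 else 24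

open Classical in
/-- What a dart at a vertex of degree `n` pays, given which neighboring faces are triangles. -/
noncomputable def payment (n : ℕ) (a b : Prop) : ℕ :=
  if a ∧ b then 2 * halfPayment n else if a ∨ b then 22 else 0

open Classical in
theorem sum_payment_le {D : Type*} (S : Finset D) (σ : Equiv.Perm D) (hS : ∀ d, σ d ∈ S ↔ d ∈ S)
    {c a b t : D → Prop} (hcard : 7 ≤ S.card) (hac : ∀ d, a d → c d) (ha : ∀ d, a (σ d) → ¬ c d)
    (hb : ∀ d, b d → c d ∧ ¬ c (σ d)) (ht : ∀ d, t (σ d) → ¬ c (σ d) ∧ ¬ c d) :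
    ∑ d ∈ S, (payment S.card (a d) (b d) + 12 * if t d then 1 else 0) + 144 ≤ 36 * S.card := by
  have hσ : ∀ g : D → ℕ, ∑ d ∈ S, g (σ d) = ∑ d ∈ S, g d := fun g =>
    Finset.sum_equiv σ (fun d => (hS d).symm) fun _ _ => rfl
  set A := halfPayment S.card with hA
  have hA12 : 16 ≤ A := by
    simp only [hA, halfPayment]
    split_ifs <;> omega
  let f : D → ℕ := fun d => A * (if a d then 1 else 0) + 12 * (if t d then 1 else 0) +
    (22 - A) * if b d ∧ ¬ a d then 1 else 0
  let g : D → ℕ := fun d => A * (if b d then 1 else 0) + (22 - A) * if a d ∧ ¬ b d then 1 else 0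
  have h1 : ∑ d ∈ S, (payment S.card (a d) (b d) + 12 * if t d then 1 else 0) ≤
      ∑ d ∈ S, (f (σ d) + g d) := by
    rw [Finset.sum_add_distrib (f := fun d => f (σ d)), hσ, ← Finset.sum_add_distrib]
    refine Finset.sum_le_sum fun d _ => ?_
    simp only [payment, f, g, ← hA]
    by_cases h1 : a d <;> by_cases h2 : b d <;> simp [h1, h2] <;> omega
  have h2 : ∀ d, f (σ d) + g d ≤ if (c d ↔ c (σ d)) then 12 else A := by
    intro d
    clear h1 hσ
    clear_value A
    clear hA
    have := hac d
    have := hac (σ d)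
    have := ha d
    have := hb d
    have := ht d
    simp only [f, g]
    by_cases h1 : c d <;> by_cases h2 : c (σ d) <;> by_cases h3 : a (σ d) <;>
      by_cases h4 : b d <;> by_cases h5 : t (σ d) <;> by_cases h6 : b (σ d) <;>
      by_cases h7 : a d <;> simp_all <;> omega
  have h3 : ∑ d ∈ S, (f (σ d) + g d) + 144 ≤ 36 * S.card := by
    by_cases hodd : ∃ d ∈ S, (c d ↔ c (σ d))
    · obtain ⟨d, hd, hcd⟩ := hodd
      have e1 := Finset.add_sum_erase S (fun d => f (σ d) + g d) hd
      have e2 := Finset.sum_le_card_nsmul (S.erase d) (fun d => f (σ d) + g d) A fun x _ =>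
        (h2 x).trans (by split_ifs <;> omega)
      have e3 := h2 d
      rw [if_pos hcd] at e3
      rw [Finset.card_erase_of_mem hd, smul_eq_mul] at e2
      simp only [hA, halfPayment] at e1 e2 e3
      split_ifs at e2 <;> omega
    · push Not at hodd
      have e1 := Finset.sum_le_card_nsmul S (fun d => f (σ d) + g d) A fun x hx => by
        have h := h2 x
        rwa [if_neg] at h
        have := hodd x hx
        tauto
      have e2 : S.card = 2 * ∑ d ∈ S, if c d then 1 else 0 := by
        rw [two_mul]
        nth_rw 2 [← hσ fun d => if c d then 1 else 0]
        rw [← Finset.sum_add_distrib, Finset.card_eq_sum_ones]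
        refine Finset.sum_congr rfl fun d hd => ?_
        have := hodd d hd
        by_cases h1 : c d <;> by_cases h2 : c (σ d) <;> simp_all
      simp only [smul_eq_mul, hA, halfPayment] at e1
      split_ifs at e1 <;> omega
  exact (Nat.add_le_add_right h1 _).trans h3

theorem le_sum_halfPayment {n : Fin 4 → ℕ} (hn : Monotone n) (h7 : ∀ i, 7 ≤ n i)
    (h : ¬ ((n 0 = 7 ∧ n 1 ≤ 8 ∧ n 2 ≤ 8 ∧ n 3 ≤ 10) ∨
      (n 0 ≤ 8 ∧ n 1 ≤ 8 ∧ n 2 ≤ 8 ∧ n 3 ≤ 8))) : 72 ≤ ∑ i, halfPayment (n i) := by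
  have h1 : ∀ i, 16 ≤ halfPayment (n i) ∧ (8 ≤ n i → 18 ≤ halfPayment (n i)) ∧
      (9 ≤ n i → 21 ≤ halfPayment (n i)) ∧ (11 ≤ n i → 24 ≤ halfPayment (n i)) := fun i => by
    simp only [halfPayment]
    split_ifs <;> omega
  rw [Fin.sum_univ_four]
  have a0 := h1 0
  have a1 := h1 1
  have a2 := h1 2
  have a3 := h1 3
  have := h7 0
  have : n 0 ≤ n 1 := hn (by decide)
  have : n 1 ≤ n 2 := hn (by decide)
  have : n 2 ≤ n 3 := hn (by decide)
  omega

theorem SimpleGraph.le_sum_halfPayment_degree {V : Type*} [Fintype V] {G : SimpleGraph V}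
    [DecidableRel G.Adj] (hmin : ∀ v, 7 ≤ G.degree v)
    (hno : ¬ ∃ a b c d : V, a ≠ b ∧ a ≠ c ∧ a ≠ d ∧ b ≠ c ∧ b ≠ d ∧ c ≠ d ∧
      G.Adj a b ∧ G.Adj a c ∧ G.Adj a d ∧ G.Adj b c ∧ G.Adj b d ∧ G.Adj c d ∧
      G.degree a ≤ G.degree b ∧ G.degree b ≤ G.degree c ∧
      G.degree c ≤ G.degree d ∧
      ((G.degree a = 7 ∧ G.degree b ≤ 8 ∧ G.degree c ≤ 8 ∧ G.degree d ≤ 10) ∨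
        (G.degree a ≤ 8 ∧ G.degree b ≤ 8 ∧ G.degree c ≤ 8 ∧ G.degree d ≤ 8)))
    {f : Fin 4 → V} (hf : Pairwise fun i j => G.Adj (f i) (f j)) :
    72 ≤ ∑ i, halfPayment (G.degree (f i)) := by
  have hτ := Tuple.monotone_sort fun i => G.degree (f i)
  set τ := Tuple.sort fun i => G.degree (f i)
  rw [← Equiv.sum_comp τ]
  refine le_sum_halfPayment (n := fun i => G.degree (f (τ i))) hτ (fun _ => hmin _) fun h => hno ?_
  have hadj : ∀ {i j}, i ≠ j → G.Adj (f (τ i)) (f (τ j)) := fun hij => hf (τ.injective.ne hij)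
  have e01 := hadj (show (0 : Fin 4) ≠ 1 by decide)
  have e02 := hadj (show (0 : Fin 4) ≠ 2 by decide)
  have e03 := hadj (show (0 : Fin 4) ≠ 3 by decide)
  have e12 := hadj (show (1 : Fin 4) ≠ 2 by decide)
  have e13 := hadj (show (1 : Fin 4) ≠ 3 by decide)
  have e23 := hadj (show (2 : Fin 4) ≠ 3 by decide)
  exact ⟨f (τ 0), f (τ 1), f (τ 2), f (τ 3), e01.ne, e02.ne, e03.ne, e12.ne, e13.ne, e23.ne,
    e01, e02, e03, e12, e13, e23, hτ (by decide), hτ (by decide), hτ (by decide), h⟩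

open Classical in
theorem le_sum_payment {n : Fin 4 → ℕ} {a b c d : Prop}
    (h : a → b → c → d → 72 ≤ ∑ i, halfPayment (n i)) :
    36 * ((if a then 1 else 0) + (if b then 1 else 0) + (if c then 1 else 0) +
      if d then 1 else 0) ≤
      payment (n 0) a d + payment (n 1) b a + payment (n 2) c b + payment (n 3) d c := by
  have h1 : ∀ n, 16 ≤ halfPayment n := fun n => by
    simp only [halfPayment]
    split_ifs <;> omega
  have a0 := h1 (n 0)
  have a1 := h1 (n 1)
  have a2 := h1 (n 2)
  have a3 := h1 (n 3)
  rw [Fin.sum_univ_four] at h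
  simp only [payment]
  by_cases ha : a <;> by_cases hb : b <;> by_cases hc : c <;> by_cases hd : d <;>
    simp only [ha, hb, hc, hd, and_self, or_self, and_true, and_false,
      or_true, or_false, if_true, if_false, forall_const] at h ⊢ <;> omega

namespace DartMap

variable {V D : Type*} [Fintype V] [Fintype D] {G : SimpleGraph V} {s : D → V}

open Classical in
theorem sum_falseTriangle_le (M : DartMap G s) (hrev : ∀ d ∈ M.crossed, M.rev d = M.ν (M.ν d))
    {n : V → ℕ} (hK : ∀ f : Fin 4 → V, Pairwise (fun i j => G.Adj (f i) (f j)) →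
      72 ≤ ∑ i, halfPayment (n (f i))) :
    36 * ∑ d, (if M.FalseTriangle d then 1 else 0) ≤
      ∑ d, payment (n (s d)) (M.FalseTriangle d) (M.FalseTriangle (M.ν (M.ν (M.ν d)))) := by
  set t : D → ℕ := fun d => if M.FalseTriangle d then 1 else 0 with ht
  set p : D → ℕ := fun d =>
    payment (n (s d)) (M.FalseTriangle d) (M.FalseTriangle (M.ν (M.ν (M.ν d)))) with hp
  have key : ∀ d, 36 * (t d + t (M.ν d) + t (M.ν (M.ν d)) + t (M.ν (M.ν (M.ν d)))) ≤
      p d + p (M.ν d) + p (M.ν (M.ν d)) + p (M.ν (M.ν (M.ν d))) := by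
    intro d
    simp only [ht, hp, M.ν_four]
    refine le_sum_payment (n := fun i => n ((![s d, s (M.ν d), s (M.ν (M.ν d)),
      s (M.ν (M.ν (M.ν d)))] : Fin 4 → V) i)) fun h0 h1 h2 h3 => hK _ ?_
    have e01 := h0.adj
    have e12 := h1.adj
    have e23 := h2.adj
    have e30 := h3.adj
    rw [M.ν_four] at e30
    have e02 := M.adj_rev d
    have e13 := M.adj_rev (M.ν d)
    rw [hrev _ h0.1] at e02
    rw [hrev _ h1.1] at e13
    intro i j hij
    fin_cases i <;> fin_cases j <;> first | exact absurd rfl hij | assumption | (symm; assumption)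
  have hsum : ∀ g : D → ℕ, ∑ d, (g d + g (M.ν d) + g (M.ν (M.ν d)) + g (M.ν (M.ν (M.ν d)))) =
      4 * ∑ d, g d := by
    intro g
    have e1 : ∀ g : D → ℕ, ∑ d, g (M.ν d) = ∑ d, g d := Equiv.sum_comp M.ν
    rw [Finset.sum_add_distrib, Finset.sum_add_distrib, Finset.sum_add_distrib,
      e1 fun d => g (M.ν (M.ν d)), e1 fun d => g (M.ν d), e1]
    ring
  have := Finset.sum_le_sum fun d (_ : d ∈ Finset.univ) => key d
  rw [← Finset.mul_sum, hsum, hsum] at this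
  change 36 * ∑ d, t d ≤ ∑ d, p d
  omega

open Classical in
theorem false_of_degree (M : DartMap G s) (hrev : ∀ d ∈ M.crossed, M.rev d = M.ν (M.ν d))
    (hp : ∀ d ∈ M.crossed, s d ≠ s (M.ν d)) [DecidableRel G.Adj]
    (hmin : ∀ v, 7 ≤ G.degree v) (hK : ∀ f : Fin 4 → V, Pairwise (fun i j => G.Adj (f i) (f j)) →
      72 ≤ ∑ i, halfPayment (G.degree (f i))) : False := by
  have hσ : ∀ d, M.σ d ≠ d := by
    intro d hd
    have h : Finset.univ.filter (fun x => s x = s d) ⊆ {d} := by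
      intro x hx
      rw [Finset.mem_filter, eq_comm, ← M.sameCycle_iff] at hx
      rw [Finset.mem_singleton]
      exact (hx.2.eq_of_left hd).symm
    have := Finset.card_le_card h
    rw [M.card_fiber, Finset.card_singleton] at this
    have := hmin (s d)
    omega
  have h1 := M.euler_triangles hp hσ
  have h2 := M.sum_falseTriangle_le (n := fun v => G.degree v) hrev hK
  have h3 : ∀ v, ∑ d with s d = v, (payment (G.degree (s d)) (M.FalseTriangle d)
      (M.FalseTriangle (M.ν (M.ν (M.ν d)))) + 12 * if M.TrueTriangle d then 1 else 0) + 144 ≤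
      ∑ d with s d = v, 36 := by
    intro v
    have h := sum_payment_le (Finset.univ.filter fun d => s d = v) M.σ
      (fun d => by simp only [Finset.mem_filter, Finset.mem_univ, true_and, M.s_σ])
      (c := (· ∈ M.crossed)) (a := M.FalseTriangle) (t := M.TrueTriangle)
      (b := fun d => M.FalseTriangle (M.ν (M.ν (M.ν d)))) ?_ (fun d hd => hd.1) ?_ ?_ ?_
    · rw [Finset.sum_const, smul_eq_mul, mul_comm _ 36]
      rw [M.card_fiber] at h ⊢
      refine le_of_eq_of_le ?_ h
      congr 1
      refine Finset.sum_congr rfl fun d hd => ?_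
      rw [(Finset.mem_filter.1 hd).2]
    · rw [M.card_fiber]
      exact hmin v
    · intro d hd h
      have := M.σ.injective hd.2.2
      rw [← this, M.ν_mem_crossed] at h
      exact hd.2.1 h
    · intro d hd
      have h1 := hd.2.1
      simp only [face, Equiv.Perm.mul_apply, M.ν_four] at h1
      refine ⟨?_, h1⟩
      have h2 := hd.1
      simpa only [M.ν_mem_crossed] using h2
    · intro d hd
      refine ⟨hd.1, fun h => ?_⟩
      have := M.σ.injective hd.2.2.2
      rw [← this, M.ν_mem_crossed] at h
      exact hd.2.2.1 h
  have h4 := Finset.sum_le_sum fun v (_ : v ∈ Finset.univ) => h3 v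
  rw [Finset.sum_add_distrib, Finset.sum_fiberwise Finset.univ s,
    Finset.sum_fiberwise Finset.univ s, Finset.sum_const,
    Finset.sum_const, Finset.sum_add_distrib, ← Finset.mul_sum, Finset.card_univ,
    Finset.card_univ, smul_eq_mul, smul_eq_mul] at h4
  rw [Finset.sum_add_distrib, ← Finset.mul_sum] at h1
  omega

end DartMap

/-- Every 1-planar graph with minimum degree 7 contains a copy of K₄ whose
vertex degrees d₁ ≤ d₂ ≤ d₃ ≤ d₄ satisfy d₁ = 7, d₂ ≤ 8, d₃ ≤ 8, d₄ ≤ 10,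
or are all at most 8. -/
theorem one_planar_light_K4 {V : Type*} [Fintype V] [Nonempty V]
    (G : SimpleGraph V) [DecidableRel G.Adj] (h1p : G.IsOnePlanar)
    (hmin : ∀ v : V, 7 ≤ G.degree v) :
    ∃ a b c d : V, a ≠ b ∧ a ≠ c ∧ a ≠ d ∧ b ≠ c ∧ b ≠ d ∧ c ≠ d ∧
      G.Adj a b ∧ G.Adj a c ∧ G.Adj a d ∧ G.Adj b c ∧ G.Adj b d ∧ G.Adj c d ∧
      G.degree a ≤ G.degree b ∧ G.degree b ≤ G.degree c ∧
      G.degree c ≤ G.degree d ∧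
      ((G.degree a = 7 ∧ G.degree b ≤ 8 ∧ G.degree c ≤ 8 ∧ G.degree d ≤ 10) ∨
        (G.degree a ≤ 8 ∧ G.degree b ≤ 8 ∧ G.degree c ≤ 8 ∧ G.degree d ≤ 8)) := by
  classical
  by_contra hno
  obtain ⟨Γ⟩ := h1p
  have : Nonempty G.Dart := by
    obtain ⟨v⟩ := ‹Nonempty V›
    have hv : 0 < G.degree v := (Nat.zero_lt_succ 6).trans_le (hmin v)
    obtain ⟨w, hw⟩ := (G.degree_pos_iff_exists_adj v).1 hv
    exact ⟨⟨(v, w), hw⟩⟩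
  obtain ⟨M⟩ := Γ.nonempty_dartMap
  obtain ⟨M, hrev, hp⟩ := M.exists_proper
  exact M.false_of_degree hrev hp hmin fun _ => G.le_sum_halfPayment_degree hmin hno
end

section
/- Every 1-planar graph with minimum degree 7 contains an edge both of whose endpoints have degree exactly 7. -/
namespace OnePlanar

/-- A space of binary chains generated by a family in which every coordinate is used
at most twice (MacLane's condition). -/
def TwoGenerated {E : Type*} (Z : Submodule (ZMod 2) (E →₀ ZMod 2)) : Prop :=
  ∃ S : Set (E →₀ ZMod 2), Submodule.span (ZMod 2) S = Z ∧
    ∀ e, ∀ a ∈ S, ∀ b ∈ S, ∀ c ∈ S, a e ≠ 0 → b e ≠ 0 → c e ≠ 0 → a = b ∨ a = c ∨ b = c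

theorem zmod_two_eq_one {x : ZMod 2} (h : x ≠ 0) : x = 1 := by
  revert x; decide

theorem add_self_two {M : Type*} [AddCommGroup M] [Module (ZMod 2) M] (x : M) : x + x = 0 := by
  have h : (1 : ZMod 2) + 1 = 0 := by decide
  have := add_smul (1 : ZMod 2) 1 x
  rw [h, zero_smul, one_smul] at this
  exact this.symm

theorem TwoGenerated.inf_ker {E : Type*} {Z : Submodule (ZMod 2) (E →₀ ZMod 2)}
    (hZ : TwoGenerated Z) (e : E) :
    TwoGenerated (Z ⊓ LinearMap.ker (Finsupp.lapply (R := ZMod 2) (M := ZMod 2) e)) := by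
  obtain ⟨S, rfl, h2⟩ := hZ
  by_cases hS : ∃ a ∈ S, a e ≠ 0
  · obtain ⟨a, haS, hae⟩ := hS
    let g : (E →₀ ZMod 2) →ₗ[ZMod 2] (E →₀ ZMod 2) :=
      LinearMap.id + (Finsupp.lapply (R := ZMod 2) (M := ZMod 2) e).smulRight a
    have hg : ∀ x, g x = x + x e • a := fun x => by simp [g]
    have hae1 := zmod_two_eq_one hae
    have hge : ∀ x, g x e = 0 := fun x => by
      rw [hg]; simp only [Finsupp.add_apply, Finsupp.smul_apply, hae1, smul_eq_mul, mul_one]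
      exact add_self_two _
    have hg0 : ∀ x : E →₀ ZMod 2, x e = 0 → g x = x := fun x hx => by rw [hg, hx]; simp
    refine ⟨g '' S, ?_, ?_⟩
    · rw [Submodule.span_image]
      apply le_antisymm
      · rintro _ ⟨x, hx, rfl⟩
        refine ⟨?_, by simpa using hge x⟩
        rw [hg]
        exact Submodule.add_mem _ hx (Submodule.smul_mem _ _ (Submodule.subset_span haS))
      · rintro x ⟨hx, hxe⟩
        exact ⟨x, hx, hg0 x (by simpa using hxe)⟩
    · have key : ∀ e', ∀ x ∈ S, ∀ y ∈ S, ∀ z ∈ S, g x e' ≠ 0 → g y e' ≠ 0 → g z e' ≠ 0 →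
          x e ≠ 0 → g x = g y ∨ g x = g z ∨ g y = g z := by
        intro e' x hx y hy z hz hgx hgy hgz hxe
        have hga : g a = 0 := by rw [hg, hae1, one_smul]; exact add_self_two _
        have uniq : ∀ w ∈ S, w e ≠ 0 → g w e' ≠ 0 → x = w := by
          intro w hw hwe hgw
          rcases h2 e a haS x hx w hw hae hxe hwe with h | h | h
          · rw [← h, hga] at hgx; exact absurd rfl hgx
          · rw [← h, hga] at hgw; exact absurd rfl hgw
          · exact h
        by_cases hye : y e = 0
        · by_cases hze : z e = 0
          · rw [hg0 y hye] at hgy ⊢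
            rw [hg0 z hze] at hgz ⊢
            have hax : a e' ≠ 0 ∨ x e' ≠ 0 := by
              by_contra! h
              rw [hg] at hgx
              simp [h.1, h.2] at hgx
            rcases hax with h | h
            · rcases h2 e' a haS y hy z hz h hgy hgz with h' | h' | h'
              · exact absurd hye (h' ▸ hae)
              · exact absurd hze (h' ▸ hae)
              · exact Or.inr (Or.inr h')
            · rcases h2 e' x hx y hy z hz h hgy hgz with h' | h' | h'
              · exact absurd hye (h' ▸ hxe)
              · exact absurd hze (h' ▸ hxe)
              · exact Or.inr (Or.inr h')
          · exact Or.inr (Or.inl (by rw [uniq z hz hze hgz]))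
        · exact Or.inl (by rw [uniq y hy hye hgy])
      rintro e' _ ⟨x, hx, rfl⟩ _ ⟨y, hy, rfl⟩ _ ⟨z, hz, rfl⟩ hgx hgy hgz
      by_cases hxe : x e = 0
      · by_cases hye : y e = 0
        · by_cases hze : z e = 0
          · rw [hg0 x hxe] at hgx ⊢
            rw [hg0 y hye] at hgy ⊢
            rw [hg0 z hze] at hgz ⊢
            exact h2 e' x hx y hy z hz hgx hgy hgz
          · rcases key e' z hz x hx y hy hgz hgx hgy hze with h | h | h <;> simp [h]
        · rcases key e' y hy x hx z hz hgy hgx hgz hye with h | h | h <;> simp [h]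
      · exact key e' x hx y hy z hz hgx hgy hgz hxe
  · push Not at hS
    refine ⟨S, ?_, h2⟩
    symm
    rw [inf_eq_left, Submodule.span_le]
    intro x hx
    simpa using hS x hx

theorem TwoGenerated.inf_supported {E : Type*} {Z : Submodule (ZMod 2) (E →₀ ZMod 2)}
    (hZ : TwoGenerated Z) {D : Set E} (hD : D.Finite) :
    TwoGenerated (Z ⊓ Finsupp.supported (ZMod 2) (ZMod 2) Dᶜ) := by
  induction D, hD using Set.Finite.induction_on with
  | empty => simpa using hZ
  | @insert e D _ _ ih =>
    convert ih.inf_ker e using 1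
    rw [inf_assoc]
    congr 1
    ext x
    simp only [Finsupp.mem_supported', Submodule.mem_inf, LinearMap.mem_ker,
      Finsupp.lapply_apply, Set.mem_compl_iff, not_not, Set.mem_insert_iff, forall_eq_or_imp]
    exact and_comm

/-- The binary chain of endpoints of an unordered pair. -/
noncomputable def endChain {U : Type*} : Sym2 U → (U →₀ ZMod 2) :=
  Sym2.lift ⟨fun a b => Finsupp.single a 1 + Finsupp.single b 1, fun _ _ => add_comm _ _⟩

theorem endChain_mk {U : Type*} (a b : U) :
    endChain s(a, b) = Finsupp.single a 1 + Finsupp.single b 1 := rfl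

/-- The boundary map of the multigraph with edge ends `ends`. -/
noncomputable def bdry {U I : Type*} (ends : I → Sym2 U) :
    (I →₀ ZMod 2) →ₗ[ZMod 2] (U →₀ ZMod 2) :=
  Finsupp.linearCombination (ZMod 2) (fun i => endChain (ends i))

theorem bdry_single {U I : Type*} (ends : I → Sym2 U) (i : I) :
    bdry ends (Finsupp.single i 1) = endChain (ends i) := by
  simp [bdry]

/-- Edges of the integer grid: from a point to its right neighbour (`true`) or upper
neighbour (`false`). -/
abbrev GridEdge := (ℤ × ℤ) × Bool

/-- The second endpoint of a grid edge; the first one is `e.1`. -/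
def GridEdge.tgt (e : GridEdge) : ℤ × ℤ :=
  if e.2 then (e.1.1 + 1, e.1.2) else (e.1.1, e.1.2 + 1)

/-- The pair of endpoints of a grid edge. -/
def GridEdge.ends (e : GridEdge) : Sym2 (ℤ × ℤ) := s(e.1, e.tgt)

/-- The boundary chain of a unit square of the grid. -/
noncomputable def unitSquare (p : ℤ × ℤ) : GridEdge →₀ ZMod 2 :=
  Finsupp.single (p, true) 1 + Finsupp.single ((p.1 + 1, p.2), false) 1 +
    Finsupp.single ((p.1, p.2 + 1), true) 1 + Finsupp.single (p, false) 1

theorem exists_int_primitive {M : Type*} [AddCommGroup M] (g : ℤ → M) :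
    ∃ f : ℤ → M, f 0 = 0 ∧ ∀ n, f (n + 1) = f n + g n := by
  refine ⟨fun n => ∑ k ∈ Finset.Ico 0 n, g k - ∑ k ∈ Finset.Ico n 0, g k, by simp, fun n => ?_⟩
  rcases le_or_gt 0 n with h | h
  · have h1 : Finset.Ico 0 (n + 1) = insert n (Finset.Ico 0 n) := by ext; simp; omega
    have h2 : Finset.Ico n 0 = ∅ := by ext; simp; omega
    have h3 : Finset.Ico (n + 1) 0 = ∅ := by ext; simp; omega
    simp [h1, h2, h3, add_comm]
  · have h1 : Finset.Ico n 0 = insert n (Finset.Ico (n + 1) 0) := by ext; simp; omega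
    have h2 : Finset.Ico 0 n = ∅ := by ext; simp; omega
    have h3 : Finset.Ico 0 (n + 1) = ∅ := by ext; simp; omega
    simp [h1, h2, h3]

theorem grid_twoGenerated : TwoGenerated (LinearMap.ker (bdry GridEdge.ends)) := by
  refine ⟨Set.range unitSquare, le_antisymm ?_ ?_, ?_⟩
  · rw [Submodule.span_le]
    rintro _ ⟨p, rfl⟩
    simp only [SetLike.mem_coe, LinearMap.mem_ker, unitSquare, map_add, bdry_single,
      GridEdge.ends, endChain_mk, GridEdge.tgt]
    simp only [if_true, Bool.false_eq_true, if_false]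
    have h := fun q : ℤ × ℤ => add_self_two (Finsupp.single q (1 : ZMod 2))
    have := h p
    have := h (p.1 + 1, p.2)
    have := h (p.1, p.2 + 1)
    have := h (p.1 + 1, p.2 + 1)
    grind
  · obtain ⟨col, hcol0, hcol⟩ := exists_int_primitive
      (fun j : ℤ => Finsupp.single (((0 : ℤ), j), false) (1 : ZMod 2))
    choose row hrow0 hrow using fun j : ℤ => exists_int_primitive
      (fun i : ℤ => Finsupp.single ((i, j), true) (1 : ZMod 2))
    let path : ℤ × ℤ → GridEdge →₀ ZMod 2 := fun p => col p.2 + row p.2 p.1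
    let Path := Finsupp.linearCombination (ZMod 2) path
    set Q := Submodule.span (ZMod 2) (Set.range unitSquare)
    have hvert : ∀ j i : ℤ, path (i, j) + path (i, j + 1) + Finsupp.single ((i, j), false) 1 ∈ Q := by
      intro j i
      have step : ∀ i : ℤ, path (i + 1, j) + path (i + 1, j + 1) +
          Finsupp.single ((i + 1, j), false) 1 =
          (path (i, j) + path (i, j + 1) + Finsupp.single ((i, j), false) 1) +
            unitSquare (i, j) := by
        intro i
        simp only [path, unitSquare, hrow]
        have := add_self_two (Finsupp.single ((i, j), false) (1 : ZMod 2))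
        grind
      have hsq : ∀ p, unitSquare p ∈ Q := fun p => Submodule.subset_span ⟨p, rfl⟩
      induction i using Int.induction_on with
      | zero =>
        convert Q.zero_mem using 1
        simp only [path, hcol, hrow0]
        have := add_self_two (Finsupp.single (((0 : ℤ), j), false) (1 : ZMod 2))
        have := add_self_two (col j)
        grind
      | succ i ih => rw [step]; exact Q.add_mem ih (hsq _)
      | pred i ih =>
        have := step (-(i : ℤ) - 1)
        rw [sub_add_cancel] at this
        rw [this] at ih
        exact (Q.add_mem_iff_left (hsq _)).1 ih
    have hedge : ∀ e : GridEdge, Finsupp.single e 1 + Path (endChain e.ends) ∈ Q := by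
      rintro ⟨⟨i, j⟩, b⟩
      cases b
      · convert hvert j i using 1
        simp [Path, GridEdge.ends, GridEdge.tgt, endChain_mk, add_comm]
      · convert Q.zero_mem using 1
        simp only [GridEdge.ends, GridEdge.tgt, endChain_mk, map_add, Path,
          Finsupp.linearCombination_single, one_smul, path, if_true, hrow]
        have := add_self_two (Finsupp.single ((i, j), true) (1 : ZMod 2))
        have := add_self_two (col j)
        have := add_self_two (row j i)
        grind
    have hall : ∀ C : GridEdge →₀ ZMod 2, C + Path (bdry GridEdge.ends C) ∈ Q := by
      intro C
      induction C using Finsupp.induction_linear with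
      | zero => simp
      | add f g hf hg =>
        convert Q.add_mem hf hg using 1
        simp only [map_add]; abel
      | single e a =>
        convert Q.smul_mem a (hedge e) using 1
        rw [← bdry_single, smul_add, ← map_smul, ← map_smul]
        simp
    intro C hC
    have := hall C
    rw [LinearMap.mem_ker.1 hC, map_zero, add_zero] at this
    exact this
  · rintro ⟨⟨i, j⟩, b⟩ _ ⟨⟨x, y⟩, rfl⟩ _ ⟨⟨z, w⟩, rfl⟩ _ ⟨⟨s, t⟩, rfl⟩
    have key : ∀ x y : ℤ, unitSquare (x, y) ((i, j), b) ≠ 0 →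
        (x = i ∧ y = j) ∨ (b = true ∧ x = i ∧ y + 1 = j) ∨ (b = false ∧ x + 1 = i ∧ y = j) := by
      intro x y h
      by_contra hc
      apply h
      simp only [unitSquare, Finsupp.add_apply, Finsupp.single_apply, Prod.mk.injEq]
      have h1 : ¬ ((x = i ∧ y = j) ∧ true = b) := by tauto
      have h2 : ¬ ((x + 1 = i ∧ y = j) ∧ false = b) := by tauto
      have h3 : ¬ ((x = i ∧ y + 1 = j) ∧ true = b) := by tauto
      have h4 : ¬ ((x = i ∧ y = j) ∧ false = b) := by tauto
      simp only [h1, h2, h3, h4, if_false, add_zero]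
    intro h1 h2 h3
    replace h1 := key _ _ h1
    replace h2 := key _ _ h2
    replace h3 := key _ _ h3
    clear key
    have : (x = z ∧ y = w) ∨ (x = s ∧ y = t) ∨ (z = s ∧ w = t) := by
      cases b <;> simp only [Bool.false_eq_true, false_and, true_and, false_or, or_false,
        reduceCtorEq] at h1 h2 h3 <;> omega
    rcases this with ⟨rfl, rfl⟩ | ⟨rfl, rfl⟩ | ⟨rfl, rfl⟩ <;> simp

/-- `A` is a union of connected components of the subgraph of the grid induced on `Y`. -/
def GridClosedIn (Y A : Set (ℤ × ℤ)) : Prop :=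
  ∀ e : GridEdge, e.1 ∈ Y → e.tgt ∈ Y → (e.1 ∈ A ↔ e.tgt ∈ A)

/-- A set of grid points inducing a connected subgraph. -/
def GridConn (B : Set (ℤ × ℤ)) : Prop :=
  B.Nonempty ∧ ∀ A ⊆ B, A.Nonempty → GridClosedIn B A → B ⊆ A

theorem GridConn.exists_chain {B : Set (ℤ × ℤ)} (hB : GridConn B) {p r : ℤ × ℤ}
    (hp : p ∈ B) (hr : r ∈ B) :
    ∃ c ∈ Finsupp.supported (ZMod 2) (ZMod 2) {e : GridEdge | e.1 ∈ B ∧ e.tgt ∈ B},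
      bdry GridEdge.ends c = Finsupp.single p 1 + Finsupp.single r 1 := by
  set W := Finsupp.supported (ZMod 2) (ZMod 2) {e : GridEdge | e.1 ∈ B ∧ e.tgt ∈ B}
  let A : Set (ℤ × ℤ) := {q | q ∈ B ∧ ∃ c ∈ W,
    bdry GridEdge.ends c = Finsupp.single q 1 + Finsupp.single r 1}
  have hsub : B ⊆ A := by
    refine hB.2 A (fun q hq => hq.1) ⟨r, hr, 0, W.zero_mem, by simp [add_self_two]⟩ ?_
    intro e h1 h2
    have he : Finsupp.single e (1 : ZMod 2) ∈ W := Finsupp.single_mem_supported _ _ ⟨h1, h2⟩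
    constructor
    · rintro ⟨-, c, hc, hbc⟩
      refine ⟨h2, c + Finsupp.single e 1, W.add_mem hc he, ?_⟩
      rw [map_add, hbc, bdry_single, GridEdge.ends, endChain_mk]
      have := add_self_two (Finsupp.single e.1 (1 : ZMod 2))
      grind
    · rintro ⟨-, c, hc, hbc⟩
      refine ⟨h1, c + Finsupp.single e 1, W.add_mem hc he, ?_⟩
      rw [map_add, hbc, bdry_single, GridEdge.ends, endChain_mk]
      have := add_self_two (Finsupp.single e.tgt (1 : ZMod 2))
      grind
  exact (hsub hp).2

/-- The multigraph with edge ends `ends` is a minor of the grid, with finite branch sets `B`. -/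
structure GridModel {U I : Type*} (ends : I → Sym2 U) (B : U → Set (ℤ × ℤ)) : Prop where
  finite : ∀ u, (B u).Finite
  conn : ∀ u, GridConn (B u)
  disjoint : ∀ u w, u ≠ w → Disjoint (B u) (B w)
  edge : ∀ i, ∃ e : GridEdge, ∃ u w, ends i = s(u, w) ∧ e.1 ∈ B u ∧ e.tgt ∈ B w

theorem GridModel.twoGenerated {U I : Type*} [Finite U] {ends : I → Sym2 U}
    {B : U → Set (ℤ × ℤ)} (hB : GridModel ends B) (hinj : Function.Injective ends)
    (hdiag : ∀ i, ¬ (ends i).IsDiag) :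
    TwoGenerated (LinearMap.ker (bdry ends)) := by
  classical
  choose φ φs φt hφe hφs hφt using hB.edge
  have huniq : ∀ {p u w}, p ∈ B u → p ∈ B w → u = w := by
    intro p u w hu hw
    by_contra h
    exact (Set.disjoint_left.1 (hB.disjoint u w h)) hu hw
  have hφinj : Function.Injective φ := by
    intro i j hij
    apply hinj
    rw [hφe, hφe, huniq (hφs i) (hij ▸ hφs j), huniq (hφt i) (hij ▸ hφt j)]
  have hφne : ∀ i, φs i ≠ φt i := fun i h => hdiag i (by rw [hφe, h]; simp)
  -- the label of a grid point is the chain of the vertex whose branch set contains it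
  let lab : ℤ × ℤ → (U →₀ ZMod 2) := fun p =>
    if h : ∃ u, p ∈ B u then Finsupp.single h.choose 1 else 0
  have hlab : ∀ {p u}, p ∈ B u → lab p = Finsupp.single u 1 := by
    intro p u hp
    have h : ∃ u, p ∈ B u := ⟨u, hp⟩
    simp only [lab, dif_pos h]
    rw [huniq h.choose_spec hp]
  have hlab0 : ∀ {p}, (¬ ∃ u, p ∈ B u) → lab p = 0 := fun h => by simp only [lab, dif_neg h]
  let D : Set GridEdge := {e | lab e.1 ≠ lab e.tgt} \ Set.range φ
  have hD : D.Finite := by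
    have hP : (⋃ u, B u).Finite := Set.finite_iUnion hB.finite
    have h1 : ((⋃ u, B u) ×ˢ (Set.univ : Set Bool)).Finite := hP.prod Set.finite_univ
    have h2 : ((fun e : GridEdge =>
      ((if e.2 then (e.1.1 - 1, e.1.2) else (e.1.1, e.1.2 - 1), e.2) : GridEdge)) ''
        ((⋃ u, B u) ×ˢ (Set.univ : Set Bool))).Finite := h1.image _
    refine (h1.union h2).subset ?_
    intro (e : GridEdge) he
    replace he := he.1
    by_cases hs : ∃ u, e.1 ∈ B u
    · exact Or.inl ⟨by simpa using hs, trivial⟩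
    · by_cases ht : ∃ u, e.tgt ∈ B u
      · refine Or.inr ⟨(e.tgt, e.2), ⟨by simpa using ht, trivial⟩, ?_⟩
        rcases e with ⟨⟨i, j⟩, b⟩
        cases b <;> simp [GridEdge.tgt]
      · exact absurd ((hlab0 hs).trans (hlab0 ht).symm) he
  have hX := grid_twoGenerated.inf_supported hD
  set Z := LinearMap.ker (bdry GridEdge.ends) ⊓ Finsupp.supported (ZMod 2) (ZMod 2) Dᶜ
  let R : (GridEdge →₀ ZMod 2) →ₗ[ZMod 2] (I →₀ ZMod 2) := Finsupp.lcomapDomain φ hφinj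
  have hR : ∀ x i, R x i = x (φ i) := fun x i => rfl
  have hRφ : ∀ i a, R (Finsupp.single (φ i) a) = Finsupp.single i a := by
    intro i a
    ext j
    simp [hR, Finsupp.single_apply, hφinj.eq_iff]
  have hR0 : ∀ e a, e ∉ Set.range φ → R (Finsupp.single e a) = 0 := by
    intro e a he
    ext j
    rw [hR, Finsupp.single_apply, if_neg (fun h => he ⟨j, h.symm⟩)]; rfl
  let Lab := Finsupp.linearCombination (ZMod 2) lab
  -- pushing forward commutes with the boundary on chains avoiding `D`
  have hpush : ∀ C ∈ Finsupp.supported (ZMod 2) (ZMod 2) Dᶜ,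
      bdry ends (R C) = Lab (bdry GridEdge.ends C) := by
    intro C hC
    rw [Finsupp.supported_eq_span_single] at hC
    induction hC using Submodule.span_induction with
    | zero => simp
    | add x y _ _ hx hy => simp only [map_add, hx, hy]
    | smul a x _ hx => simp only [map_smul, hx]
    | mem x hx =>
      obtain ⟨e, he, rfl⟩ := hx
      by_cases her : e ∈ Set.range φ
      · obtain ⟨i, rfl⟩ := her
        rw [hRφ, bdry_single, bdry_single, hφe, GridEdge.ends, endChain_mk, endChain_mk, map_add]
        simp [Lab, hlab (hφs i), hlab (hφt i)]
      · have : lab e.1 = lab e.tgt := by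
          by_contra h
          exact he ⟨h, her⟩
        dsimp only
        rw [hR0 e 1 her, bdry_single, GridEdge.ends, endChain_mk, map_add, map_zero]
        simp [Lab, this, add_self_two]
  choose r hr using fun u => (hB.conn u).1
  have hpth : ∀ u p, ∃ c : GridEdge →₀ ZMod 2, p ∈ B u →
      c ∈ Finsupp.supported (ZMod 2) (ZMod 2) {e : GridEdge | e.1 ∈ B u ∧ e.tgt ∈ B u} ∧
      bdry GridEdge.ends c = Finsupp.single p 1 + Finsupp.single (r u) 1 := by
    intro u p
    by_cases hp : p ∈ B u
    · obtain ⟨c, hc⟩ := (hB.conn u).exists_chain hp (hr u)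
      exact ⟨c, fun _ => hc⟩
    · exact ⟨0, fun h => absurd h hp⟩
  choose pth hpth using hpth
  have hins : ∀ {u} {e : GridEdge}, e.1 ∈ B u → e.tgt ∈ B u → e ∉ Set.range φ := by
    rintro u _ h1 h2 ⟨i, rfl⟩
    exact hφne i ((huniq (hφs i) h1).trans (huniq h2 (hφt i)))
  have hpD : ∀ u p, p ∈ B u → pth u p ∈ Finsupp.supported (ZMod 2) (ZMod 2) Dᶜ := by
    intro u p hp
    refine Finsupp.supported_mono ?_ (hpth u p hp).1
    rintro e ⟨h1, h2⟩ he
    exact he.1 ((hlab h1).trans (hlab h2).symm)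
  have hpR : ∀ u p, p ∈ B u → R (pth u p) = 0 := by
    intro u p hp
    ext j
    rw [hR]
    have := (Finsupp.mem_supported' _ _).1 (hpth u p hp).1 (φ j)
      (fun h => hins h.1 h.2 ⟨j, rfl⟩)
    simpa using this
  let lift : I → (GridEdge →₀ ZMod 2) := fun i =>
    Finsupp.single (φ i) 1 + pth (φs i) (φ i).1 + pth (φt i) (φ i).tgt
  let Λ := Finsupp.linearCombination (ZMod 2) lift
  have hRΛ : ∀ x, R (Λ x) = x := by
    intro x
    induction x using Finsupp.induction_linear with
    | zero => simp
    | add f g hf hg => simp only [map_add, hf, hg]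
    | single i a =>
      simp only [Λ, Finsupp.linearCombination_single, map_smul, lift, map_add, hRφ,
        hpR _ _ (hφs i), hpR _ _ (hφt i)]
      simp
  have hΛD : ∀ x, Λ x ∈ Finsupp.supported (ZMod 2) (ZMod 2) Dᶜ := by
    intro x
    have : LinearMap.range Λ ≤ Finsupp.supported (ZMod 2) (ZMod 2) Dᶜ := by
      rw [Finsupp.range_linearCombination, Submodule.span_le]
      rintro _ ⟨i, rfl⟩
      refine Submodule.add_mem _ (Submodule.add_mem _ ?_ (hpD _ _ (hφs i))) (hpD _ _ (hφt i))
      exact Finsupp.single_mem_supported _ _ (fun h => h.2 ⟨i, rfl⟩)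
    exact this ⟨x, rfl⟩
  have hbΛ : ∀ x, bdry GridEdge.ends (Λ x) =
      Finsupp.lmapDomain (ZMod 2) (ZMod 2) r (bdry ends x) := by
    intro x
    induction x using Finsupp.induction_linear with
    | zero => simp
    | add f g hf hg => simp only [map_add, hf, hg]
    | single i a =>
      have h1 : Finsupp.single i a = a • Finsupp.single i (1 : ZMod 2) := by simp
      rw [h1, map_smul, map_smul, map_smul, map_smul]
      congr 1
      simp only [Λ, Finsupp.linearCombination_single, one_smul, lift, map_add,
        (hpth _ _ (hφs i)).2, (hpth _ _ (hφt i)).2, bdry_single, hφe, GridEdge.ends,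
        endChain_mk, Finsupp.lmapDomain_apply, Finsupp.mapDomain_single]
      have := add_self_two (Finsupp.single (φ i).1 (1 : ZMod 2))
      have := add_self_two (Finsupp.single (φ i).tgt (1 : ZMod 2))
      grind
  have hZ : Z.map R = LinearMap.ker (bdry ends) := by
    apply le_antisymm
    · rintro _ ⟨C, ⟨hC1, hC2⟩, rfl⟩
      rw [LinearMap.mem_ker, hpush C hC2, LinearMap.mem_ker.1 hC1, map_zero]
    · intro x hx
      refine ⟨Λ x, ⟨?_, hΛD x⟩, hRΛ x⟩
      rw [SetLike.mem_coe, LinearMap.mem_ker, hbΛ, LinearMap.mem_ker.1 hx, map_zero]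
  obtain ⟨S, hS, h2⟩ := hX
  refine ⟨R '' S, by rw [Submodule.span_image, hS, hZ], ?_⟩
  rintro i _ ⟨a, ha, rfl⟩ _ ⟨b, hb, rfl⟩ _ ⟨c, hc, rfl⟩ h1 h2' h3
  rcases h2 (φ i) a ha b hb c hc h1 h2' h3 with h | h | h <;> simp [h]

theorem sum_endChain {U : Type*} [Fintype U] (z : Sym2 U) : ∑ u, endChain z u = 0 := by
  induction z with | _ a b
  classical
  simp only [endChain_mk, Finsupp.add_apply, Finset.sum_add_distrib, Finsupp.single_apply,
    Finset.sum_ite_eq, Finset.mem_univ, if_true]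
  decide

theorem endChain_apply {U : Type*} [DecidableEq U] {z : Sym2 U} (hz : ¬ z.IsDiag) (u : U) :
    endChain z u = if u ∈ z then 1 else 0 := by
  induction z with | _ a b
  rw [Sym2.mk_isDiag_iff] at hz
  simp only [endChain_mk, Finsupp.add_apply, Finsupp.single_apply, Sym2.mem_iff]
  by_cases h1 : a = u <;> by_cases h2 : b = u
  · exact absurd (h1.trans h2.symm) hz
  all_goals simp [h1, h2, eq_comm (a := u)]

/-- Euler's inequality in MacLane's form: a grid minor has a family of more than `|I| - |U|`
nonempty even edge sets covering every edge at most twice. -/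
theorem GridModel.exists_face_family {U I : Type*} [Fintype U] [Nonempty U] [Fintype I]
    [DecidableEq U] [DecidableEq I] {ends : I → Sym2 U}
    {B : U → Set (ℤ × ℤ)} (hB : GridModel ends B) (hinj : Function.Injective ends)
    (hdiag : ∀ i, ¬ (ends i).IsDiag) :
    ∃ F : Finset (Finset I), Fintype.card I + 1 ≤ F.card + Fintype.card U ∧
      (∀ s ∈ F, s.Nonempty ∧ ∀ u, Even (s.filter (fun i => u ∈ ends i)).card) ∧
      ∀ i, (F.filter (fun s => i ∈ s)).card ≤ 2 := by
  obtain ⟨S, hS, h2⟩ := hB.twoGenerated hinj hdiag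
  obtain ⟨T, hTS, hspan, hli⟩ := exists_linearIndependent (ZMod 2) S
  rw [hS] at hspan
  have hTfin : T.Finite := hli.setFinite
  have hsupp : ∀ x y : I →₀ ZMod 2, x.support = y.support → x = y := by
    intro x y h
    ext i
    by_cases hx : x i = 0
    · have : i ∉ y.support := by rw [← h]; simpa using hx
      rw [hx, Finsupp.notMem_support_iff.1 this]
    · have : i ∈ y.support := by rw [← h]; simpa using hx
      rw [zmod_two_eq_one hx, zmod_two_eq_one (Finsupp.mem_support_iff.1 this)]
  have hTker : ∀ x ∈ T, bdry ends x = 0 := by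
    intro x hx
    have : x ∈ LinearMap.ker (bdry ends) := hspan ▸ Submodule.subset_span hx
    exact this
  refine ⟨hTfin.toFinset.image Finsupp.support, ?_, ?_, ?_⟩
  · rw [Finset.card_image_of_injective _ (fun x y h => hsupp x y h)]
    have hcard : hTfin.toFinset.card = Module.finrank (ZMod 2) (LinearMap.ker (bdry ends)) := by
      rw [← hspan, ← Set.ncard_eq_toFinset_card T hTfin]
      have := hTfin.fintype
      rw [finrank_span_set_eq_card hli, Set.ncard_eq_toFinset_card']
    have hrn := LinearMap.finrank_range_add_finrank_ker (bdry ends)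
    have hlt : Module.finrank (ZMod 2) (LinearMap.range (bdry ends)) <
        Module.finrank (ZMod 2) (U →₀ ZMod 2) := by
      apply Submodule.finrank_lt
      intro htop
      let σ : (U →₀ ZMod 2) →ₗ[ZMod 2] ZMod 2 :=
        Finsupp.linearCombination (ZMod 2) (fun _ => (1 : ZMod 2))
      have hσ : ∀ x, σ x = ∑ u, x u := fun x => by
        simp [σ, Finsupp.linearCombination_apply, Finsupp.sum_fintype]
      have hle : LinearMap.range (bdry ends) ≤ LinearMap.ker σ := by
        rw [bdry, Finsupp.range_linearCombination, Submodule.span_le]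
        rintro _ ⟨i, rfl⟩
        rw [SetLike.mem_coe, LinearMap.mem_ker, hσ, sum_endChain]
      obtain ⟨u⟩ := ‹Nonempty U›
      have hu : Finsupp.single u (1 : ZMod 2) ∈ LinearMap.ker σ := by
        apply hle; rw [htop]; trivial
      rw [LinearMap.mem_ker] at hu
      simp [σ] at hu
    rw [Module.finrank_finsupp_self] at hrn hlt
    omega
  · intro s hs
    obtain ⟨x, hx, rfl⟩ := Finset.mem_image.1 hs
    rw [Set.Finite.mem_toFinset] at hx
    refine ⟨?_, fun u => ?_⟩
    · rw [Finsupp.support_nonempty_iff]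
      exact hli.ne_zero ⟨x, hx⟩
    · have h := DFunLike.congr_fun (hTker x hx) u
      rw [bdry, Finsupp.linearCombination_apply, Finsupp.sum, Finsupp.finsetSum_apply] at h
      rw [← ZMod.natCast_eq_zero_iff_even, Finset.card_filter, Nat.cast_sum]
      refine Eq.trans (Finset.sum_congr rfl fun i hi => ?_) h
      rw [Finsupp.smul_apply, zmod_two_eq_one (Finsupp.mem_support_iff.1 hi), one_smul,
        endChain_apply (hdiag i)]
      simp
  · intro i
    by_contra! hcon
    obtain ⟨a, b, c, ha, hb, hc, hab, hac, hbc⟩ := Finset.two_lt_card_iff.1 hcon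
    simp only [Finset.mem_filter, Finset.mem_image, Set.Finite.mem_toFinset] at ha hb hc
    obtain ⟨⟨x, hx, rfl⟩, hxi⟩ := ha
    obtain ⟨⟨y, hy, rfl⟩, hyi⟩ := hb
    obtain ⟨⟨z, hz, rfl⟩, hzi⟩ := hc
    rcases h2 i x (hTS hx) y (hTS hy) z (hTS hz) (Finsupp.mem_support_iff.1 hxi)
      (Finsupp.mem_support_iff.1 hyi) (Finsupp.mem_support_iff.1 hzi) with h | h | h
    · exact hab (by rw [h])
    · exact hac (by rw [h])
    · exact hbc (by rw [h])

theorem GridClosedIn.inter {Y A Y' : Set (ℤ × ℤ)} (h : GridClosedIn Y A) (hY : Y' ⊆ Y) :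
    GridClosedIn Y' (A ∩ Y') := fun e h1 h2 => by
  have := h e (hY h1) (hY h2)
  simp [this, h1, h2]

theorem GridConn.subset_of_closed {Y A B : Set (ℤ × ℤ)} (hB : GridConn B) (hBY : B ⊆ Y)
    (hA : GridClosedIn Y A) {p : ℤ × ℤ} (hpA : p ∈ A) (hpB : p ∈ B) : B ⊆ A :=
  (hB.2 (A ∩ B) Set.inter_subset_right ⟨p, hpA, hpB⟩ (hA.inter hBY)).trans Set.inter_subset_left

theorem gridConn_of_forall {B : Set (ℤ × ℤ)} {p : ℤ × ℤ} (hp : p ∈ B)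
    (h : ∀ q ∈ B, ∃ Y ⊆ B, GridConn Y ∧ p ∈ Y ∧ q ∈ Y) : GridConn B := by
  refine ⟨⟨p, hp⟩, fun A hAB ⟨a, ha⟩ hA q hq => ?_⟩
  obtain ⟨Y, hYB, hY, hpY, haY⟩ := h a (hAB ha)
  obtain ⟨Y', hYB', hY', hpY', hqY'⟩ := h q hq
  have hpA := hY.subset_of_closed hYB hA ha haY hpY
  exact hY'.subset_of_closed hYB' hA hpA hpY' hqY'

theorem GridConn.union {B C : Set (ℤ × ℤ)} (hB : GridConn B) (hC : GridConn C)
    {p : ℤ × ℤ} (hpB : p ∈ B) (hpC : p ∈ C) : GridConn (B ∪ C) := by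
  refine gridConn_of_forall (Or.inl hpB) ?_
  rintro q (hq | hq)
  · exact ⟨B, Set.subset_union_left, hB, hpB, hq⟩
  · exact ⟨C, Set.subset_union_right, hC, hpC, hq⟩

/-- Every point of a set of grid points lies in a connected component of it. -/
theorem exists_gridComponent {Y : Set (ℤ × ℤ)} {p : ℤ × ℤ} (hp : p ∈ Y) :
    ∃ A ⊆ Y, GridConn A ∧ p ∈ A ∧ GridClosedIn Y A := by
  let A : Set (ℤ × ℤ) := {q | q ∈ Y ∧ ∀ A', GridClosedIn Y A' → p ∈ A' → q ∈ A'}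
  have hAY : A ⊆ Y := fun q hq => hq.1
  have hA : GridClosedIn Y A := by
    intro e h1 h2
    constructor
    · exact fun h => ⟨h2, fun A' hA' hpA' => (hA' e h1 h2).1 (h.2 A' hA' hpA')⟩
    · exact fun h => ⟨h1, fun A' hA' hpA' => (hA' e h1 h2).2 (h.2 A' hA' hpA')⟩
  refine ⟨A, hAY, ⟨⟨p, hp, fun _ _ h => h⟩, fun A' hA'A ⟨a, ha⟩ hA' => ?_⟩,
    ⟨hp, fun _ _ h => h⟩, hA⟩
  have hA'Y : GridClosedIn Y A' := by
    intro e h1 h2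
    have h := hA e h1 h2
    by_cases h3 : e.1 ∈ A
    · exact hA' e h3 (h.1 h3)
    · exact ⟨fun h4 => absurd (hA'A h4) h3, fun h4 => absurd (h.2 (hA'A h4)) h3⟩
  by_cases hpA' : p ∈ A'
  · exact fun q hq => hq.2 A' hA'Y hpA'
  · have hc : GridClosedIn Y A'ᶜ := fun e h1 h2 => not_congr (hA'Y e h1 h2)
    exact absurd ha ((hA'A ha).2 A'ᶜ hc hpA')

/-- In a connected set meeting `T`, some connected set avoiding `T` joins a given point to
a neighbour of `T`. -/
theorem GridConn.exists_approach {Y T : Set (ℤ × ℤ)} (hY : GridConn Y) {p : ℤ × ℤ}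
    (hp : p ∈ Y) (hpT : p ∉ T) (hT : (Y ∩ T).Nonempty) :
    ∃ A ⊆ Y \ T, GridConn A ∧ p ∈ A ∧
      ∃ e : GridEdge, (e.1 ∈ A ∧ e.tgt ∈ T) ∨ (e.tgt ∈ A ∧ e.1 ∈ T) := by
  obtain ⟨A, hAY, hA, hpA, hcl⟩ := exists_gridComponent (Y := Y \ T) ⟨hp, hpT⟩
  refine ⟨A, hAY, hA, hpA, ?_⟩
  by_contra! hno
  have hAcl : GridClosedIn Y A := by
    intro e h1 h2
    have := hno e
    constructor
    · intro h
      exact (hcl e (hAY h) ⟨h2, this.1 h⟩).1 h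
    · intro h
      exact (hcl e ⟨h1, this.2 h⟩ (hAY h)).2 h
  obtain ⟨q, hq, hqT⟩ := hT
  exact (hAY (hY.subset_of_closed subset_rfl hAcl hpA hp hq)).2 hqT

theorem int_iff_of_ordConnected {J : Set ℤ} (hJ : J.OrdConnected) {P : ℤ → Prop}
    (h : ∀ n, n ∈ J → n + 1 ∈ J → (P n ↔ P (n + 1))) {a b : ℤ} (ha : a ∈ J) (hb : b ∈ J) :
    P a ↔ P b := by
  have key : ∀ a b : ℤ, a ∈ J → a ≤ b → b ∈ J → (P a ↔ P b) := by
    intro a b ha hab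
    induction b, hab using Int.leInduction with
    | base => exact fun _ => Iff.rfl
    | succ n hn ih =>
      intro hb
      have : n ∈ J := hJ.out ha hb ⟨hn, by omega⟩
      exact (ih this).trans (h n this hb)
  rcases le_total a b with hab | hab
  · exact key a b ha hab hb
  · exact (key b a hb hab ha).symm

/-- The point of the plane with grid coordinates `p` and mesh `δ`. -/
def gridPoint (δ : ℝ) (p : ℤ × ℤ) : ℝ × ℝ := (δ * p.1, δ * p.2)

/-- The grid points of mesh `δ` at distance less than `ρ` from `C`. -/
def gridNbhd (δ ρ : ℝ) (C : Set (ℝ × ℝ)) : Set (ℤ × ℤ) :=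
  gridPoint δ ⁻¹' Metric.thickening ρ C

theorem exists_gridPoint_dist_le {δ : ℝ} (hδ : 0 < δ) (x : ℝ × ℝ) :
    ∃ p, dist (gridPoint δ p) x ≤ δ := by
  have key : ∀ y : ℝ, |δ * ⌊y / δ⌋ - y| ≤ δ := by
    intro y
    have h1 := Int.floor_le (y / δ)
    have h2 := Int.lt_floor_add_one (y / δ)
    rw [le_div_iff₀ hδ] at h1
    rw [div_lt_iff₀ hδ] at h2
    rw [abs_le]
    constructor <;> nlinarith
  refine ⟨(⌊x.1 / δ⌋, ⌊x.2 / δ⌋), ?_⟩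
  rw [Prod.dist_eq, Real.dist_eq, Real.dist_eq]
  exact max_le (key _) (key _)

theorem gridNbhd_finite {δ ρ : ℝ} (hδ : 0 < δ) {C : Set (ℝ × ℝ)} (hC : Bornology.IsBounded C) :
    (gridNbhd δ ρ C).Finite := by
  obtain ⟨M, hM⟩ := (hC.thickening (δ := ρ)).subset_closedBall (0 : ℝ × ℝ)
  have : gridNbhd δ ρ C ⊆ Set.Icc (-⌈M / δ⌉) ⌈M / δ⌉ ×ˢ Set.Icc (-⌈M / δ⌉) ⌈M / δ⌉ := by
    intro p hp
    have h : dist (gridPoint δ p) 0 ≤ M := hM hp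
    rw [Prod.dist_eq, max_le_iff, Real.dist_eq, Real.dist_eq] at h
    simp only [gridPoint, Prod.fst_zero, Prod.snd_zero, sub_zero] at h
    have key : ∀ n : ℤ, |δ * n| ≤ M → n ∈ Set.Icc (-⌈M / δ⌉) ⌈M / δ⌉ := by
      intro n hn
      rw [abs_mul, abs_of_pos hδ, mul_comm, ← le_div_iff₀ hδ] at hn
      have := (abs_le.1 (hn.trans (Int.le_ceil _)))
      constructor
      · have h := this.1
        exact_mod_cast h
      · have h := this.2
        exact_mod_cast h
    exact ⟨key _ h.1, key _ h.2⟩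
  exact ((Set.finite_Icc _ _).prod (Set.finite_Icc _ _)).subset this

theorem ball_iff_of_gridClosedIn {δ ρ : ℝ} (hδ : 0 < δ) {x : ℝ × ℝ} {A : Set (ℤ × ℤ)}
    (hA : GridClosedIn (gridPoint δ ⁻¹' Metric.ball x ρ) A) {p q : ℤ × ℤ}
    (hp : gridPoint δ p ∈ Metric.ball x ρ) (hq : gridPoint δ q ∈ Metric.ball x ρ) :
    p ∈ A ↔ q ∈ A := by
  have hmem : ∀ a b : ℤ, gridPoint δ (a, b) ∈ Metric.ball x ρ ↔
      δ * a ∈ Metric.ball x.1 ρ ∧ δ * b ∈ Metric.ball x.2 ρ := by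
    intro a b
    simp only [Metric.mem_ball, Prod.dist_eq, max_lt_iff, gridPoint]
  have hord : ∀ y : ℝ, {n : ℤ | δ * n ∈ Metric.ball y ρ}.OrdConnected := by
    intro y
    refine ⟨fun a ha b hb c hc => ?_⟩
    have h1 : δ * (a : ℝ) ≤ δ * c := mul_le_mul_of_nonneg_left (by exact_mod_cast hc.1) hδ.le
    have h2 : δ * (c : ℝ) ≤ δ * b := mul_le_mul_of_nonneg_left (by exact_mod_cast hc.2) hδ.le
    simp only [Set.mem_ofPred_eq, Real.ball_eq_Ioo, Set.mem_Ioo] at ha hb ⊢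
    exact ⟨ha.1.trans_le h1, h2.trans_lt hb.2⟩
  obtain ⟨a, b⟩ := p
  obtain ⟨c, d⟩ := q
  rw [hmem] at hp hq
  have h1 : (a, b) ∈ A ↔ (c, b) ∈ A := by
    refine int_iff_of_ordConnected (P := fun n => (n, b) ∈ A) (hord x.1) ?_ hp.1 hq.1
    intro n hn hn'
    exact hA ((n, b), true) ((hmem _ _).2 ⟨hn, hp.2⟩) ((hmem _ _).2 ⟨hn', hp.2⟩)
  have h2 : (c, b) ∈ A ↔ (c, d) ∈ A := by
    refine int_iff_of_ordConnected (P := fun n => (c, n) ∈ A) (hord x.2) ?_ hp.2 hq.2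
    intro n hn hn'
    exact hA ((c, n), false) ((hmem _ _).2 ⟨hq.1, hn⟩) ((hmem _ _).2 ⟨hq.1, hn'⟩)
  exact h1.trans h2

theorem gridNbhd_conn {δ ρ : ℝ} (hδ : 0 < δ) (hρ : 2 * δ ≤ ρ) {C : Set (ℝ × ℝ)}
    (hC : IsPreconnected C) (hne : C.Nonempty) : GridConn (gridNbhd δ ρ C) := by
  have hball : ∀ x ∈ C, ∀ p, gridPoint δ p ∈ Metric.ball x ρ → p ∈ gridNbhd δ ρ C := by
    intro x hx p hp
    exact Metric.mem_thickening_iff.2 ⟨x, hx, hp⟩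
  refine ⟨?_, fun A hAY hAne hA => ?_⟩
  · obtain ⟨x, hx⟩ := hne
    obtain ⟨p, hp⟩ := exists_gridPoint_dist_le hδ x
    exact ⟨p, hball x hx p (by rw [Metric.mem_ball]; linarith)⟩
  · have hiff : ∀ x ∈ C, ∀ p q, gridPoint δ p ∈ Metric.ball x ρ →
        gridPoint δ q ∈ Metric.ball x ρ → (p ∈ A ↔ q ∈ A) := by
      intro x hx p q hp hq
      refine ball_iff_of_gridClosedIn hδ (fun e h1 h2 => ?_) hp hq
      exact hA e (hball x hx _ h1) (hball x hx _ h2)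
    let P : ℝ × ℝ → Prop := fun x => ∃ p ∈ A, gridPoint δ p ∈ Metric.ball x ρ
    have hnear : ∀ x ∈ C, ∀ y ∈ C, dist x y < δ → P x → P y := by
      rintro x hx y hy hxy ⟨p, hpA, hp⟩
      obtain ⟨q, hq⟩ := exists_gridPoint_dist_le hδ x
      refine ⟨q, (hiff x hx p q hp (by rw [Metric.mem_ball]; linarith)).1 hpA, ?_⟩
      rw [Metric.mem_ball]
      have := dist_triangle (gridPoint δ q) x y
      linarith
    have hall : ∀ x ∈ C, P x := by
      by_contra! hcon
      obtain ⟨y, hy, hPy⟩ := hcon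
      obtain ⟨p, hp⟩ := hAne
      obtain ⟨x, hx, hpx⟩ := Metric.mem_thickening_iff.1 (hAY hp)
      have hδ2 : 0 < δ / 2 := by linarith
      obtain ⟨z, -, hz1, hz2⟩ := hC (Metric.thickening (δ / 2) {x | x ∈ C ∧ P x})
        (Metric.thickening (δ / 2) {x | x ∈ C ∧ ¬ P x}) Metric.isOpen_thickening
        Metric.isOpen_thickening
        (fun w hw => by
          by_cases h : P w
          · exact Or.inl (Metric.self_subset_thickening hδ2 _ ⟨hw, h⟩)
          · exact Or.inr (Metric.self_subset_thickening hδ2 _ ⟨hw, h⟩))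
        ⟨x, hx, Metric.self_subset_thickening hδ2 _ ⟨hx, p, hp, hpx⟩⟩
        ⟨y, hy, Metric.self_subset_thickening hδ2 _ ⟨hy, hPy⟩⟩
      obtain ⟨u, ⟨hu, hPu⟩, hzu⟩ := Metric.mem_thickening_iff.1 hz1
      obtain ⟨v, ⟨hv, hPv⟩, hzv⟩ := Metric.mem_thickening_iff.1 hz2
      refine hPv (hnear u hu v hv ?_ hPu)
      have := dist_triangle_left u v z
      linarith
    intro q hq
    obtain ⟨x, hx, hqx⟩ := Metric.mem_thickening_iff.1 hq
    obtain ⟨p, hp, hpx⟩ := hall x hx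
    exact (hiff x hx p q hpx hqx).1 hp

/-- `S` is the relative interior of a path from `a` to `b` in the plane. -/
def OpenArc (S : Set (ℝ × ℝ)) (a b : ℝ × ℝ) : Prop :=
  ∃ γ : ℝ → ℝ × ℝ, ContinuousOn γ (Set.Icc 0 1) ∧ γ 0 = a ∧ γ 1 = b ∧ γ '' Set.Ioo 0 1 = S

theorem OpenArc.exists_closed {S : Set (ℝ × ℝ)} {a b : ℝ × ℝ} (h : OpenArc S a b) :
    IsCompact (S ∪ {a, b}) ∧ IsPreconnected (S ∪ {a, b}) := by
  obtain ⟨γ, hγ, rfl, rfl, rfl⟩ := h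
  have : γ '' Set.Ioo 0 1 ∪ {γ 0, γ 1} = γ '' Set.Icc 0 1 := by
    rw [← Set.Ioo_union_both zero_le_one, Set.image_union, Set.image_pair]
  rw [this]
  exact ⟨isCompact_Icc.image_of_continuousOn hγ, isPreconnected_Icc.image _ hγ⟩

theorem OpenArc.closure_subset {S : Set (ℝ × ℝ)} {a b : ℝ × ℝ} (h : OpenArc S a b) :
    closure S ⊆ S ∪ {a, b} :=
  closure_minimal Set.subset_union_left h.exists_closed.1.isClosed

theorem OpenArc.exists_core {S : Set (ℝ × ℝ)} {a b : ℝ × ℝ} (h : OpenArc S a b) {ε : ℝ}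
    (hε : 0 < ε) : ∃ C ⊆ S, IsCompact C ∧ IsPreconnected C ∧
      (∃ x ∈ C, dist x a < ε) ∧ (∃ x ∈ C, dist x b < ε) := by
  obtain ⟨γ, hγ, rfl, rfl, rfl⟩ := h
  obtain ⟨η, hη, h0⟩ := Metric.continuousWithinAt_iff.1 (hγ 0 (by simp)) ε hε
  obtain ⟨θ, hθ, h1⟩ := Metric.continuousWithinAt_iff.1 (hγ 1 (by simp)) ε hε
  set s := min (η / 2) (1 / 3)
  set t := min (θ / 2) (1 / 3)
  have hs : 0 < s := by positivity
  have ht : 0 < t := by positivity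
  have hs1 : s ≤ η / 2 := min_le_left _ _
  have ht1 : t ≤ θ / 2 := min_le_left _ _
  have hs2 : s ≤ 1 / 3 := min_le_right _ _
  have ht2 : t ≤ 1 / 3 := min_le_right _ _
  have hsub : Set.Icc s (1 - t) ⊆ Set.Icc 0 1 := Set.Icc_subset_Icc hs.le (by linarith)
  refine ⟨γ '' Set.Icc s (1 - t), Set.image_mono fun x hx => ⟨?_, ?_⟩,
    isCompact_Icc.image_of_continuousOn (hγ.mono hsub),
    isPreconnected_Icc.image _ (hγ.mono hsub), ⟨γ s, ⟨s, ⟨le_rfl, by linarith⟩, rfl⟩, ?_⟩,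
    ⟨γ (1 - t), ⟨1 - t, ⟨by linarith, le_rfl⟩, rfl⟩, ?_⟩⟩
  · linarith [hx.1]
  · linarith [hx.2]
  · refine h0 ⟨hs.le, by linarith⟩ ?_
    rw [Real.dist_eq, sub_zero, abs_of_pos hs]; linarith
  · refine h1 ⟨by linarith, by linarith⟩ ?_
    rw [Real.dist_eq, abs_lt]
    constructor <;> linarith

theorem exists_uniform_pos {J : Type*} [Finite J] {P : J → ℝ → Prop}
    (hanti : ∀ j a b, a ≤ b → P j b → P j a) (h : ∀ j, ∃ δ > 0, P j δ) :
    ∃ δ > 0, ∀ j, P j δ := by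
  choose δ hδ hP using h
  rcases isEmpty_or_nonempty J with hJ | hJ
  · exact ⟨1, one_pos, fun j => (hJ.false j).elim⟩
  · obtain ⟨j, hj⟩ := Finite.exists_min δ
    exact ⟨δ j, hδ j, fun i => hanti i _ _ (hj i) (hP i)⟩

/-- A topological drawing of a multigraph without crossings, in which vertices may be
drawn as arbitrary continua, yields a grid minor. -/
theorem exists_gridModel {U I : Type*} [Finite U] [Finite I] {ends : I → Sym2 U}
    {K : U → Set (ℝ × ℝ)} (hdiag : ∀ i, ¬ (ends i).IsDiag)
    (hKc : ∀ u, IsCompact (K u)) (hKp : ∀ u, IsPreconnected (K u)) (hKn : ∀ u, (K u).Nonempty)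
    (hKd : ∀ u w, u ≠ w → Disjoint (K u) (K w)) {L : I → Set (ℝ × ℝ)}
    (hLd : ∀ i j, i ≠ j → Disjoint (L i) (L j)) (hLK : ∀ i u, Disjoint (L i) (K u))
    (hL : ∀ i, ∃ u w a b, ends i = s(u, w) ∧ OpenArc (L i) a b ∧ a ∈ K u ∧ b ∈ K w) :
    ∃ B : U → Set (ℤ × ℤ), GridModel ends B := by
  choose src tgt a b hends harc ha hb using hL
  have hne : ∀ i, src i ≠ tgt i := fun i h => hdiag i (by rw [hends, h]; simp)
  obtain ⟨r₁, hr₁, hKK⟩ := exists_uniform_pos (J := U × U)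
    (P := fun j δ => j.1 ≠ j.2 →
      Disjoint (Metric.thickening δ (K j.1)) (Metric.thickening δ (K j.2)))
    (fun j x y hxy h hj => (h hj).mono (Metric.thickening_mono hxy _) (Metric.thickening_mono hxy _))
    (fun j => by
      by_cases hj : j.1 = j.2
      · exact ⟨1, one_pos, fun h => absurd hj h⟩
      · obtain ⟨δ, hδ, h⟩ := (hKd _ _ hj).exists_thickenings (hKc _) (hKc _).isClosed
        exact ⟨δ, hδ, fun _ => h⟩)
  obtain ⟨r₂, hr₂, hLK'⟩ := exists_uniform_pos (J := I × U)
    (P := fun j δ => j.2 ∉ ends j.1 →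
      Disjoint (Metric.thickening δ (K j.2)) (Metric.thickening δ (L j.1)))
    (fun j x y hxy h hj => (h hj).mono (Metric.thickening_mono hxy _) (Metric.thickening_mono hxy _))
    (fun j => by
      obtain ⟨i, u⟩ := j
      by_cases hj : u ∈ ends i
      · exact ⟨1, one_pos, fun h => absurd hj h⟩
      · have hd : Disjoint (K u) (closure (L i)) := by
          refine Disjoint.mono_right (harc i).closure_subset ?_
          rw [hends, Sym2.mem_iff, not_or] at hj
          rw [Set.disjoint_union_right]
          refine ⟨(hLK i u).symm, ?_⟩
          rw [Set.disjoint_insert_right, Set.disjoint_singleton_right]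
          exact ⟨fun h => Set.disjoint_left.1 (hKd _ _ hj.1) h (ha i),
            fun h => Set.disjoint_left.1 (hKd _ _ hj.2) h (hb i)⟩
        obtain ⟨δ, hδ, h⟩ := hd.exists_thickenings (hKc _) isClosed_closure
        rw [Metric.thickening_closure] at h
        exact ⟨δ, hδ, fun _ => h⟩)
  set r := min r₁ r₂
  have hr : 0 < r := lt_min hr₁ hr₂
  choose C hCL hCc hCp hCa hCb using fun i => (harc i).exists_core (half_pos hr)
  obtain ⟨s, hs, hCC⟩ := exists_uniform_pos (J := I × I)
    (P := fun j δ => j.1 ≠ j.2 →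
      Disjoint (Metric.thickening δ (C j.1)) (Metric.thickening δ (C j.2)))
    (fun j x y hxy h hj => (h hj).mono (Metric.thickening_mono hxy _) (Metric.thickening_mono hxy _))
    (fun j => by
      by_cases hj : j.1 = j.2
      · exact ⟨1, one_pos, fun h => absurd hj h⟩
      · obtain ⟨δ, hδ, h⟩ := ((hLd _ _ hj).mono (hCL _) (hCL _)).exists_thickenings
          (hCc _) (hCc _).isClosed
        exact ⟨δ, hδ, fun _ => h⟩)
  set ρ := min s (r / 2)
  have hρ : 0 < ρ := lt_min hs (half_pos hr)
  have hρs : ρ ≤ s := min_le_left _ _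
  have hρr : ρ ≤ r / 2 := min_le_right _ _
  set δ := ρ / 2
  have hδ : 0 < δ := half_pos hρ
  have hδρ : 2 * δ = ρ := by simp only [δ]; ring
  let B : U → Set (ℤ × ℤ) := fun u => gridNbhd δ r (K u)
  let Q : I → Set (ℤ × ℤ) := fun i => gridNbhd δ ρ (C i)
  have hBconn : ∀ u, GridConn (B u) := fun u =>
    gridNbhd_conn hδ (by linarith) (hKp u) (hKn u)
  have hQconn : ∀ i, GridConn (Q i) := fun i =>
    gridNbhd_conn hδ hδρ.le (hCp i) (let ⟨x, hx, _⟩ := hCa i; ⟨x, hx⟩)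
  have hBB : ∀ u w p, u ≠ w → p ∈ B u → p ∉ B w := fun u w p huw hu hw =>
    Set.disjoint_left.1 (hKK (u, w) huw) (Metric.thickening_mono (min_le_left _ _) _ hu)
      (Metric.thickening_mono (min_le_left _ _) _ hw)
  have hQQ : ∀ i j p, i ≠ j → p ∈ Q i → p ∉ Q j := fun i j p hij hi hj =>
    Set.disjoint_left.1 (hCC (i, j) hij) (Metric.thickening_mono hρs _ hi)
      (Metric.thickening_mono hρs _ hj)
  have hQB : ∀ i u p, p ∈ Q i → p ∈ B u → u = src i ∨ u = tgt i := by
    intro i u p hi hu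
    by_contra h
    rw [← Sym2.mem_iff, ← hends] at h
    refine Set.disjoint_left.1 (hLK' (i, u) h) (Metric.thickening_mono (min_le_right _ _) _ hu) ?_
    refine Metric.thickening_subset_of_subset _ (hCL i) (Metric.thickening_mono ?_ _ hi)
    exact (hρr.trans (half_le_self hr.le)).trans (min_le_right _ _)
  have hmeet : ∀ i u x, x ∈ K u → (∃ y ∈ C i, dist y x < r / 2) → ∃ p, p ∈ Q i ∧ p ∈ B u := by
    rintro i u x hx ⟨y, hy, hyx⟩
    obtain ⟨p, hp⟩ := exists_gridPoint_dist_le hδ y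
    refine ⟨p, Metric.mem_thickening_iff.2 ⟨y, hy, by linarith⟩,
      Metric.mem_thickening_iff.2 ⟨x, hx, ?_⟩⟩
    have := dist_triangle (gridPoint δ p) y x
    linarith
  choose base hbase using fun u => (hBconn u).1
  have happ : ∀ i, ∃ A ⊆ (B (src i) ∪ Q i) \ B (tgt i), GridConn A ∧ base (src i) ∈ A ∧
      ∃ e : GridEdge, (e.1 ∈ A ∧ e.tgt ∈ B (tgt i)) ∨ (e.tgt ∈ A ∧ e.1 ∈ B (tgt i)) := by
    intro i
    obtain ⟨p, hpQ, hpB⟩ := hmeet i _ _ (ha i) (hCa i)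
    obtain ⟨q, hqQ, hqB⟩ := hmeet i _ _ (hb i) (hCb i)
    exact ((hBconn _).union (hQconn i) hpB hpQ).exists_approach (Or.inl (hbase _))
      (hBB _ _ _ (hne i) (hbase _)) ⟨q, Or.inr hqQ, hqB⟩
  choose A hA hAconn hAbase hAe using happ
  refine ⟨fun u => B u ∪ ⋃ (i : I) (_ : src i = u), A i, ?_, ?_, ?_, ?_⟩
  · intro u
    refine (gridNbhd_finite hδ (hKc u).isBounded).union ?_
    refine Set.finite_iUnion fun i => Set.finite_iUnion fun _ => ?_
    exact ((gridNbhd_finite hδ (hKc (src i)).isBounded).union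
      (gridNbhd_finite hδ (hCc i).isBounded)).subset ((hA i).trans Set.sdiff_subset)
  · intro u
    refine gridConn_of_forall (p := base u) (Or.inl (hbase u)) ?_
    rintro q (hq | hq)
    · exact ⟨B u, Set.subset_union_left, hBconn u, hbase u, hq⟩
    · obtain ⟨i, rfl, hq'⟩ := Set.mem_iUnion₂.1 hq
      refine ⟨A i, ?_, hAconn i, hAbase i, hq'⟩
      exact fun x hx => Or.inr (Set.mem_iUnion₂.2 ⟨i, rfl, hx⟩)
  · intro u w huw
    have hBA : ∀ p u j, u ≠ src j → p ∈ B u → p ∉ A j := by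
      intro p u j huj hu hj
      rcases (hA j hj).1 with h | h
      · exact hBB _ _ p huj hu h
      · rcases hQB j u p h hu with h' | h'
        · exact huj h'
        · exact (hA j hj).2 (h' ▸ hu)
    rw [Set.disjoint_left]
    rintro p (hp | hp) (hq | hq)
    · exact hBB u w p huw hp hq
    · obtain ⟨j, rfl, hq'⟩ := Set.mem_iUnion₂.1 hq
      exact hBA p u j huw hp hq'
    · obtain ⟨i, rfl, hp'⟩ := Set.mem_iUnion₂.1 hp
      exact hBA p w i huw.symm hq hp'
    · obtain ⟨i, rfl, hp'⟩ := Set.mem_iUnion₂.1 hp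
      obtain ⟨j, rfl, hq'⟩ := Set.mem_iUnion₂.1 hq
      rcases (hA i hp').1 with h | h
      · exact hBA p _ j huw h hq'
      · rcases (hA j hq').1 with h' | h'
        · exact hBA p _ i huw.symm h' hp'
        · exact hQQ i j p (fun hij => huw (by rw [hij])) h h'
  · intro i
    have hAsub : ∀ p ∈ A i, p ∈ B (src i) ∪ ⋃ (j : I) (_ : src j = src i), A j :=
      fun p hp => Or.inr (Set.mem_iUnion₂.2 ⟨i, rfl, hp⟩)
    obtain ⟨e, he | he⟩ := hAe i
    · exact ⟨e, src i, tgt i, hends i, hAsub _ he.1, Or.inl he.2⟩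
    · exact ⟨e, tgt i, src i, by rw [hends, Sym2.eq_swap], Or.inl he.2, hAsub _ he.1⟩

theorem OpenArc.of_continuousOn {γ : ℝ → ℝ × ℝ} (hγ : ContinuousOn γ (Set.Icc 0 1)) {a b : ℝ}
    (ha : 0 ≤ a) (hab : a < b) (hb : b ≤ 1) : OpenArc (γ '' Set.Ioo a b) (γ a) (γ b) := by
  have hba : 0 < b - a := sub_pos.2 hab
  refine ⟨fun s => γ ((b - a) * s + a), ?_, by simp, by simp, ?_⟩
  · refine hγ.comp (by fun_prop) fun s hs => ⟨?_, ?_⟩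
    · have := mul_nonneg hba.le hs.1
      linarith
    · have := mul_le_mul_of_nonneg_left hs.2 hba.le
      linarith
  · have h : (fun s => γ ((b - a) * s + a)) = γ ∘ fun s => (b - a) * s + a := rfl
    rw [h, Set.image_comp, Set.image_affine_Ioo hba]
    simp

theorem OpenArc.symm {S : Set (ℝ × ℝ)} {a b : ℝ × ℝ} (h : OpenArc S a b) : OpenArc S b a := by
  obtain ⟨γ, hγ, h0, h1, rfl⟩ := h
  refine ⟨fun s => γ (1 - s), ?_, by simpa, by simpa, ?_⟩
  · refine hγ.comp (by fun_prop) fun s hs => ⟨?_, ?_⟩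
    · linarith [hs.2]
    · linarith [hs.1]
  · have h : (fun s => γ (1 - s)) = γ ∘ fun s => 1 - s := rfl
    rw [h, Set.image_comp, Set.image_const_sub_Ioo]
    simp

/-- The endpoints of the edges of a planarization: `c e` is the crossing point of an edge `e`
in `P`, and the edges in `P` are cut in two there. -/
def planarEnds {V : Type*} {G : SimpleGraph V} (c : G.edgeSet → ℝ × ℝ) (P : Set G.edgeSet) :
    {e // e ∉ P} ⊕ {p : G.edgeSet × V // p.1 ∈ P ∧ p.2 ∈ (p.1 : Sym2 V)} → Sym2 (V ⊕ (c '' P))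
  | .inl e => Sym2.map Sum.inl (e : Sym2 V)
  | .inr p => s(.inl p.1.2, .inr ⟨c p.1.1, p.1.1, p.2.1, rfl⟩)

theorem planarEnds_not_isDiag {V : Type*} {G : SimpleGraph V} {c : G.edgeSet → ℝ × ℝ}
    {P : Set G.edgeSet} : ∀ i, ¬ (planarEnds c P i).IsDiag := by
  rintro (⟨⟨e, he⟩, _⟩ | p)
  · induction e using Sym2.ind with
    | _ x y =>
      have : x ≠ y := ((SimpleGraph.mem_edgeSet G).1 he).ne
      simpa [planarEnds] using this
  · simp [planarEnds]

section Drawing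

variable {V : Type*} {G : SimpleGraph V} (D : OnePlanarDrawing G)

/-- The interior of an edge of a drawing. -/
def edgeInterior (e : G.edgeSet) : Set (ℝ × ℝ) := D.arc e '' Set.Ioo 0 1

theorem exists_openArc (e : G.edgeSet) : ∃ u w, (e : Sym2 V) = s(u, w) ∧
    OpenArc (edgeInterior D e) (D.pos u) (D.pos w) := by
  obtain ⟨u, w, he, h0, h1⟩ := D.arc_ends e
  exact ⟨u, w, he, h0 ▸ h1 ▸ OpenArc.of_continuousOn (D.arc_cont e) le_rfl one_pos le_rfl⟩

theorem pos_notMem_edgeInterior (e : G.edgeSet) (v : V) : D.pos v ∉ edgeInterior D e := by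
  rintro ⟨t, ht, h⟩
  exact D.arc_avoids e t ht ⟨v, h.symm⟩

/-- Every edge has a point at which all its crossings take place. -/
theorem exists_crossing_point (e : G.edgeSet) : ∃ x ∈ edgeInterior D e,
    ∀ f, f ≠ e → ∀ y ∈ edgeInterior D e, y ∈ edgeInterior D f → y = x := by
  by_cases h : ∃ f, f ≠ e ∧ (edgeInterior D e ∩ edgeInterior D f).Nonempty
  · obtain ⟨f, hf, x, hx⟩ := h
    refine ⟨x, hx.1, fun g hg y hy hy' => ?_⟩
    obtain rfl : g = f := D.at_most_one_crossing e ⟨hg, y, hy, hy'⟩ ⟨hf, x, hx⟩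
    exact D.crossings_subsingleton e g hg.symm ⟨hy, hy'⟩ hx
  · exact ⟨D.arc e (1 / 2), ⟨1 / 2, by norm_num, rfl⟩,
      fun f hf y hy hy' => absurd ⟨f, hf, y, hy, hy'⟩ h⟩

/-- An edge cut at an interior point falls into two half-edges. -/
theorem exists_halves {e : G.edgeSet} {x : ℝ × ℝ} (hx : x ∈ edgeInterior D e) :
    ∃ h : V → Set (ℝ × ℝ), (∀ v ∈ (e : Sym2 V), OpenArc (h v) (D.pos v) x ∧
      h v ⊆ edgeInterior D e ∧ x ∉ h v) ∧
      ∀ v ∈ (e : Sym2 V), ∀ w ∈ (e : Sym2 V), v ≠ w → Disjoint (h v) (h w) := by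
  classical
  obtain ⟨u, w, he, h0, h1⟩ := D.arc_ends e
  obtain ⟨t, ht, rfl⟩ := hx
  have huw : w ≠ u := by
    rintro rfl
    exact G.irrefl ((SimpleGraph.mem_edgeSet G).1 (he ▸ e.2))
  have hinj : ∀ s ∈ Set.Ioo (0 : ℝ) 1, ∀ s' ∈ Set.Ioo (0 : ℝ) 1, D.arc e s = D.arc e s' → s = s' :=
    fun s hs s' hs' => D.arc_inj e (Set.Ioo_subset_Icc_self hs) (Set.Ioo_subset_Icc_self hs')
  have hl : Set.Ioo 0 t ⊆ Set.Ioo 0 1 := Set.Ioo_subset_Ioo_right ht.2.le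
  have hr : Set.Ioo t 1 ⊆ Set.Ioo 0 1 := Set.Ioo_subset_Ioo_left ht.1.le
  have hd : Disjoint (D.arc e '' Set.Ioo 0 t) (D.arc e '' Set.Ioo t 1) := by
    rw [Set.disjoint_left]
    rintro _ ⟨s, hs, rfl⟩ ⟨s', hs', h⟩
    have := hinj _ (hr hs') _ (hl hs) h
    linarith [hs.2, hs'.1]
  refine ⟨fun v => if v = u then D.arc e '' Set.Ioo 0 t else D.arc e '' Set.Ioo t 1, ?_, ?_⟩
  · intro v hv
    rw [he, Sym2.mem_iff] at hv
    obtain rfl | rfl := hv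
    · simp only [if_true]
      refine ⟨h0 ▸ .of_continuousOn (D.arc_cont e) le_rfl ht.1 ht.2.le, Set.image_mono hl, ?_⟩
      rintro ⟨s, hs, h⟩
      have := hinj _ (hl hs) _ ht h
      linarith [hs.2]
    · simp only [if_neg huw]
      refine ⟨h1 ▸ (OpenArc.of_continuousOn (D.arc_cont e) ht.1.le ht.2 le_rfl).symm,
        Set.image_mono hr, ?_⟩
      rintro ⟨s, hs, h⟩
      have := hinj _ (hr hs) _ ht h
      linarith [hs.1]
  · intro v hv v' hv' hne
    rw [he, Sym2.mem_iff] at hv hv'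
    rcases hv with rfl | rfl <;> rcases hv' with rfl | rfl
    · exact absurd rfl hne
    · simpa [huw] using hd
    · simpa [huw] using hd.symm
    · exact absurd rfl hne

/-- A 1-planar drawing yields a planar one in which the crossings of pairs of disjoint edges
are vertices, and no other crossings are left. -/
theorem exists_planarization [Finite V] (D : OnePlanarDrawing G) :
    ∃ (c : G.edgeSet → ℝ × ℝ) (P : Set G.edgeSet),
      (∀ e ∈ P, ∃ f ∈ P, f ≠ e ∧ c f = c e) ∧
      (∀ e ∈ P, ∀ f ∈ P, f ≠ e → c f = c e → ∀ v ∈ (e : Sym2 V), v ∉ (f : Sym2 V)) ∧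
      ∃ B, GridModel (planarEnds c P) B := by
  choose c hc hcross using exists_crossing_point D
  choose h harc hdisj using fun e => exists_halves D (hc e)
  set R := edgeInterior D with hR
  have hsymm : ∀ {e f x}, f ≠ e → x ∈ R e → x ∈ R f → x = c e ∧ x = c f := fun {e f x} hf h1 h2 =>
    ⟨hcross e f hf x h1 h2, hcross f e hf.symm x h2 h1⟩
  have huniq : ∀ {e f f'}, f ≠ e → f' ≠ e → c e ∈ R f → c e ∈ R f' → f = f' :=
    fun {e f f'} hf hf' h1 h2 =>
      D.at_most_one_crossing e ⟨hf, c e, hc e, h1⟩ ⟨hf', c e, hc e, h2⟩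
  let Crossed : G.edgeSet → Prop := fun e => ∃ f, f ≠ e ∧ c e ∈ R f
  let Bad : G.edgeSet → V → Prop := fun e v => v ∈ (e : Sym2 V) ∧ ∃ f, f ≠ e ∧ c e ∈ R f ∧
    v ∈ (f : Sym2 V)
  let P : Set G.edgeSet := {e | ∃ f, f ≠ e ∧ c e ∈ R f ∧ ∀ v ∈ (e : Sym2 V), v ∉ (f : Sym2 V)}
  have hPBad : ∀ {e v}, e ∈ P → ¬ Bad e v := by
    rintro e v ⟨f, hf, hcf, hd⟩ ⟨hv, f', hf', hcf', hv'⟩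
    exact hd v hv (huniq hf' hf hcf' hcf ▸ hv')
  have hPcross : ∀ {e f}, e ∈ P → f ≠ e → c e ∈ R f → ∀ v ∈ (e : Sym2 V), v ∉ (f : Sym2 V) := by
    rintro e f ⟨f', hf', hcf', hd⟩ hf hcf
    exact huniq hf' hf hcf' hcf ▸ hd
  have hBadEq : ∀ {e f v w}, Bad e v → Bad f w → c e ∈ R f → v = w := by
    rintro e f v w ⟨hve, f', hf', hcf', hvf'⟩ ⟨hwf, e', he', hce', hwe'⟩ hef
    by_contra hvw
    have key : ∀ e₁ e₂ : G.edgeSet, e₁ ≠ e₂ → v ∈ (e₁ : Sym2 V) → w ∈ (e₁ : Sym2 V) →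
        v ∈ (e₂ : Sym2 V) → w ∈ (e₂ : Sym2 V) → False := fun e₁ e₂ hne h1 h2 h3 h4 =>
      hne (Subtype.ext (((Sym2.mem_and_mem_iff hvw).1 ⟨h1, h2⟩).trans
        ((Sym2.mem_and_mem_iff hvw).1 ⟨h3, h4⟩).symm))
    by_cases hfe : f = e
    · subst hfe
      obtain rfl := huniq hf' he' hcf' hce'
      exact key _ _ hf' hvf' hwe' hve hwf
    · obtain rfl := huniq hf' hfe hcf' hef
      have hcc := hsymm hfe (hc e) hef
      obtain rfl := huniq (e := f') he' (Ne.symm hfe) hce' (hcc.2 ▸ hc e)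
      exact key _ _ hfe hvf' hwf hve hwe'
  have hedge : ∀ e : {e // e ∉ P}, ∃ S a b u w, ((e : G.edgeSet) : Sym2 V) = s(u, w) ∧
      OpenArc S a b ∧ (a = D.pos u ∨ Bad e u ∧ a = c e) ∧ b = D.pos w ∧ S ⊆ R e ∧
      (c e ∈ S → ¬ Crossed e) ∧ ∀ v, Bad e v → Disjoint S (h e v) := by
    rintro ⟨e, he⟩
    by_cases hcr : Crossed e
    · have : ∃ v, Bad e v := by
        obtain ⟨f, hf, hcf⟩ := hcr
        by_contra! hno
        exact he ⟨f, hf, hcf, fun v hv hvf => hno v ⟨hv, f, hf, hcf, hvf⟩⟩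
      obtain ⟨v, hv⟩ := this
      obtain ⟨w, hw⟩ := hv.1
      have hvw : v ≠ w := by
        rintro rfl
        exact G.irrefl ((SimpleGraph.mem_edgeSet G).1 (hw ▸ e.2))
      have hwe : w ∈ (e : Sym2 V) := by rw [hw]; simp
      obtain ⟨h1, h2, h3⟩ := harc e w hwe
      refine ⟨h e w, c e, D.pos w, v, w, hw, h1.symm, Or.inr ⟨hv, rfl⟩, rfl, h2,
        fun h => absurd h h3, fun v' hv' => ?_⟩
      obtain rfl := hBadEq hv hv' (hc e)
      exact hdisj e _ hwe _ hv.1 hvw.symm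
    · obtain ⟨u, w, hends, ha⟩ := exists_openArc D e
      exact ⟨R e, D.pos u, D.pos w, u, w, hends, ha, Or.inl rfl, rfl, subset_rfl, fun _ => hcr,
        fun v hv => absurd (let ⟨_, f, hf, hcf, _⟩ := hv; ⟨f, hf, hcf⟩) hcr⟩
  choose S a b u w hends hS ha hb hSR hSc hSd using hedge
  let K : V ⊕ (c '' P) → Set (ℝ × ℝ)
    | .inl v => {D.pos v} ∪ ⋃ (e : G.edgeSet) (_ : Bad e v), (h e v ∪ {D.pos v, c e})
    | .inr x => {x.1}
  have hK : ∀ v x, x ∈ K (.inl v) → x = D.pos v ∨ ∃ e, Bad e v ∧ (x ∈ h e v ∨ x = c e) := by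
    rintro v x (hx | hx)
    · exact Or.inl hx
    · obtain ⟨e, he, hx | hx | hx⟩ := Set.mem_iUnion₂.1 hx
      · exact Or.inr ⟨e, he, Or.inl hx⟩
      · exact Or.inl hx
      · exact Or.inr ⟨e, he, Or.inr hx⟩
  have hKR : ∀ {e v x}, Bad e v → (x ∈ h e v ∨ x = c e) → x ∈ R e := by
    rintro e v x he (hx | rfl)
    · exact (harc e v he.1).2.1 hx
    · exact hc e
  let L : {e // e ∉ P} ⊕ {p : G.edgeSet × V // p.1 ∈ P ∧ p.2 ∈ (p.1 : Sym2 V)} → Set (ℝ × ℝ)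
    | .inl e => S e
    | .inr p => h p.1.1 p.1.2
  have hPP : ∀ e ∈ P, ∃ f ∈ P, f ≠ e ∧ c f = c e := by
    rintro e ⟨f, hf, hcf, hd⟩
    have hcc := hsymm hf (hc e) hcf
    exact ⟨f, ⟨e, hf.symm, hcc.2 ▸ hc e, fun v hv hve => hd v hve hv⟩, hf, hcc.2.symm⟩
  refine ⟨c, P, hPP, ?_, exists_gridModel (K := K) (L := L) ?_ ?_ ?_ ?_ ?_ ?_ ?_ ?_⟩
  · intro e he f hf hfe hcc
    exact hPcross he hfe (hcc ▸ hc f)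
  · exact planarEnds_not_isDiag
  · rintro (v | x)
    · refine isCompact_singleton.union (Set.Finite.isCompact_biUnion (Set.toFinite _) ?_)
      exact fun e he => (harc e v he.1).1.exists_closed.1
    · exact isCompact_singleton
  · rintro (v | x)
    · refine isPreconnected_of_forall (D.pos v) ?_
      rintro y (hy | hy)
      · exact ⟨{D.pos v}, Set.subset_union_left, rfl, hy, isPreconnected_singleton⟩
      · obtain ⟨e, he, hy'⟩ := Set.mem_iUnion₂.1 hy
        refine ⟨_, ?_, ?_, hy', (harc e v he.1).1.exists_closed.2⟩
        · exact fun z hz => Or.inr (Set.mem_iUnion₂.2 ⟨e, he, hz⟩)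
        · exact Or.inr (Or.inl rfl)
    · exact isPreconnected_singleton
  · rintro (v | x)
    · exact ⟨D.pos v, Or.inl rfl⟩
    · exact ⟨x, rfl⟩
  · have hKX : ∀ v (x : c '' P), Disjoint (K (.inl v)) (K (.inr x)) := by
      rintro v ⟨_, f, hf, rfl⟩
      rw [Set.disjoint_singleton_right]
      intro hx
      obtain hx | ⟨e, he, hx⟩ := hK _ _ hx
      · exact pos_notMem_edgeInterior D f v (hx ▸ hc f)
      · have hxe := hKR he hx
        by_cases hfe : e = f
        · exact hPBad hf (hfe ▸ he)
        · have hcc := hsymm hfe (hc f) hxe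
          obtain ⟨hve, f', hf', hcf', hvf'⟩ := he
          obtain rfl := huniq hf' (Ne.symm hfe) hcf' (hcc.2 ▸ hc f)
          exact hPcross hf hfe hxe v hvf' hve
    rintro (v | x) (w | y) hne
    · have hvw : v ≠ w := fun h => hne (by rw [h])
      rw [Set.disjoint_left]
      intro x hx hx'
      obtain hx | ⟨e, he, hx⟩ := hK _ _ hx <;> obtain hx' | ⟨f, hf, hx'⟩ := hK _ _ hx'
      · exact hvw (D.pos_inj (hx.symm.trans hx'))
      · exact pos_notMem_edgeInterior D f v (hx ▸ hKR hf hx')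
      · exact pos_notMem_edgeInterior D e w (hx' ▸ hKR he hx)
      · have hxe := hKR he hx
        have hxf := hKR hf hx'
        refine hvw (hBadEq he hf ?_)
        by_cases hfe : f = e
        · exact hfe ▸ hc f
        · exact (hsymm hfe hxe hxf).1 ▸ hxf
    · exact hKX v y
    · exact (hKX w x).symm
    · exact Set.disjoint_singleton.2 fun h => hne (by rw [Subtype.ext h])
  · have hSL : ∀ e f x, f ≠ e.1 → x ∈ S e → x ∉ R f := fun e f x hf hx hxf => by
      obtain rfl := (hsymm hf (hSR e hx) hxf).1
      exact hSc e hx ⟨f, hf, hxf⟩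
    rintro (e | ⟨⟨e, v⟩, he, hv⟩) (f | ⟨⟨f, w⟩, hf, hw⟩) hne <;> rw [Set.disjoint_left] <;>
      intro x hx hx'
    · exact hSL e f x (fun h => hne (by rw [Subtype.ext h])) hx (hSR f hx')
    · exact hSL e f x (fun h => e.2 (h ▸ hf)) hx ((harc f w hw).2.1 hx')
    · exact hSL f e x (fun h => f.2 (h ▸ he)) hx' ((harc e v hv).2.1 hx)
    · by_cases hfe : f = e
      · subst hfe
        refine Set.disjoint_left.1 (hdisj f v hv w hw fun h => hne ?_) hx hx'
        subst h
        rfl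
      · obtain rfl := (hsymm hfe ((harc e v hv).2.1 hx) ((harc f w hw).2.1 hx')).1
        exact (harc e v hv).2.2 hx
  · rintro (e | ⟨⟨e, v⟩, he, hv⟩) (w | ⟨_, f, hf, rfl⟩) <;> rw [Set.disjoint_left] <;>
      intro x hx hx'
    · obtain rfl | ⟨f, hf, hx'⟩ := hK _ _ hx'
      · exact pos_notMem_edgeInterior D e w (hSR e hx)
      · by_cases hfe : f = e.1
        · subst hfe
          obtain hx' | rfl := hx'
          · exact Set.disjoint_left.1 (hSd e w hf) hx hx'
          · obtain ⟨_, f, hf, hcf, _⟩ := hf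
            exact hSc e hx ⟨f, hf, hcf⟩
        · have hxf := hKR hf hx'
          obtain rfl := (hsymm hfe (hSR e hx) hxf).1
          exact hSc e hx ⟨f, hfe, hxf⟩
    · obtain rfl : x = c f := hx'
      have hfe : f ≠ e.1 := fun h => e.2 (h ▸ hf)
      have hcc := hsymm hfe (hSR e hx) (hc f)
      exact hSc e (hcc.1 ▸ hx) ⟨f, hfe, hcc.1 ▸ hc f⟩
    · have hxe := (harc e v hv).2.1 hx
      obtain rfl | ⟨f, hf, hx'⟩ := hK _ _ hx'
      · exact pos_notMem_edgeInterior D e w hxe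
      · by_cases hfe : f = e
        · exact hPBad he (hfe ▸ hf)
        · obtain rfl := (hsymm hfe hxe (hKR hf hx')).1
          exact (harc e v hv).2.2 hx
    · obtain rfl : x = c f := hx'
      have hxe := (harc e v hv).2.1 hx
      by_cases hfe : f = e
      · subst hfe
        exact (harc f v hv).2.2 hx
      · exact (harc e v hv).2.2 ((hsymm hfe hxe (hc f)).1 ▸ hx)
  · rintro (e | ⟨⟨e, v⟩, he, hv⟩)
    · refine ⟨.inl (u e), .inl (w e), a e, b e, by simp [planarEnds, hends], hS e, ?_,
        Or.inl (hb e)⟩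
      rcases ha e with h | ⟨h, h'⟩
      · exact Or.inl h
      · exact Or.inr (Set.mem_iUnion₂.2 ⟨e, h, Or.inr (Or.inr h')⟩)
    · exact ⟨.inl v, .inr ⟨c e, e, he, rfl⟩, D.pos v, c e, rfl, (harc e v hv).1, Or.inl rfl, rfl⟩

end Drawing

section Faces

variable {U I : Type*} [DecidableEq U] {ends : I → Sym2 U} {s : Finset I}

theorem exists_ne_of_even (hs : ∀ u, Even (s.filter fun i => u ∈ ends i).card) {i : I} (hi : i ∈ s)
    {u : U} (hu : u ∈ ends i) : ∃ j ∈ s, j ≠ i ∧ u ∈ ends j := by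
  have hi' : i ∈ s.filter fun i => u ∈ ends i := Finset.mem_filter.2 ⟨hi, hu⟩
  have h1 : 1 < (s.filter fun i => u ∈ ends i).card := by
    obtain ⟨k, hk⟩ := hs u
    have := Finset.card_pos.2 ⟨i, hi'⟩
    omega
  obtain ⟨j, hj, hji⟩ := Finset.exists_mem_ne h1 i
  exact ⟨j, (Finset.mem_filter.1 hj).1, hji, (Finset.mem_filter.1 hj).2⟩

/-- In a simple graph, a nonempty edge set with even degrees has at least three edges, and is a
triangle if it has exactly three. -/
theorem three_le_card_of_even (hinj : Function.Injective ends) (hdiag : ∀ i, ¬ (ends i).IsDiag)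
    (hne : s.Nonempty) (hs : ∀ u, Even (s.filter fun i => u ∈ ends i).card) :
    3 ≤ s.card ∧ (s.card = 3 → ∃ x y z, ∃ i ∈ s, ∃ j ∈ s, ∃ k ∈ s,
      ends i = s(x, y) ∧ ends j = s(x, z) ∧ ends k = s(y, z)) := by
  classical
  obtain ⟨i, hi⟩ := hne
  obtain ⟨⟨x, y⟩, hxy⟩ := Quot.exists_rep (ends i)
  replace hxy : ends i = s(x, y) := hxy.symm
  have hne : ∀ {i x y}, ends i = s(x, y) → x ≠ y := fun {i x y} h hxy =>
    hdiag i (by rw [h, hxy]; simp)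
  obtain ⟨j, hj, hji, z, hxz⟩ := exists_ne_of_even hs hi (show x ∈ ends i by simp [hxy])
  obtain ⟨k, hk, hki, hyk⟩ := exists_ne_of_even hs hi (show y ∈ ends i by simp [hxy])
  have hyz : y ≠ z := fun h => hji (hinj (by rw [hxz, hxy, h]))
  have hkj : k ≠ j := by
    rintro rfl
    rw [hxz, Sym2.mem_iff] at hyk
    exact hyk.elim (hne hxy).symm hyz
  have hsub : {i, j, k} ⊆ s := by simp [Finset.insert_subset_iff, hi, hj, hk]
  have hcard : ({i, j, k} : Finset I).card = 3 :=
    Finset.card_eq_three.2 ⟨i, j, k, hji.symm, hki.symm, hkj.symm, rfl⟩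
  refine ⟨hcard ▸ Finset.card_le_card hsub, fun h3 => ⟨x, y, z, i, hi, j, hj, k, hk, hxy, hxz, ?_⟩⟩
  have hseq := Finset.eq_of_subset_of_card_le hsub (by rw [h3, hcard])
  obtain ⟨l, hl, hlj, hzl⟩ := exists_ne_of_even hs hj (show z ∈ ends j by simp [hxz])
  rw [← hseq] at hl
  simp only [Finset.mem_insert, Finset.mem_singleton] at hl
  obtain rfl | rfl | rfl := hl
  · rw [hxy, Sym2.mem_iff] at hzl
    exact absurd hzl (by simpa using ⟨(hne hxz).symm, hyz.symm⟩)
  · exact absurd rfl hlj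
  · exact (Sym2.mem_and_mem_iff hyz).1 ⟨hyk, hzl⟩

end Faces

theorem mul_card_le_of_cover {I : Type*} [DecidableEq I] {F T : Finset (Finset I)} (hTF : T ⊆ F)
    (hF : ∀ i, (F.filter fun s => i ∈ s).card ≤ 2) {A : Finset I} {k : ℕ}
    (hA : ∀ s ∈ T, k ≤ (A.filter fun i => i ∈ s).card) : k * T.card ≤ 2 * A.card := by
  have := Finset.card_mul_le_card_mul (s := T) (t := A) (fun s i => i ∈ s) (m := k) (n := 2) hA
    fun i _ => (Finset.card_le_card (Finset.filter_subset_filter _ hTF)).trans (hF i)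
  linarith

/-- Discharging: Let a simple graph on `V ⊕ X` with `X` independent have a family of faces as in
Euler's formula. If `d` bounds the degrees of the vertices in `V` and is large enough on average,
then two adjacent vertices in `V` have `d = 7`. -/
theorem exists_adjacent_seven {V X I : Type*} [Fintype V] [Fintype X] [Fintype I] [DecidableEq V]
    [DecidableEq X] [DecidableEq I] {ends : I → Sym2 (V ⊕ X)} (hinj : Function.Injective ends)
    (hdiag : ∀ i, ¬ (ends i).IsDiag) (hX : ∀ i x y, ends i ≠ s(.inr x, .inr y))
    {d : V → ℕ} (hd : ∀ v, 7 ≤ d v)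
    (hdeg : ∀ v, (Finset.univ.filter fun i => .inl v ∈ ends i).card ≤ d v)
    (hsum : ∑ v, d v + 4 * Fintype.card X ≤ 2 * Fintype.card I)
    {F : Finset (Finset I)} (hcard : Fintype.card I + 1 ≤ F.card + Fintype.card (V ⊕ X))
    (heven : ∀ s ∈ F, s.Nonempty ∧ ∀ u, Even (s.filter fun i => u ∈ ends i).card)
    (hF : ∀ i, (F.filter fun s => i ∈ s).card ≤ 2) :
    ∃ i v w, ends i = s(.inl v, .inl w) ∧ d v = 7 ∧ d w = 7 := by
  classical
  by_contra! hno
  have hface := fun s hs => three_le_card_of_even hinj hdiag (heven s hs).1 (heven s hs).2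
  set T := F.filter fun s => s.card = 3
  have hTF : T ⊆ F := Finset.filter_subset _ _
  have hT : 4 * F.card ≤ T.card + 2 * Fintype.card I := by
    have h1 : ∑ s ∈ F, s.card ≤ 2 * Fintype.card I := by
      have h := Finset.sum_card_bipartiteAbove_eq_sum_card_bipartiteBelow
        (s := F) (t := Finset.univ) (fun s (i : I) => i ∈ s)
      simp only [Finset.bipartiteAbove, Finset.bipartiteBelow, Finset.filter_univ_mem] at h
      rw [h]
      refine (Finset.sum_le_card_nsmul _ _ 2 fun i _ => hF i).trans ?_
      simp [mul_comm]
    have h2 : ∑ s ∈ F, 4 ≤ ∑ s ∈ F, s.card + T.card := by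
      rw [Finset.card_filter, ← Finset.sum_add_distrib]
      refine Finset.sum_le_sum fun s hs => ?_
      have := (hface s hs).1
      split_ifs <;> omega
    rw [Finset.sum_const, smul_eq_mul] at h2
    linarith
  let Half : I → Prop := fun i => ∃ x, .inr x ∈ ends i
  let Counted : Finset I → V → Prop := fun s v => (∃ i ∈ s, .inl v ∈ ends i) ∧
    (8 ≤ d v ∨ (∃ i ∈ s, .inl v ∈ ends i ∧ Half i) ∧ ∃ i ∈ s, .inl v ∈ ends i ∧ ¬ Half i)
  have htwo : ∀ s ∈ T, 2 ≤ (Finset.univ.filter fun v => Counted s v).card := by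
    intro s hs
    obtain ⟨hsF, h3⟩ := Finset.mem_filter.1 hs
    suffices h : ∃ v w, v ≠ w ∧ Counted s v ∧ Counted s w by
      obtain ⟨v, w, hvw, hv, hw⟩ := h
      exact Finset.one_lt_card.2 ⟨v, by simpa using hv, w, by simpa using hw, hvw⟩
    have hne : ∀ {i} {v w : V}, ends i = s(.inl v, .inl w) → v ≠ w := fun {i v w} h hvw =>
      hdiag i (by rw [h, hvw]; simp)
    have hmix : ∀ v w t, ∀ i ∈ s, ∀ j ∈ s, ∀ k ∈ s, ends i = s(.inl v, .inl w) →
        ends j = s(.inl v, .inr t) → ends k = s(.inl w, .inr t) →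
        ∃ v w, v ≠ w ∧ Counted s v ∧ Counted s w := by
      intro v w t i hi j hj k hk hvw hvt hwt
      have hih : ¬ Half i := by simp [Half, hvw]
      exact ⟨v, w, hne hvw,
        ⟨⟨i, hi, by simp [hvw]⟩, Or.inr ⟨⟨j, hj, by simp [hvt], t, by simp [hvt]⟩,
          ⟨i, hi, by simp [hvw], hih⟩⟩⟩,
        ⟨⟨i, hi, by simp [hvw]⟩, Or.inr ⟨⟨k, hk, by simp [hwt], t, by simp [hwt]⟩,
          ⟨i, hi, by simp [hvw], hih⟩⟩⟩⟩
    obtain ⟨x, y, z, i, hi, j, hj, k, hk, hxy, hxz, hyz⟩ := (hface s hsF).2 h3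
    rcases x with x | x <;> rcases y with y | y <;> rcases z with z | z
    · have hbig : ∀ v, d v ≠ 7 → (∃ i ∈ s, .inl v ∈ ends i) → Counted s v := fun v hv h =>
        ⟨h, Or.inl (by have := hd v; omega)⟩
      have hx : ∃ i ∈ s, .inl x ∈ ends i := ⟨i, hi, by simp [hxy]⟩
      have hy : ∃ i ∈ s, .inl y ∈ ends i := ⟨i, hi, by simp [hxy]⟩
      have hz : ∃ i ∈ s, .inl z ∈ ends i := ⟨j, hj, by simp [hxz]⟩
      by_cases hx7 : d x = 7
      · exact ⟨y, z, hne hyz, hbig y (hno i x y hxy hx7) hy, hbig z (hno j x z hxz hx7) hz⟩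
      by_cases hy7 : d y = 7
      · exact ⟨x, z, hne hxz, hbig x hx7 hx, hbig z (hno k y z hyz hy7) hz⟩
      · exact ⟨x, y, hne hxy, hbig x hx7 hx, hbig y hy7 hy⟩
    · exact hmix x y z i hi j hj k hk hxy hxz hyz
    · exact hmix x z y j hj i hi k hk hxz hxy (hyz.trans Sym2.eq_swap)
    · exact absurd hyz (hX _ _ _)
    · exact hmix y z x k hk i hi j hj hyz (hxy.trans Sym2.eq_swap) (hxz.trans Sym2.eq_swap)
    · exact absurd hxz (hX _ _ _)
    · exact absurd hxy (hX _ _ _)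
    · exact absurd hxy (hX _ _ _)
  have hN : ∀ v, (T.filter fun s => Counted s v).card + 8 ≤ 2 * d v := by
    intro v
    set N := T.filter fun s => Counted s v
    have hNF : N ⊆ F := (Finset.filter_subset _ _).trans hTF
    set A := Finset.univ.filter fun i => .inl v ∈ ends i
    have hAd : A.card ≤ d v := by convert hdeg v
    by_cases h8 : 8 ≤ d v
    · have h : 2 * N.card ≤ 2 * A.card := mul_card_le_of_cover hNF hF fun s hs => by
        obtain ⟨i, hi, hvi⟩ := (Finset.mem_filter.1 hs).2.1
        obtain ⟨j, hj, hji, hvj⟩ := exists_ne_of_even (heven s (hNF hs)).2 hi hvi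
        exact Finset.one_lt_card.2 ⟨j, by simp [A, hj, hvj], i, by simp [A, hi, hvi], hji⟩
      omega
    · have h7 : d v = 7 := by have := hd v; omega
      have hcount : ∀ s ∈ N, (∃ i ∈ s, .inl v ∈ ends i ∧ Half i) ∧
          ∃ i ∈ s, .inl v ∈ ends i ∧ ¬ Half i := fun s hs =>
        (Finset.mem_filter.1 hs).2.2.resolve_left h8
      have h1 : 1 * N.card ≤ 2 * (A.filter Half).card := mul_card_le_of_cover hNF hF fun s hs => by
        obtain ⟨i, hi, hvi, hh⟩ := (hcount s hs).1
        exact Finset.card_pos.2 ⟨i, by simp [A, hi, hvi, hh]⟩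
      have h2 : 1 * N.card ≤ 2 * (A.filter fun i => ¬ Half i).card :=
        mul_card_le_of_cover hNF hF fun s hs => by
          obtain ⟨i, hi, hvi, hh⟩ := (hcount s hs).2
          exact Finset.card_pos.2 ⟨i, by simp [A, hi, hvi, hh]⟩
      have h3 := Finset.card_filter_add_card_filter_not (s := A) Half
      omega
  have hdouble : 2 * T.card ≤ ∑ v, (T.filter fun s => Counted s v).card := by
    have h := Finset.sum_card_bipartiteAbove_eq_sum_card_bipartiteBelow
      (s := T) (t := Finset.univ) Counted
    simp only [Finset.bipartiteAbove, Finset.bipartiteBelow] at h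
    have h' := Finset.card_nsmul_le_sum _ _ _ htwo
    rw [smul_eq_mul, mul_comm] at h'
    refine h'.trans_eq ?_
    convert h
  have hN' := Finset.sum_le_sum fun v (_ : v ∈ Finset.univ) => hN v
  rw [Finset.sum_add_distrib, Finset.sum_const, smul_eq_mul, Finset.card_univ,
    ← Finset.mul_sum] at hN'
  rw [Fintype.card_sum] at hcard
  omega

section Planarization

variable {V : Type*} {G : SimpleGraph V} {c : G.edgeSet → ℝ × ℝ} {P : Set G.edgeSet}

theorem planarEnds_injective
    (hP : ∀ e ∈ P, ∀ f ∈ P, f ≠ e → c f = c e → ∀ v ∈ (e : Sym2 V), v ∉ (f : Sym2 V)) :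
    Function.Injective (planarEnds c P) := by
  have hne : ∀ (z : Sym2 V) (v : V) (x : c '' P), Sym2.map Sum.inl z ≠ s(.inl v, .inr x) := by
    intro z v x h
    have : Sum.inr x ∈ Sym2.map Sum.inl z := by rw [h]; simp
    simp at this
  rintro (e | ⟨⟨e, v⟩, he, hv⟩) (f | ⟨⟨f, w⟩, hf, hw⟩) h
  · rw [Subtype.ext (Subtype.ext (Sym2.map.injective Sum.inl_injective h))]
  · exact absurd h (hne _ _ _)
  · exact absurd h.symm (hne _ _ _)
  · simp only [planarEnds, Sym2.eq_iff, Sum.inl.injEq, Sum.inr.injEq, reduceCtorEq,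
      false_and, or_false] at h
    obtain ⟨rfl, hc⟩ := h
    by_cases hfe : f = e
    · subst hfe
      rfl
    · exact absurd hw (hP e he f hf hfe (congrArg Subtype.val hc).symm v hv)

theorem card_planarEnds_le [Fintype V] [DecidableRel G.Adj] [DecidableEq V] [DecidableEq (c '' P)]
    [Fintype ({e // e ∉ P} ⊕ {p : G.edgeSet × V // p.1 ∈ P ∧ p.2 ∈ (p.1 : Sym2 V)})] (v : V) :
    (Finset.univ.filter fun i => .inl v ∈ planarEnds c P i).card ≤ G.degree v := by
  rw [← G.card_incidenceFinset_eq_degree]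
  refine Finset.card_le_card_of_injOn (Sum.elim (fun e => (e : Sym2 V)) fun p => (p.1.1 : Sym2 V))
    ?_ ?_
  · rintro (⟨e, he⟩ | ⟨⟨e, w⟩, he, hw⟩) hi
    · simpa [planarEnds, SimpleGraph.incidenceSet] using (Finset.mem_filter.1 hi).2
    · obtain rfl : v = w := by simpa [planarEnds] using (Finset.mem_filter.1 hi).2
      simpa [SimpleGraph.incidenceSet] using hw
  · rintro (⟨e, he⟩ | ⟨⟨e, w⟩, he, hw⟩) hi (⟨f, hf⟩ | ⟨⟨f, w'⟩, hf, hw'⟩) hj h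
    · obtain rfl := Subtype.ext h
      rfl
    · obtain rfl := Subtype.ext h
      exact absurd hf he
    · obtain rfl := Subtype.ext h
      exact absurd he hf
    · obtain rfl := Subtype.ext h
      obtain rfl : v = w := by simpa [planarEnds] using (Finset.mem_filter.1 hi).2
      obtain rfl : v = w' := by simpa [planarEnds] using (Finset.mem_filter.1 hj).2
      rfl

theorem le_card_planarization [Finite V] (hP : ∀ e ∈ P, ∃ f ∈ P, f ≠ e ∧ c f = c e) :
    Nat.card G.edgeSet + 2 * Nat.card (c '' P) ≤
      Nat.card ({e // e ∉ P} ⊕ {p : G.edgeSet × V // p.1 ∈ P ∧ p.2 ∈ (p.1 : Sym2 V)}) := by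
  have h1 : 2 * Nat.card (c '' P) ≤ Nat.card P := by
    have hex : ∀ x : c '' P, ∃ e f : P, e ≠ f ∧ c e = x ∧ c f = x := by
      rintro ⟨_, e, he, rfl⟩
      obtain ⟨f, hf, hfe, hc⟩ := hP e he
      exact ⟨⟨e, he⟩, ⟨f, hf⟩, fun h => hfe (congrArg Subtype.val h).symm, rfl, hc⟩
    choose p q hpq hp hq using hex
    have hinj : Function.Injective (Sum.elim p q) := by
      refine Function.Injective.sumElim ?_ ?_ ?_
      · exact fun x y h => Subtype.ext ((hp x).symm.trans (h ▸ hp y))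
      · exact fun x y h => Subtype.ext ((hq x).symm.trans (h ▸ hq y))
      · intro x y h
        obtain rfl : x = y := Subtype.ext ((hp x).symm.trans (h ▸ hq y))
        exact hpq x h
    have := Nat.card_le_card_of_injective _ hinj
    rw [Nat.card_sum] at this
    omega
  have h2 : 2 * Nat.card P ≤
      Nat.card {p : G.edgeSet × V // p.1 ∈ P ∧ p.2 ∈ (p.1 : Sym2 V)} := by
    have hex : ∀ e : P, ∃ v w, ((e : G.edgeSet) : Sym2 V) = s(v, w) := fun e =>
      Sym2.ind (fun v w => ⟨v, w, rfl⟩) ((e : G.edgeSet) : Sym2 V)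
    choose p q hpq using hex
    let φ : P ⊕ P → {p : G.edgeSet × V // p.1 ∈ P ∧ p.2 ∈ (p.1 : Sym2 V)} :=
      Sum.elim (fun e => ⟨(e, p e), e.2, by rw [hpq]; simp⟩)
        fun e => ⟨(e, q e), e.2, by rw [hpq]; simp⟩
    have hinj : Function.Injective φ := by
      refine Function.Injective.sumElim ?_ ?_ ?_
      · exact fun x y h => Subtype.ext (congrArg (fun p => p.1.1) h)
      · exact fun x y h => Subtype.ext (congrArg (fun p => p.1.1) h)
      · intro x y h
        obtain rfl : x = y := Subtype.ext (congrArg (fun p => p.1.1) h)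
        have hx := hpq x
        rw [show p x = q x from congrArg (fun p => p.1.2) h] at hx
        exact G.irrefl ((SimpleGraph.mem_edgeSet G).1 (hx ▸ x.1.2))
    have := Nat.card_le_card_of_injective _ hinj
    rw [Nat.card_sum] at this
    omega
  have h3 : Nat.card P + Nat.card {e // e ∉ P} = Nat.card G.edgeSet := by
    classical
    rw [← Nat.card_sum]
    exact Nat.card_congr (Equiv.sumCompl (· ∈ P))
  rw [Nat.card_sum]
  omega

end Planarization

end OnePlanar

/-- Every 1-planar graph with minimum degree 7 contains an edge of type (7,7). -/
theorem one_planar_edge_7_7 {V : Type*} [Fintype V] [Nonempty V]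
    (G : SimpleGraph V) [DecidableRel G.Adj] (h1p : G.IsOnePlanar)
    (hmin : ∀ v : V, 7 ≤ G.degree v) :
    ∃ u v : V, G.Adj u v ∧ G.degree u = 7 ∧ G.degree v = 7 := by
  classical
  obtain ⟨D⟩ := h1p
  obtain ⟨c, P, hP, hPd, B, hB⟩ := OnePlanar.exists_planarization D
  have hinj := OnePlanar.planarEnds_injective hPd
  have hdiag := OnePlanar.planarEnds_not_isDiag (c := c) (P := P)
  obtain ⟨F, hcard, heven, hF⟩ := hB.exists_face_family hinj hdiag
  have hle := OnePlanar.le_card_planarization hP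
  have hX : ∀ i x y, OnePlanar.planarEnds c P i ≠ s(.inr x, .inr y) := by
    rintro (e | p) x y h
    · have : Sum.inr x ∈ Sym2.map Sum.inl ((e : G.edgeSet) : Sym2 V) := by
        rw [show Sym2.map Sum.inl _ = _ from h]
        simp
      simp at this
    · simp [OnePlanar.planarEnds] at h
  have hsum : ∑ v, G.degree v + 4 * Fintype.card (c '' P) ≤ 2 * Fintype.card
      ({e // e ∉ P} ⊕ {p : G.edgeSet × V // p.1 ∈ P ∧ p.2 ∈ (p.1 : Sym2 V)}) := by
    rw [G.sum_degrees_eq_twice_card_edges, SimpleGraph.edgeFinset, Set.toFinset_card]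
    simp only [Nat.card_eq_fintype_card] at hle
    linarith
  obtain ⟨i, u, w, hi, hu, hw⟩ := OnePlanar.exists_adjacent_seven hinj hdiag hX hmin
    OnePlanar.card_planarEnds_le hsum hcard heven hF
  refine ⟨u, w, ?_, hu, hw⟩
  rcases i with e | p
  · have : ((e : G.edgeSet) : Sym2 V) = s(u, w) := Sym2.map.injective Sum.inl_injective hi
    exact (SimpleGraph.mem_edgeSet G).1 (this ▸ e.1.2)
  · simp [OnePlanar.planarEnds] at hi
end
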